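/- arXiv:1812.03095 — 2 statements merged into one kernel-verified Lean document; each statement's English description precedes it below -/
import Mathlib

section
/- Let ψ be an admissible obstacle and set α := inf_{γ ∈ P_ψ} E(γ), c₀ = ∫_{-∞}^{∞} (1+s²)^{-5/4} ds, and G(x) = ∫₀ˣ (1+s²)^{-5/4} ds with inverse G^{-1} : (−c₀/2, c₀/2) → ℝ. Then: (i) there exists a ∩-shaped pseudograph γ ∈ P_ψ, concave on the top, with E(γ) = α; (ii) α ≤ c₀²; (iii) if α < c₀², the minimizer γ in (i) can be chosen so that L(γ) ≤ max{ 2(sup_{x∈(0,1)} ψ(x) + ‖ψ'‖_∞) + 1 , G^{-1}(√((α+c₀²)/2) − c₀/2) + √(1 + G^{-1}(√((α+c₀²)/2) − c₀/2)²) } and so that γ has a vertical tangent line at at most one of the two endpoints (i.e., its graph reparametrization u has a finite one-sided derivative at x=0 or at x=1). -/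
open MeasureTheory Set Topology Filter

noncomputable section

/-- A function of class `W^{2,2}(0,1)`, identified with its `C¹([0,1])` representative:
`u` has weak derivatives `du`, `ddu` (encoded through the fundamental theorem of calculus)
with `du, ddu ∈ L¹(0,1)` and `ddu ∈ L²(0,1)`. -/
structure W22 where
  u : ℝ → ℝ
  du : ℝ → ℝ
  ddu : ℝ → ℝ
  du_int : IntegrableOn du (Icc (0:ℝ) 1)
  ddu_int : IntegrableOn ddu (Icc (0:ℝ) 1)
  ddu_sq : IntegrableOn (fun x => (ddu x)^2) (Icc (0:ℝ) 1)
  ftc_u : ∀ x ∈ Icc (0:ℝ) 1, u x = u 0 + ∫ s in (0:ℝ)..x, du s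
  ftc_du : ∀ x ∈ Icc (0:ℝ) 1, du x = du 0 + ∫ s in (0:ℝ)..x, ddu s

/-- The elastic energy of a graph. -/
def graphE (f : W22) : ℝ :=
  ∫ x in Ioo (0:ℝ) 1, (f.ddu x)^2 / (1 + (f.du x)^2) ^ ((5:ℝ)/2)

/-- The length of a graph. -/
def graphLen (f : W22) : ℝ :=
  ∫ x in Ioo (0:ℝ) 1, Real.sqrt (1 + (f.du x)^2)

/-- The length-penalized elastic energy of a graph. -/
def graphPE (ε : ℝ) (f : W22) : ℝ := graphE f + ε * graphLen f

/-- Membership in the admissible class `G_ψ`. -/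
def MemG (ψ : ℝ → ℝ) (f : W22) : Prop :=
  f.u 0 = 0 ∧ f.u 1 = 0 ∧ ∀ x ∈ Icc (0:ℝ) 1, ψ x ≤ f.u x

/-- An admissible obstacle. -/
structure Admissible (ψ : ℝ → ℝ) : Prop where
  cont : ContinuousOn ψ (Icc 0 1)
  neg0 : ψ 0 < 0
  neg1 : ψ 1 < 0
  pos : ∃ x ∈ Icc (0:ℝ) 1, 0 < ψ x
  osd : ∃ C : ℝ, ∀ x ∈ Ioo (0:ℝ) 1,
      (∃ d : ℝ, |d| ≤ C ∧ HasDerivWithinAt ψ d (Ici x) x) ∧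
      (∃ d : ℝ, |d| ≤ C ∧ HasDerivWithinAt ψ d (Iic x) x)

/-- `‖ψ'‖_∞`, the smallest uniform bound for the one-sided derivatives of `ψ` on `(0,1)`. -/
def obstNorm (ψ : ℝ → ℝ) : ℝ :=
  sInf {C : ℝ | 0 ≤ C ∧ ∀ x ∈ Ioo (0:ℝ) 1, ∀ d : ℝ,
    (HasDerivWithinAt ψ d (Ici x) x ∨ HasDerivWithinAt ψ d (Iic x) x) → |d| ≤ C}

/-- A planar curve on `(0,1)` of class `W^{1,1}((0,1);ℝ²)`. -/
structure Curve1 where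
  x : ℝ → ℝ
  y : ℝ → ℝ
  dx : ℝ → ℝ
  dy : ℝ → ℝ
  dx_int : IntegrableOn dx (Icc (0:ℝ) 1)
  dy_int : IntegrableOn dy (Icc (0:ℝ) 1)
  ftc_x : ∀ t ∈ Icc (0:ℝ) 1, x t = x 0 + ∫ s in (0:ℝ)..t, dx s
  ftc_y : ∀ t ∈ Icc (0:ℝ) 1, y t = y 0 + ∫ s in (0:ℝ)..t, dy s

/-- A planar curve of class `W^{1,1}((0,1);ℝ²) ∩ W^{2,1}_loc((0,1);ℝ²)`. -/
structure Curve extends Curve1 where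
  ddx : ℝ → ℝ
  ddy : ℝ → ℝ
  ddx_loc : ∀ a b : ℝ, 0 < a → b < 1 → IntegrableOn ddx (Icc a b)
  ddy_loc : ∀ a b : ℝ, 0 < a → b < 1 → IntegrableOn ddy (Icc a b)
  ftc_dx : ∀ a ∈ Ioo (0:ℝ) 1, ∀ t ∈ Ioo (0:ℝ) 1, dx t = dx a + ∫ s in a..t, ddx s
  ftc_dy : ∀ a ∈ Ioo (0:ℝ) 1, ∀ t ∈ Ioo (0:ℝ) 1, dy t = dy a + ∫ s in a..t, ddy s

/-- `|γ'(t)|`. -/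
def speed1 (γ : Curve1) (t : ℝ) : ℝ := Real.sqrt ((γ.dx t)^2 + (γ.dy t)^2)

/-- The length `L(γ) = ∫₀¹ |γ'| dt`, as an extended real number. -/
def len1E (γ : Curve1) : ENNReal := ∫⁻ t in Ioo (0:ℝ) 1, ENNReal.ofReal (speed1 γ t)

/-- The length `L(γ)`, as a real number. -/
def len1 (γ : Curve1) : ℝ := ∫ t in Ioo (0:ℝ) 1, speed1 γ t

def lenE (γ : Curve) : ENNReal := len1E γ.toCurve1

/-- The integrand `⟨γ'', N_γ⟩²/|γ'|³` of the elastic energy. -/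
def elInt (γ : Curve) (t : ℝ) : ℝ :=
  (γ.dx t * γ.ddy t - γ.dy t * γ.ddx t)^2 / ((γ.dx t)^2 + (γ.dy t)^2) ^ ((5:ℝ)/2)

/-- Elastic energy of a curve, as an extended real number. -/
def elE (γ : Curve) : ENNReal := ∫⁻ t in Ioo (0:ℝ) 1, ENNReal.ofReal (elInt γ t)

/-- The length-penalized elastic energy `E_ε = E + ε·L`. -/
def penE (ε : ℝ) (γ : Curve) : ENNReal := elE γ + ENNReal.ofReal ε * lenE γ

/-- A curve is immersed if `|γ'| > ε` on `(0,1)` for some `ε > 0`. -/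
def Curve.Immersed (γ : Curve) : Prop :=
  ∃ ε > 0, ∀ t ∈ Ioo (0:ℝ) 1, ε < speed1 γ.toCurve1 t

/-- `u` lies in `W^{2,2}_loc(c,d)` with weak derivatives `du`, `ddu`. -/
structure W22locOn (u du ddu : ℝ → ℝ) (c d : ℝ) : Prop where
  du_loc : ∀ a b : ℝ, c < a → b < d → IntegrableOn du (Icc a b)
  ddu_loc : ∀ a b : ℝ, c < a → b < d → IntegrableOn ddu (Icc a b)
  ddu_sq : ∀ a b : ℝ, c < a → b < d → IntegrableOn (fun t => (ddu t)^2) (Icc a b)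
  ftc_u : ∀ a ∈ Ioo c d, ∀ t ∈ Ioo c d, u t = u a + ∫ s in a..t, du s
  ftc_du : ∀ a ∈ Ioo c d, ∀ t ∈ Ioo c d, du t = du a + ∫ s in a..t, ddu s

/-- `γ` is a pseudograph. -/
def Pseudograph (γ : Curve) : Prop :=
  γ.Immersed ∧ (∀ t ∈ Ioo (0:ℝ) 1, 0 ≤ γ.dx t) ∧
  ∀ a b : ℝ, 0 ≤ a → a < b → b ≤ 1 → (∀ t ∈ Ioo a b, 0 < γ.dx t) →
    ∃ u du ddu : ℝ → ℝ, W22locOn u du ddu (γ.x a) (γ.x b) ∧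
      ∀ t ∈ Ioo a b, u (γ.x t) = γ.y t

/-- Membership in `P_ψ`. -/
def MemP (ψ : ℝ → ℝ) (γ : Curve) : Prop :=
  Pseudograph γ ∧ γ.x 0 = 0 ∧ γ.y 0 = 0 ∧ γ.x 1 = 1 ∧ γ.y 1 = 0 ∧
  ∀ t ∈ Icc (0:ℝ) 1, ψ (γ.x t) ≤ γ.y t

/-- `v : (a,b) → (c,d)` is invertible in `W^{1,1}` (increasing case): it has an
inverse `w` which is again of class `W^{1,1}`. -/
def InvertibleW11On (v : ℝ → ℝ) (a b c d : ℝ) : Prop :=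
  ∃ w dw : ℝ → ℝ, IntegrableOn dw (Icc c d) ∧
    (∀ s ∈ Icc c d, w s = w c + ∫ r in c..s, dw r) ∧
    (∀ t ∈ Ioo a b, v t ∈ Ioo c d ∧ w (v t) = t) ∧
    (∀ s ∈ Ioo c d, w s ∈ Ioo a b ∧ v (w s) = s)

/-- `γ ∈ M_{γ₀}`: a `∩`-shaped curve above `γ₀` with parameters `β₁, β₂` and
graph reparametrization `u`. -/
structure CapAbove (γ : Curve1) (γ₀ : Curve) (β₁ β₂ : ℝ) (u : ℝ → ℝ) : Prop where
  ep0 : γ.x 0 = 0 ∧ γ.y 0 = 0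
  ep1 : γ.x 1 = 1 ∧ γ.y 1 = 0
  hβ : 0 ≤ β₁ ∧ β₁ < β₂ ∧ β₂ ≤ 1
  left : ∀ t ∈ Icc (0:ℝ) β₁, γ.x t = 0
  right : ∀ t ∈ Icc β₂ (1:ℝ), γ.x t = 1
  inv : InvertibleW11On γ.x β₁ β₂ 0 1
  graph : ∀ t ∈ Ioo β₁ β₂, u (γ.x t) = γ.y t
  ucont : ContinuousOn u (Icc (0:ℝ) 1)
  above : ∀ t ∈ Icc (0:ℝ) 1, γ₀.y t ≤ u (γ₀.x t)

/-- A `∩`-shaped pseudograph with parameters `β₁, β₂` and graph reparametrization `u`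
(with weak derivatives `du`, `ddu`). -/
structure CapShaped (γ : Curve) (β₁ β₂ : ℝ) (u du ddu : ℝ → ℝ) : Prop where
  hβ : 0 ≤ β₁ ∧ β₁ < β₂ ∧ β₂ ≤ 1
  left : ∀ t ∈ Icc (0:ℝ) β₁, γ.x t = 0
  right : ∀ t ∈ Icc β₂ (1:ℝ), γ.x t = 1
  pos : ∀ t ∈ Ioo β₁ β₂, 0 < γ.dx t
  graph : ∀ t ∈ Ioo β₁ β₂, u (γ.x t) = γ.y t
  reg : W22locOn u du ddu 0 1

/-- `G(x) = ∫₀ˣ (1+s²)^{-5/4} ds`. -/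
def Gfun (x : ℝ) : ℝ := ∫ s in (0:ℝ)..x, ((1 + s^2) ^ (-(5:ℝ)/4) : ℝ)

/-- `c₀ = ∫_ℝ (1+s²)^{-5/4} ds`. -/
def c0 : ℝ := ∫ s : ℝ, ((1 + s^2) ^ (-(5:ℝ)/4) : ℝ)

/-- The inverse of `G`. -/
def Ginv : ℝ → ℝ := Function.invFun Gfun

/-- The ratio `R(B)` from the nonexistence theorem. -/
def ratio (B : ℝ) : ℝ :=
  (∫ t in (0:ℝ)..B, t / (Real.sqrt (B - t) * (1 + t^2) ^ ((5:ℝ)/4))) /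
  (2 * ∫ t in (0:ℝ)..B, 1 / (Real.sqrt (B - t) * (1 + t^2) ^ ((5:ℝ)/4)))

/-- The symmetric cone obstacle with valley `[0,s]` and peak `A`. -/
def coneObstacle (A s : ℝ) : ℝ → ℝ := fun x =>
  if x ≤ 1/2 then A / (1/2 - s) * (x - s) else A / (1/2 - s) * (1 - s - x)
/-- The infimum of the elastic energy over `P_ψ`. -/
def infP (ψ : ℝ → ℝ) : ENNReal := sInf {e : ENNReal | ∃ τ : Curve, MemP ψ τ ∧ e = elE τ}

/-- A function whose increments are dominated by those of two absolutely continuous functions is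
absolutely continuous. -/
theorem AbsolutelyContinuousOnInterval.of_dist_le {f g h : ℝ → ℝ} {a b : ℝ}
    (hf : AbsolutelyContinuousOnInterval f a b) (hg : AbsolutelyContinuousOnInterval g a b)
    (hd : ∀ x ∈ uIcc a b, ∀ y ∈ uIcc a b, dist (h x) (h y) ≤ dist (f x) (f y) + dist (g x) (g y)) :
    AbsolutelyContinuousOnInterval h a b := by
  have hsum := Tendsto.add hf hg
  rw [add_zero] at hsum
  refine squeeze_zero' (Eventually.of_forall fun t => Finset.sum_nonneg fun i _ => dist_nonneg) ?_
    hsum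
  filter_upwards [mem_inf_of_right (mem_principal_self _)] with E hE
  rw [← Finset.sum_add_distrib]
  exact Finset.sum_le_sum fun i hi => hd _ (hE.1 i hi).1 _ (hE.1 i hi).2

theorem sum_dist_le_of_monotoneOn {Φ : ℝ → ℝ} {a b : ℝ} (hab : a ≤ b)
    (hΦ : MonotoneOn Φ (Icc a b)) {E : ℕ × (ℕ → ℝ × ℝ)}
    (hE : E ∈ AbsolutelyContinuousOnInterval.disjWithin a b) :
    ∑ i ∈ Finset.range E.1, dist (Φ (E.2 i).1) (Φ (E.2 i).2) ≤ Φ b - Φ a := by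
  obtain ⟨h1, h2⟩ := hE
  rw [uIcc_of_le hab] at h1
  have hdisj : Set.PairwiseDisjoint (↑(Finset.range E.1) : Set ℕ)
      (fun i => uIoc (Φ (E.2 i).1) (Φ (E.2 i).2)) := by
    intro i hi j hj hij
    have hd := h2 hi hj hij
    obtain ⟨p1, p2⟩ := h1 i hi
    obtain ⟨q1, q2⟩ := h1 j hj
    have key : ∀ s t s' t' : ℝ, s ∈ Icc a b → t ∈ Icc a b → s' ∈ Icc a b → t' ∈ Icc a b →
        s ≤ t → s' ≤ t' → Disjoint (Ioc s t) (Ioc s' t') →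
        Disjoint (Ioc (Φ s) (Φ t)) (Ioc (Φ s') (Φ t')) := by
      intro s t s' t' hs ht hs' ht' hst hst' hdis
      rw [Set.disjoint_left] at hdis ⊢
      rintro y ⟨hy1, hy2⟩ ⟨hy3, hy4⟩
      have hne : s < t := lt_of_not_ge fun h => by
        have := hΦ ht hs h; linarith
      have hne' : s' < t' := lt_of_not_ge fun h => by
        have := hΦ ht' hs' h; linarith
      rcases le_total t t' with h | h
      · have : ¬ s' < t := fun h' => hdis (a := t) ⟨hne, le_rfl⟩ ⟨h', h⟩
        have := hΦ ht hs' (not_lt.1 this)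
        linarith
      · have : ¬ s < t' := fun h' => hdis (a := t') ⟨h', h⟩ ⟨hne', le_rfl⟩
        have := hΦ ht' hs (not_lt.1 this)
        linarith
    have hu : ∀ s t : ℝ, s ∈ Icc a b → t ∈ Icc a b →
        ∃ s' t', s' ∈ Icc a b ∧ t' ∈ Icc a b ∧ s' ≤ t' ∧ uIoc s t = Ioc s' t' ∧
          uIoc (Φ s) (Φ t) = Ioc (Φ s') (Φ t') := by
      intro s t hs ht
      rcases le_total s t with h | h
      · exact ⟨s, t, hs, ht, h, uIoc_of_le h, uIoc_of_le (hΦ hs ht h)⟩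
      · exact ⟨t, s, ht, hs, h, uIoc_of_ge h, uIoc_of_ge (hΦ ht hs h)⟩
    obtain ⟨s, t, hs, ht, hst, e1, e2⟩ := hu _ _ p1 p2
    obtain ⟨s', t', hs', ht', hst', e1', e2'⟩ := hu _ _ q1 q2
    simp only [Function.onFun] at hd ⊢
    rw [e1, e1'] at hd
    rw [e2, e2']
    exact key _ _ _ _ hs ht hs' ht' hst hst' hd
  have hvol : volume (⋃ i ∈ Finset.range E.1, uIoc (Φ (E.2 i).1) (Φ (E.2 i).2)) =
      ENNReal.ofReal (∑ i ∈ Finset.range E.1, dist (Φ (E.2 i).1) (Φ (E.2 i).2)) := by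
    rw [measure_biUnion_finset hdisj (fun _ _ => measurableSet_uIoc),
      ENNReal.ofReal_sum_of_nonneg (fun _ _ => dist_nonneg)]
    exact Finset.sum_congr rfl fun i _ => by
      simp [uIoc, Real.dist_eq, max_sub_min_eq_abs']
  have hsub : (⋃ i ∈ Finset.range E.1, uIoc (Φ (E.2 i).1) (Φ (E.2 i).2)) ⊆ Icc (Φ a) (Φ b) := by
    simp only [iUnion_subset_iff]
    intro i hi
    obtain ⟨p1, p2⟩ := h1 i hi
    have hA : ∀ s ∈ Icc a b, Φ s ∈ Icc (Φ a) (Φ b) := fun s hs =>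
      ⟨hΦ ⟨le_rfl, hab⟩ hs hs.1, hΦ hs ⟨hab, le_rfl⟩ hs.2⟩
    exact uIoc_subset_uIcc.trans (uIcc_subset_Icc (hA _ p1) (hA _ p2))
  have hm := measure_mono (μ := volume) hsub
  rw [hvol, Real.volume_Icc] at hm
  exact (ENNReal.ofReal_le_ofReal_iff (by
    have := hΦ ⟨le_rfl, hab⟩ ⟨hab, le_rfl⟩ hab; linarith)).1 hm

theorem absolutelyContinuousOnInterval_of_sq_le {f Φ : ℝ → ℝ} {a b : ℝ} (hab : a ≤ b)
    (hΦ : MonotoneOn Φ (Icc a b))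
    (h : ∀ s ∈ Icc a b, ∀ t ∈ Icc a b, s ≤ t → (f t - f s) ^ 2 ≤ (t - s) * (Φ t - Φ s)) :
    AbsolutelyContinuousOnInterval f a b := by
  rw [absolutelyContinuousOnInterval_iff]
  intro ε hε
  set M := Φ b - Φ a with hM
  have hM0 : 0 ≤ M := by have := hΦ ⟨le_rfl, hab⟩ ⟨hab, le_rfl⟩ hab; linarith
  set K := (M + 1) / ε with hK
  have hK0 : 0 < K := by positivity
  refine ⟨(M + 1) / K ^ 2, by positivity, fun E hE hlt => ?_⟩
  have hpt : ∀ i ∈ Finset.range E.1, dist (f (E.2 i).1) (f (E.2 i).2) ≤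
      (K / 2) * dist (E.2 i).1 (E.2 i).2 + (1 / (2 * K)) * dist (Φ (E.2 i).1) (Φ (E.2 i).2) := by
    intro i hi
    obtain ⟨p1, p2⟩ := hE.1 i hi
    rw [uIcc_of_le hab] at p1 p2
    have key : ∀ s ∈ Icc a b, ∀ t ∈ Icc a b, s ≤ t → dist (f s) (f t) ≤
        (K / 2) * dist s t + (1 / (2 * K)) * dist (Φ s) (Φ t) := by
      intro s hs t ht hst
      have h1 := h s hs t ht hst
      have h2 : 0 ≤ Φ t - Φ s := by have := hΦ hs ht hst; linarith
      rw [dist_comm (f s), dist_comm s, dist_comm (Φ s), Real.dist_eq, Real.dist_eq, Real.dist_eq,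
        abs_of_nonneg (sub_nonneg.2 hst), abs_of_nonneg h2]
      apply abs_le_of_sq_le_sq
      · have : (K / 2 * (t - s) + 1 / (2 * K) * (Φ t - Φ s)) ^ 2 =
          (K / 2 * (t - s) - 1 / (2 * K) * (Φ t - Φ s)) ^ 2 + (t - s) * (Φ t - Φ s) := by
          field_simp; ring
        rw [this]
        have := sq_nonneg (K / 2 * (t - s) - 1 / (2 * K) * (Φ t - Φ s))
        linarith
      · have := sub_nonneg.2 hst
        positivity
    rcases le_total (E.2 i).1 (E.2 i).2 with hle | hle
    · exact key _ p1 _ p2 hle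
    · have := key _ p2 _ p1 hle
      rwa [dist_comm (f _), dist_comm (E.2 i).2, dist_comm (Φ _)] at this
  calc _ ≤ _ := Finset.sum_le_sum hpt
    _ = (K / 2) * ∑ i ∈ Finset.range E.1, dist (E.2 i).1 (E.2 i).2 +
        (1 / (2 * K)) * ∑ i ∈ Finset.range E.1, dist (Φ (E.2 i).1) (Φ (E.2 i).2) := by
      rw [Finset.sum_add_distrib, Finset.mul_sum, Finset.mul_sum]
    _ < (K / 2) * ((M + 1) / K ^ 2) + (1 / (2 * K)) * (M + 1) := by
      have h1 := sum_dist_le_of_monotoneOn hab hΦ hE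
      have h2 : (1 / (2 * K)) * ∑ i ∈ Finset.range E.1, dist (Φ (E.2 i).1) (Φ (E.2 i).2) ≤
        (1 / (2 * K)) * (M + 1) := by gcongr; linarith
      have h3 : (K / 2) * ∑ i ∈ Finset.range E.1, dist (E.2 i).1 (E.2 i).2 <
        (K / 2) * ((M + 1) / K ^ 2) := by gcongr
      linarith
    _ = ε := by rw [hK]; field_simp; ring

theorem ae_sq_deriv_le {f Φ : ℝ → ℝ} {a b : ℝ} (hab : a ≤ b)
    (hΦ : MonotoneOn Φ (Icc a b))
    (h : ∀ s ∈ Icc a b, ∀ t ∈ Icc a b, s ≤ t → (f t - f s) ^ 2 ≤ (t - s) * (Φ t - Φ s)) :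
    ∀ᵐ x, x ∈ Ioo a b → DifferentiableAt ℝ f x ∧ (deriv f x) ^ 2 ≤ deriv Φ x := by
  have hac := absolutelyContinuousOnInterval_of_sq_le hab hΦ h
  filter_upwards [hac.ae_differentiableAt, hΦ.ae_differentiableWithinAt_of_mem] with x h1 h2 hx
  have hf := h1 (by rw [uIcc_of_le hab]; exact Ioo_subset_Icc_self hx)
  have hP : DifferentiableAt ℝ Φ x :=
    (h2 (Ioo_subset_Icc_self hx)).differentiableAt (Icc_mem_nhds hx.1 hx.2)
  refine ⟨hf, ?_⟩
  have t1 : Tendsto _ (𝓝[>] x) _ := (hf.hasDerivAt.tendsto_slope.mono_left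
    (nhdsWithin_mono x (fun y (hy : x < y) => (ne_of_gt hy : y ≠ x)))).pow 2
  have t2 : Tendsto _ (𝓝[>] x) _ := hP.hasDerivAt.tendsto_slope.mono_left
    (nhdsWithin_mono x (fun y (hy : x < y) => (ne_of_gt hy : y ≠ x)))
  refine le_of_tendsto_of_tendsto t1 t2 ?_
  filter_upwards [Ioo_mem_nhdsGT hx.2] with y hy
  have h0 : 0 < y - x := sub_pos.2 hy.1
  have := h x (Ioo_subset_Icc_self hx) y ⟨(hx.1.trans hy.1).le, hy.2.le⟩ hy.1.le
  rw [slope_def_field, slope_def_field, div_pow, div_le_div_iff₀ (by positivity) h0]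
  nlinarith

theorem lintegral_deriv_le {Φ : ℝ → ℝ} {a b : ℝ} (hab : a ≤ b)
    (hΦ : MonotoneOn Φ (Icc a b)) :
    ∫⁻ x in Ioo a b, ENNReal.ofReal (deriv Φ x) ≤ ENNReal.ofReal (Φ b - Φ a) := by
  have hΦ' : MonotoneOn Φ (uIcc a b) := by rwa [uIcc_of_le hab]
  have hi := hΦ'.intervalIntegrable_deriv
  have hm := hΦ'.intervalIntegral_deriv_mem_uIcc
  have hle : Φ a ≤ Φ b := hΦ ⟨le_rfl, hab⟩ ⟨hab, le_rfl⟩ hab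
  rw [uIcc_of_le (by linarith)] at hm
  rw [intervalIntegral.integral_of_le hab, integral_Ioc_eq_integral_Ioo] at hm
  rw [← ofReal_integral_eq_lintegral_ofReal]
  · exact ENNReal.ofReal_le_ofReal hm.2
  · exact ((intervalIntegrable_iff_integrableOn_Ioo_of_le hab).1 hi)
  · refine (ae_restrict_iff' measurableSet_Ioo).2 (Eventually.of_forall fun x hx => ?_)
    have : 0 ≤ derivWithin Φ (Icc a b) x := hΦ.derivWithin_nonneg
    rwa [derivWithin_of_mem_nhds (Icc_mem_nhds hx.1 hx.2)] at this

theorem sq_le_mul_of_forall_two_mul_le {x F I : ℝ} (hF : 0 < F) (hI : 0 ≤ I) (hx : 0 ≤ x)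
    (h : ∀ l : ℝ, 0 < l → 2 * x ≤ l * F + I / l) : x ^ 2 ≤ F * I := by
  rcases hx.eq_or_lt with rfl | hx
  · simpa using mul_nonneg hF.le hI
  · have := h (x / F) (by positivity)
    have e : x / F * F + I / (x / F) = x + I * F / x := by field_simp
    rw [e] at this
    have h2 : x ≤ I * F / x := by linarith
    rw [le_div_iff₀ hx] at h2
    nlinarith

/-- Cauchy–Schwarz estimate for the increment of `K (g / f)`, where `f > 0` and `g` are absolutely
continuous. -/
theorem sq_sub_comp_div_le {f g f' g' K N e : ℝ → ℝ} {a b : ℝ} (hab : a ≤ b)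
    (hf' : IntervalIntegrable f' volume a b) (hg' : IntervalIntegrable g' volume a b)
    (hf : ∀ t ∈ Icc a b, f t = f a + ∫ s in a..t, f' s)
    (hg : ∀ t ∈ Icc a b, g t = g a + ∫ s in a..t, g' s)
    (hpos : ∀ t ∈ Icc a b, 0 < f t)
    (hK : ∀ q, HasDerivAt K (N q) q) (hN : Continuous N)
    (he : IntervalIntegrable e volume a b)
    (he0 : ∀ t ∈ Icc a b, 0 ≤ e t)
    (hpt : ∀ t ∈ Icc a b,
      (N (g t / f t) * ((g' t * f t - g t * f' t) / f t ^ 2)) ^ 2 ≤ f t * e t) :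
    (K (g b / f b) - K (g a / f a)) ^ 2 ≤ (∫ t in a..b, f t) * ∫ t in a..b, e t := by
  rcases hab.eq_or_lt with rfl | hlt
  · simp
  have hu : uIcc a b = Icc a b := uIcc_of_le hab
  have hconst : ∀ c : ℝ, AbsolutelyContinuousOnInterval (fun _ : ℝ => c) a b := fun c =>
    (LipschitzWith.const (α := ℝ) c).lipschitzOnWith.absolutelyContinuousOnInterval
  have hle : ∀ {F H : ℝ → ℝ}, (∀ t ∈ Icc a b, F t = H t) → AbsolutelyContinuousOnInterval H a b →
      AbsolutelyContinuousOnInterval F a b := by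
    intro F H hFH hH
    refine hH.of_dist_le (hconst 0) fun x hx y hy => ?_
    rw [hu] at hx hy
    rw [hFH x hx, hFH y hy]; simp
  have hfac : AbsolutelyContinuousOnInterval f a b :=
    hle hf ((hconst (f a)).fun_add
      (hf'.absolutelyContinuousOnInterval_intervalIntegral (c := a) left_mem_uIcc))
  have hgac : AbsolutelyContinuousOnInterval g a b :=
    hle hg ((hconst (g a)).fun_add
      (hg'.absolutelyContinuousOnInterval_intervalIntegral (c := a) left_mem_uIcc))
  have hfc : ContinuousOn f (Icc a b) := hu ▸ hfac.continuousOn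
  have hgc : ContinuousOn g (Icc a b) := hu ▸ hgac.continuousOn
  obtain ⟨t0, ht0, hmin⟩ := isCompact_Icc.exists_isMinOn (nonempty_Icc.2 hab) hfc
  set m := f t0 with hm
  have hm0 : 0 < m := hpos t0 ht0
  have hinv : AbsolutelyContinuousOnInterval (fun t => (f t)⁻¹) a b := by
    refine (hfac.const_mul (1 / m ^ 2)).of_dist_le (hconst 0) fun x hx y hy => ?_
    rw [hu] at hx hy
    have hx0 := hpos x hx
    have hy0 := hpos y hy
    have hxm : m ≤ f x := hmin hx
    have hym : m ≤ f y := hmin hy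
    simp only [Real.dist_eq, sub_self, abs_zero, add_zero]
    rw [← mul_sub, abs_mul, abs_of_pos (by positivity : 0 < 1 / m ^ 2), inv_sub_inv hx0.ne' hy0.ne',
      abs_div, abs_of_pos (mul_pos hx0 hy0), abs_sub_comm, div_eq_mul_inv, mul_comm, one_div]
    gcongr
    nlinarith
  have hqac : AbsolutelyContinuousOnInterval (fun t => g t / f t) a b := by
    simpa [div_eq_mul_inv] using! hgac.mul hinv
  have hqc : ContinuousOn (fun t => g t / f t) (Icc a b) := hu ▸ hqac.continuousOn
  obtain ⟨R, hR⟩ := (isCompact_Icc.image_of_continuousOn hqc).isBounded.subset_closedBall 0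
  have hKd : ContDiff ℝ 1 K := by
    rw [contDiff_one_iff_deriv]
    refine ⟨fun q => (hK q).differentiableAt, ?_⟩
    have : deriv K = N := funext fun q => (hK q).deriv
    rwa [this]
  obtain ⟨L, hL⟩ := hKd.contDiffOn.exists_lipschitzOnWith (s := Metric.closedBall (0 : ℝ) R)
    (by decide) (convex_closedBall _ _) (isCompact_closedBall _ _)
  have hac : AbsolutelyContinuousOnInterval (fun t => K (g t / f t)) a b := by
    refine (hqac.const_mul (L : ℝ)).of_dist_le (hconst 0) fun x hx y hy => ?_
    rw [hu] at hx hy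
    have := hL.dist_le_mul _ (hR ⟨x, hx, rfl⟩) _ (hR ⟨y, hy, rfl⟩)
    refine this.trans ?_
    simp only [Real.dist_eq, sub_self, abs_zero, add_zero]
    rw [← mul_sub, abs_mul, NNReal.abs_eq]
  have hder : ∀ᵐ t, t ∈ Ioo a b →
      deriv (fun t => K (g t / f t)) t = N (g t / f t) * ((g' t * f t - g t * f' t) / f t ^ 2) := by
    filter_upwards [hf'.ae_hasDerivAt_integral, hg'.ae_hasDerivAt_integral] with t h1 h2 ht
    have htI := Ioo_subset_Icc_self ht
    have hfd : HasDerivAt f (f' t) t := by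
      refine ((h1 (hu ▸ htI) a left_mem_uIcc).const_add (f a)).congr_of_eventuallyEq ?_
      filter_upwards [Icc_mem_nhds ht.1 ht.2] with s hs using hf s hs
    have hgd : HasDerivAt g (g' t) t := by
      refine ((h2 (hu ▸ htI) a left_mem_uIcc).const_add (g a)).congr_of_eventuallyEq ?_
      filter_upwards [Icc_mem_nhds ht.1 ht.2] with s hs using hg s hs
    exact ((hK _).comp t (hgd.div hfd (hpos t htI).ne')).deriv
  have hfi : IntervalIntegrable f volume a b := hfac.continuousOn.intervalIntegrable
  have hF0 : 0 < ∫ t in a..b, f t :=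
    intervalIntegral.intervalIntegral_pos_of_pos_on hfi
      (fun t ht => hpos t (Ioo_subset_Icc_self ht)) hlt
  have hI0 : 0 ≤ ∫ t in a..b, e t := intervalIntegral.integral_nonneg hab he0
  rw [← sq_abs]
  refine sq_le_mul_of_forall_two_mul_le hF0 hI0 (abs_nonneg _) fun l hl => ?_
  rw [← hac.integral_deriv_eq_sub]
  have h1 : |∫ t in a..b, deriv (fun t => K (g t / f t)) t| ≤
      ∫ t in a..b, (l / 2 * f t + 1 / (2 * l) * e t) := by
    rw [← Real.norm_eq_abs]
    refine intervalIntegral.norm_integral_le_of_norm_le hab ?_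
      ((hfi.const_mul _).add (he.const_mul _))
    have hne : ∀ᵐ t : ℝ, t ≠ b := by simp [ae_iff]
    filter_upwards [hder, hne] with t h2 htb ht
    have ht' : t ∈ Ioo a b := ⟨ht.1, lt_of_le_of_ne ht.2 htb⟩
    have htI := Ioo_subset_Icc_self ht'
    rw [h2 ht', Real.norm_eq_abs]
    have hft := hpos t htI
    have het := he0 t htI
    refine abs_le_of_sq_le_sq ((hpt t htI).trans ?_) (by positivity)
    have : (l / 2 * f t + 1 / (2 * l) * e t) ^ 2 =
        (l / 2 * f t - 1 / (2 * l) * e t) ^ 2 + f t * e t := by field_simp; ring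
    rw [this]
    have := sq_nonneg (l / 2 * f t - 1 / (2 * l) * e t)
    linarith
  rw [intervalIntegral.integral_add (hfi.const_mul _) (he.const_mul _),
    intervalIntegral.integral_const_mul, intervalIntegral.integral_const_mul] at h1
  have : l * (∫ t in a..b, f t) + (∫ t in a..b, e t) / l =
      2 * (l / 2 * (∫ t in a..b, f t) + 1 / (2 * l) * ∫ t in a..b, e t) := by field_simp
  rw [this]
  linarith

theorem sq_rpow_mul_div_eq {k R δ f : ℝ} (hR : 0 < R) (hf : 0 < f) :
    (k * R ^ (-(5:ℝ)/4) * (δ / f ^ 2)) ^ 2 = f * ((k * δ) ^ 2 / (f ^ 2 * R) ^ ((5:ℝ)/2)) := by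
  have h1 : (f ^ 2 * R) ^ ((5:ℝ)/2) = f ^ 5 * R ^ ((5:ℝ)/2) := by
    rw [Real.mul_rpow (by positivity) hR.le, ← Real.rpow_natCast f 2, ← Real.rpow_mul hf.le,
      ← Real.rpow_natCast f 5]
    norm_num
  have h2 : (R ^ (-(5:ℝ)/4)) ^ 2 = (R ^ ((5:ℝ)/2))⁻¹ := by
    rw [← Real.rpow_natCast, ← Real.rpow_mul hR.le, ← Real.rpow_neg hR.le]
    norm_num
  have h3 : (R ^ ((5:ℝ)/2)) ≠ 0 := by positivity
  rw [h1, mul_pow, mul_pow, h2]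
  field_simp

theorem continuousOn_Ioo_of_ftc {f f' : ℝ → ℝ}
    (hi : ∀ a b : ℝ, 0 < a → b < 1 → IntegrableOn f' (Icc a b))
    (h : ∀ a ∈ Ioo (0:ℝ) 1, ∀ t ∈ Ioo (0:ℝ) 1, f t = f a + ∫ s in a..t, f' s) :
    ContinuousOn f (Ioo 0 1) := by
  intro t ht
  obtain ⟨a, ha0, hat⟩ := exists_between ht.1
  obtain ⟨b, htb, hb1⟩ := exists_between ht.2
  have hab : a ≤ b := (hat.trans htb).le
  have hc : ContinuousOn (fun t => ∫ s in a..t, f' s) (uIcc a b) :=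
    intervalIntegral.continuousOn_primitive_interval (by
      rw [uIcc_of_le hab]; exact hi a b ha0 hb1)
  rw [uIcc_of_le hab] at hc
  have hca := (hc.continuousAt (Icc_mem_nhds hat htb)).const_add (f a)
  refine (hca.congr ?_).continuousWithinAt
  filter_upwards [Icc_mem_nhds hat htb] with s hs
  exact (h a ⟨ha0, hat.trans ht.2⟩ s ⟨ha0.trans_le hs.1, hs.2.trans_lt hb1⟩).symm

namespace Curve

variable (γ : Curve)

theorem continuousOn_dx : ContinuousOn γ.dx (Ioo 0 1) :=
  continuousOn_Ioo_of_ftc γ.ddx_loc γ.ftc_dx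

theorem continuousOn_dy : ContinuousOn γ.dy (Ioo 0 1) :=
  continuousOn_Ioo_of_ftc γ.ddy_loc γ.ftc_dy

theorem intervalIntegrable_dx {a b : ℝ} (ha : a ∈ Icc (0:ℝ) 1) (hb : b ∈ Icc (0:ℝ) 1) :
    IntervalIntegrable γ.dx volume a b := by
  rw [intervalIntegrable_iff]
  exact γ.dx_int.mono_set (uIoc_subset_uIcc.trans (uIcc_subset_Icc ha hb))

theorem intervalIntegrable_dy {a b : ℝ} (ha : a ∈ Icc (0:ℝ) 1) (hb : b ∈ Icc (0:ℝ) 1) :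
    IntervalIntegrable γ.dy volume a b := by
  rw [intervalIntegrable_iff]
  exact γ.dy_int.mono_set (uIoc_subset_uIcc.trans (uIcc_subset_Icc ha hb))

theorem integral_dx {a b : ℝ} (ha : a ∈ Icc (0:ℝ) 1) (hb : b ∈ Icc (0:ℝ) 1) :
    ∫ t in a..b, γ.dx t = γ.x b - γ.x a := by
  rw [γ.ftc_x a ha, γ.ftc_x b hb, ← intervalIntegral.integral_interval_sub_left
    (γ.intervalIntegrable_dx ⟨le_rfl, zero_le_one⟩ hb)
    (γ.intervalIntegrable_dx ⟨le_rfl, zero_le_one⟩ ha)]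
  ring

theorem integral_dy {a b : ℝ} (ha : a ∈ Icc (0:ℝ) 1) (hb : b ∈ Icc (0:ℝ) 1) :
    ∫ t in a..b, γ.dy t = γ.y b - γ.y a := by
  rw [γ.ftc_y a ha, γ.ftc_y b hb, ← intervalIntegral.integral_interval_sub_left
    (γ.intervalIntegrable_dy ⟨le_rfl, zero_le_one⟩ hb)
    (γ.intervalIntegrable_dy ⟨le_rfl, zero_le_one⟩ ha)]
  ring

theorem continuousOn_x : ContinuousOn γ.x (Icc 0 1) := by
  have hc : ContinuousOn (fun t => ∫ s in (0:ℝ)..t, γ.dx s) (uIcc 0 1) :=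
    intervalIntegral.continuousOn_primitive_interval (by
      rw [uIcc_of_le zero_le_one]; exact γ.dx_int)
  rw [uIcc_of_le zero_le_one] at hc
  exact (continuousOn_const.add hc).congr γ.ftc_x

theorem continuousOn_y : ContinuousOn γ.y (Icc 0 1) := by
  have hc : ContinuousOn (fun t => ∫ s in (0:ℝ)..t, γ.dy s) (uIcc 0 1) :=
    intervalIntegral.continuousOn_primitive_interval (by
      rw [uIcc_of_le zero_le_one]; exact γ.dy_int)
  rw [uIcc_of_le zero_le_one] at hc
  exact (continuousOn_const.add hc).congr γ.ftc_y

theorem hasDerivAt_x {t : ℝ} (ht : t ∈ Ioo (0:ℝ) 1) : HasDerivAt γ.x (γ.dx t) t := by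
  have hd := intervalIntegral.integral_hasDerivAt_right
    (γ.intervalIntegrable_dx ⟨le_rfl, zero_le_one⟩ (Ioo_subset_Icc_self ht))
    ⟨_, Ioo_mem_nhds ht.1 ht.2,
      γ.continuousOn_dx.aestronglyMeasurable measurableSet_Ioo⟩
    (γ.continuousOn_dx.continuousAt (Ioo_mem_nhds ht.1 ht.2))
  refine (hd.const_add (γ.x 0)).congr_of_eventuallyEq ?_
  filter_upwards [Icc_mem_nhds ht.1 ht.2] with s hs using γ.ftc_x s hs

theorem hasDerivAt_y {t : ℝ} (ht : t ∈ Ioo (0:ℝ) 1) : HasDerivAt γ.y (γ.dy t) t := by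
  have hd := intervalIntegral.integral_hasDerivAt_right
    (γ.intervalIntegrable_dy ⟨le_rfl, zero_le_one⟩ (Ioo_subset_Icc_self ht))
    ⟨_, Ioo_mem_nhds ht.1 ht.2,
      γ.continuousOn_dy.aestronglyMeasurable measurableSet_Ioo⟩
    (γ.continuousOn_dy.continuousAt (Ioo_mem_nhds ht.1 ht.2))
  refine (hd.const_add (γ.y 0)).congr_of_eventuallyEq ?_
  filter_upwards [Icc_mem_nhds ht.1 ht.2] with s hs using γ.ftc_y s hs

theorem elInt_nonneg (t : ℝ) : 0 ≤ elInt γ t := by unfold elInt; positivity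

variable {γ} in
theorem Immersed.sq_add_sq_pos (h : γ.Immersed) {t : ℝ} (ht : t ∈ Ioo (0:ℝ) 1) :
    0 < γ.dx t ^ 2 + γ.dy t ^ 2 := by
  obtain ⟨ε, hε, h⟩ := h
  exact Real.sqrt_pos.1 (hε.trans (h t ht))

theorem aemeasurable_elInt : AEMeasurable (elInt γ) (volume.restrict (Ioo 0 1)) := by
  have hU : Ioo (0:ℝ) 1 ⊆ ⋃ n : ℕ, Icc (1 / ((n:ℝ) + 2)) (1 - 1 / ((n:ℝ) + 2)) := by
    intro t ht
    have hm : 0 < min t (1 - t) := lt_min ht.1 (by linarith [ht.2])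
    obtain ⟨n, hn⟩ := exists_nat_one_div_lt hm
    refine mem_iUnion.2 ⟨n, ?_⟩
    have : (1:ℝ) / ((n:ℝ) + 2) ≤ 1 / ((n:ℝ) + 1) := by gcongr; norm_num
    have h1 := min_le_left t (1 - t)
    have h2 := min_le_right t (1 - t)
    constructor <;> linarith
  have key : ∀ f : ℝ → ℝ, (∀ a b : ℝ, 0 < a → b < 1 → IntegrableOn f (Icc a b)) →
      AEMeasurable f (volume.restrict (Ioo 0 1)) := by
    intro f hf
    refine AEMeasurable.mono_set hU ?_
    refine aemeasurable_iUnion_iff.2 fun n => (hf _ _ (by positivity) ?_).aemeasurable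
    have : (0:ℝ) < 1 / ((n:ℝ) + 2) := by positivity
    linarith
  have hdx := key _ γ.ddx_loc
  have hdy := key _ γ.ddy_loc
  have h1 := γ.continuousOn_dx.aemeasurable (μ := volume) measurableSet_Ioo
  have h2 := γ.continuousOn_dy.aemeasurable (μ := volume) measurableSet_Ioo
  exact (((h1.mul hdy).sub (h2.mul hdx)).pow_const 2).div
    (((h1.pow_const 2).add (h2.pow_const 2)).pow_const _)

theorem integrableOn_elInt (h : elE γ < ⊤) : IntegrableOn (elInt γ) (Ioo 0 1) :=
  ⟨γ.aemeasurable_elInt.aestronglyMeasurable, by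
    rw [hasFiniteIntegral_iff_ofReal (Eventually.of_forall γ.elInt_nonneg)]; exact h⟩

theorem setIntegral_elInt_le {E : ℝ} (hE : 0 ≤ E) (h : elE γ ≤ ENNReal.ofReal E) {s : Set ℝ}
    (hs : s ⊆ Ioo 0 1) : ∫ t in s, elInt γ t ≤ E := by
  have hi := γ.integrableOn_elInt (h.trans_lt ENNReal.ofReal_lt_top)
  refine (setIntegral_mono_set hi (Eventually.of_forall γ.elInt_nonneg) hs.eventuallyLE).trans ?_
  rw [← ENNReal.ofReal_le_ofReal_iff hE,
    ofReal_integral_eq_lintegral_ofReal hi (Eventually.of_forall γ.elInt_nonneg)]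
  exact h

/-- The energy of an arc controls the increment of a function of the slope, measured with respect
to the linear coordinates `p x + q y` and `r x + s y`. -/
theorem sq_sub_slope_le {p q r s k : ℝ} {R K : ℝ → ℝ} (hR : Continuous R) (hR0 : ∀ m, 0 < R m)
    (hRf : ∀ u v, 0 < p * u + q * v →
      (p * u + q * v) ^ 2 * R ((r * u + s * v) / (p * u + q * v)) = u ^ 2 + v ^ 2)
    (hk : (k * (p * s - q * r)) ^ 2 = 1)
    (hK : ∀ m, HasDerivAt K (k * R m ^ (-(5:ℝ)/4)) m) (hE : elE γ < ⊤)
    {t₁ t₂ : ℝ} (h₁ : t₁ ∈ Ioo (0:ℝ) 1) (h₂ : t₂ ∈ Ioo (0:ℝ) 1) (hle : t₁ ≤ t₂)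
    (hpos : ∀ t ∈ Icc t₁ t₂, 0 < p * γ.dx t + q * γ.dy t) :
    (K ((r * γ.dx t₂ + s * γ.dy t₂) / (p * γ.dx t₂ + q * γ.dy t₂)) -
      K ((r * γ.dx t₁ + s * γ.dy t₁) / (p * γ.dx t₁ + q * γ.dy t₁))) ^ 2 ≤
    ((p * γ.x t₂ + q * γ.y t₂) - (p * γ.x t₁ + q * γ.y t₁)) * ∫ t in t₁..t₂, elInt γ t := by
  have hx : IntervalIntegrable γ.ddx volume t₁ t₂ :=
    (intervalIntegrable_iff_integrableOn_Icc_of_le hle).2 (γ.ddx_loc _ _ h₁.1 h₂.2)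
  have hy : IntervalIntegrable γ.ddy volume t₁ t₂ :=
    (intervalIntegrable_iff_integrableOn_Icc_of_le hle).2 (γ.ddy_loc _ _ h₁.1 h₂.2)
  have hsub : Icc t₁ t₂ ⊆ Ioo 0 1 := fun t ht => ⟨h₁.1.trans_le ht.1, ht.2.trans_lt h₂.2⟩
  have hlin : ∀ p q : ℝ, ∀ t ∈ Icc t₁ t₂, p * γ.dx t + q * γ.dy t =
      (p * γ.dx t₁ + q * γ.dy t₁) + ∫ u in t₁..t, (p * γ.ddx u + q * γ.ddy u) := by
    intro p q t ht
    have hx' := hx.mono_set (uIcc_subset_uIcc left_mem_uIcc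
      (show t ∈ uIcc t₁ t₂ by rwa [uIcc_of_le hle]))
    have hy' := hy.mono_set (uIcc_subset_uIcc left_mem_uIcc
      (show t ∈ uIcc t₁ t₂ by rwa [uIcc_of_le hle]))
    rw [intervalIntegral.integral_add (hx'.const_mul _) (hy'.const_mul _),
      intervalIntegral.integral_const_mul, intervalIntegral.integral_const_mul,
      γ.ftc_dx t₁ h₁ t (hsub ht), γ.ftc_dy t₁ h₁ t (hsub ht)]
    ring
  have hN : Continuous fun m => k * R m ^ (-(5:ℝ)/4) :=
    continuous_const.mul (hR.rpow_const fun m => Or.inl (hR0 m).ne')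
  have hei : IntervalIntegrable (elInt γ) volume t₁ t₂ :=
    (intervalIntegrable_iff_integrableOn_Icc_of_le hle).2 ((γ.integrableOn_elInt hE).mono_set hsub)
  have hmain := sq_sub_comp_div_le hle ((hx.const_mul p).add (hy.const_mul q))
    ((hx.const_mul r).add (hy.const_mul s)) (hlin p q) (hlin r s) hpos hK hN hei
    (fun t _ => γ.elInt_nonneg t) (fun t ht => by
      rw [sq_rpow_mul_div_eq (hR0 _) (hpos t ht), hRf _ _ (hpos t ht)]
      refine mul_le_mul_of_nonneg_left (le_of_eq ?_) (hpos t ht).le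
      rw [elInt]
      congr 1
      calc _ = (k * (p * s - q * r)) ^ 2 * (γ.dx t * γ.ddy t - γ.dy t * γ.ddx t) ^ 2 := by ring
        _ = _ := by rw [hk, one_mul])
  have hI₁ := Ioo_subset_Icc_self h₁
  have hI₂ := Ioo_subset_Icc_self h₂
  rw [intervalIntegral.integral_add ((γ.intervalIntegrable_dx hI₁ hI₂).const_mul _)
      ((γ.intervalIntegrable_dy hI₁ hI₂).const_mul _), intervalIntegral.integral_const_mul,
    intervalIntegral.integral_const_mul, γ.integral_dx hI₁ hI₂, γ.integral_dy hI₁ hI₂] at hmain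
  convert hmain using 2
  ring

end Curve

theorem continuous_one_add_sq_rpow (c : ℝ) : Continuous fun s : ℝ => (1 + s ^ 2) ^ c :=
  (by fun_prop : Continuous fun s : ℝ => 1 + s ^ 2).rpow_const
    fun s => Or.inl (by positivity)

theorem hasDerivAt_Gfun (m : ℝ) : HasDerivAt Gfun ((1 + m ^ 2) ^ (-(5:ℝ)/4)) m :=
  intervalIntegral.integral_hasDerivAt_right
    ((continuous_one_add_sq_rpow _).intervalIntegrable _ _)
    ((continuous_one_add_sq_rpow _).stronglyMeasurableAtFilter _ _)
    (continuous_one_add_sq_rpow _).continuousAt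

theorem Gfun_neg (x : ℝ) : Gfun (-x) = -Gfun x := by
  have := intervalIntegral.integral_comp_neg (a := 0) (b := x)
    (fun s : ℝ => ((1 + s ^ 2) ^ (-(5:ℝ)/4) : ℝ))
  simp only [neg_sq, neg_zero] at this
  rw [Gfun, Gfun, intervalIntegral.integral_symm, ← this]

/-- Between a point where `f ≤ 0` and a later point where `g ≤ 0`, there are consecutive zeros of
`f` and `g`, provided `f + g ≥ 0`. -/
theorem exists_consecutive_zeros {f g : ℝ → ℝ} {a b : ℝ} (hab : a ≤ b)
    (hf : ContinuousOn f (Icc a b)) (hg : ContinuousOn g (Icc a b)) (hfa : f a ≤ 0) (hgb : g b ≤ 0)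
    (hfg : ∀ t ∈ Icc a b, 0 ≤ f t + g t) :
    ∃ s₁ s₂, a ≤ s₁ ∧ s₁ ≤ s₂ ∧ s₂ ≤ b ∧ f s₁ = 0 ∧ g s₂ = 0 ∧
      ∀ t ∈ Icc s₁ s₂, 0 ≤ f t ∧ 0 ≤ g t := by
  have hc₁ : IsCompact {t ∈ Icc a b | f t ≤ 0} :=
    isCompact_Icc.of_isClosed_subset (hf.preimage_isClosed_of_isClosed isClosed_Icc isClosed_Iic)
      inter_subset_left
  obtain ⟨s₁, ⟨hs₁, hfs₁⟩, hmax⟩ := hc₁.exists_isGreatest ⟨a, ⟨le_rfl, hab⟩, hfa⟩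
  have hf₁ : ∀ t ∈ Icc a b, s₁ < t → 0 < f t := fun t ht hst =>
    not_le.1 fun h => hst.not_ge (hmax ⟨ht, h⟩)
  have hf0 : f s₁ = 0 := by
    refine le_antisymm hfs₁ ?_
    rcases hs₁.2.eq_or_lt with h | h
    · have := hfg b ⟨hab, le_rfl⟩
      rw [h]; linarith
    · have ht : Tendsto f (𝓝[Ioo s₁ b] s₁) (𝓝 (f s₁)) :=
        (hf s₁ hs₁).mono_left (nhdsWithin_mono _
          (Ioo_subset_Icc_self.trans (Icc_subset_Icc_left hs₁.1)))
      have : (𝓝[Ioo s₁ b] s₁).NeBot := left_nhdsWithin_Ioo_neBot h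
      refine ge_of_tendsto ht ?_
      filter_upwards [self_mem_nhdsWithin] with t ht
      exact (hf₁ t ⟨hs₁.1.trans ht.1.le, ht.2.le⟩ ht.1).le
  have hg' : ContinuousOn g (Icc s₁ b) := hg.mono (Icc_subset_Icc_left hs₁.1)
  have hc₂ : IsCompact {t ∈ Icc s₁ b | g t ≤ 0} :=
    isCompact_Icc.of_isClosed_subset (hg'.preimage_isClosed_of_isClosed isClosed_Icc isClosed_Iic)
      inter_subset_left
  obtain ⟨s₂, ⟨hs₂, hgs₂⟩, hmin⟩ := hc₂.exists_isLeast ⟨b, ⟨hs₁.2, le_rfl⟩, hgb⟩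
  have hg₁ : ∀ t ∈ Icc s₁ b, t < s₂ → 0 < g t := fun t ht hst =>
    not_le.1 fun h => hst.not_ge (hmin ⟨ht, h⟩)
  have hg0 : g s₂ = 0 := by
    refine le_antisymm hgs₂ ?_
    rcases hs₂.1.eq_or_lt with h | h
    · have := hfg s₁ hs₁
      rw [← h]; linarith
    · have ht : Tendsto g (𝓝[Ioo s₁ s₂] s₂) (𝓝 (g s₂)) :=
        (hg' s₂ hs₂).mono_left (nhdsWithin_mono _
          (Ioo_subset_Icc_self.trans (Icc_subset_Icc_right hs₂.2)))
      have : (𝓝[Ioo s₁ s₂] s₂).NeBot := right_nhdsWithin_Ioo_neBot h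
      refine ge_of_tendsto ht ?_
      filter_upwards [self_mem_nhdsWithin] with t ht
      exact (hg₁ t ⟨ht.1.le, ht.2.le.trans hs₂.2⟩ ht.2).le
  refine ⟨s₁, s₂, hs₁.1, hs₂.1, hs₂.2, hf0, hg0, fun t ht => ⟨?_, ?_⟩⟩
  · rcases ht.1.eq_or_lt with h | h
    · rw [← h, hf0]
    · exact (hf₁ t ⟨hs₁.1.trans ht.1, ht.2.trans hs₂.2⟩ h).le
  · rcases ht.2.eq_or_lt with h | h
    · rw [h, hg0]
    · exact (hg₁ t ⟨ht.1, ht.2.trans hs₂.2⟩ h).le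

namespace Curve

variable {γ : Curve}

theorem monotoneOn_x (h : ∀ t ∈ Ioo (0:ℝ) 1, 0 ≤ γ.dx t) : MonotoneOn γ.x (Icc 0 1) := by
  refine monotoneOn_of_deriv_nonneg (convex_Icc 0 1) γ.continuousOn_x ?_ ?_
  · rw [interior_Icc]
    exact fun t ht => (γ.hasDerivAt_x ht).differentiableAt.differentiableWithinAt
  · rw [interior_Icc]
    exact fun t ht => (γ.hasDerivAt_x ht).deriv ▸ h t ht

/-- A curve of small energy cannot attain both of the slopes `a` and `-a`. -/
theorem slope_dichotomy (him : γ.Immersed) (hdx : ∀ t ∈ Ioo (0:ℝ) 1, 0 ≤ γ.dx t)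
    (hx0 : γ.x 0 = 0) (hx1 : γ.x 1 = 1) {E a : ℝ} (hE0 : 0 ≤ E) (ha : 0 < a)
    (hE : elE γ ≤ ENNReal.ofReal E) (hEa : E < 4 * Gfun a ^ 2) :
    (∀ t ∈ Ioo (0:ℝ) 1, 0 < γ.dy t + a * γ.dx t) ∨
      ∀ t ∈ Ioo (0:ℝ) 1, 0 < a * γ.dx t - γ.dy t := by
  have hfin : elE γ < ⊤ := hE.trans_lt ENNReal.ofReal_lt_top
  by_contra! hcon
  obtain ⟨⟨t₁, ht₁, h₁⟩, ⟨t₂, ht₂, h₂⟩⟩ := hcon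
  have hcx := γ.continuousOn_dx
  have hcy := γ.continuousOn_dy
  have key : ∀ s₁ ∈ Ioo (0:ℝ) 1, ∀ s₂ ∈ Ioo (0:ℝ) 1, s₁ ≤ s₂ →
      (∀ t ∈ Icc s₁ s₂, 0 ≤ γ.dy t + a * γ.dx t ∧ 0 ≤ a * γ.dx t - γ.dy t) →
      ∀ σ : ℝ, σ ^ 2 = 1 → γ.dy s₁ = σ * a * γ.dx s₁ → γ.dy s₂ = -σ * a * γ.dx s₂ → False := by
    intro s₁ hs₁ s₂ hs₂ hle hnn σ hσ e₁ e₂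
    have hsub : Icc s₁ s₂ ⊆ Ioo 0 1 := fun t ht => ⟨hs₁.1.trans_le ht.1, ht.2.trans_lt hs₂.2⟩
    have hpos : ∀ t ∈ Icc s₁ s₂, 0 < 1 * γ.dx t + 0 * γ.dy t := by
      intro t ht
      have h1 := hdx t (hsub ht)
      have h2 := him.sq_add_sq_pos (hsub ht)
      obtain ⟨h3, h4⟩ := hnn t ht
      rw [one_mul, zero_mul, add_zero]
      refine lt_of_le_of_ne h1 fun h => ?_
      rw [← h] at h2 h3 h4
      have : γ.dy t = 0 := by linarith
      rw [this] at h2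
      norm_num at h2
    have hmain := γ.sq_sub_slope_le (p := 1) (q := 0) (r := 0) (s := 1) (k := 1)
      (R := fun m => 1 + m ^ 2) (K := Gfun) (by fun_prop) (fun m => by positivity)
      (fun u v h => by
        have : u ≠ 0 := by rw [one_mul, zero_mul, add_zero] at h; exact h.ne'
        simp only [one_mul, zero_mul, add_zero, zero_add]
        field_simp) (by norm_num)
      (fun m => by rw [one_mul]; exact hasDerivAt_Gfun m) hfin hs₁ hs₂ hle hpos
    have p₁ := hpos s₁ ⟨le_rfl, hle⟩
    have p₂ := hpos s₂ ⟨hle, le_rfl⟩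
    simp only [one_mul, zero_mul, add_zero, zero_add] at hmain p₁ p₂
    rw [e₁, e₂, mul_div_cancel_right₀ _ p₁.ne', mul_div_cancel_right₀ _ p₂.ne'] at hmain
    have hlhs : (Gfun (-σ * a) - Gfun (σ * a)) ^ 2 = 4 * Gfun a ^ 2 := by
      have : σ = 1 ∨ σ = -1 := mul_self_eq_one_iff.1 (by rw [← sq]; exact hσ)
      rcases this with rfl | rfl
      · rw [show -(1:ℝ) * a = -a by ring, one_mul, Gfun_neg]; ring
      · rw [show -(-1:ℝ) * a = a by ring, show (-1:ℝ) * a = -a by ring, Gfun_neg]; ring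
    rw [hlhs] at hmain
    have hmon := monotoneOn_x hdx
    have m1 := hmon ⟨le_rfl, zero_le_one⟩ (Ioo_subset_Icc_self hs₁) hs₁.1.le
    have m2 := hmon (Ioo_subset_Icc_self hs₂) ⟨zero_le_one, le_rfl⟩ hs₂.2.le
    have m3 := hmon (Ioo_subset_Icc_self hs₁) (Ioo_subset_Icc_self hs₂) hle
    have hI : ∫ t in s₁..s₂, elInt γ t ≤ E := by
      rw [intervalIntegral.integral_of_le hle]
      exact γ.setIntegral_elInt_le hE0 hE (Ioc_subset_Icc_self.trans hsub)
    have hI0 : 0 ≤ ∫ t in s₁..s₂, elInt γ t :=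
      intervalIntegral.integral_nonneg hle fun t _ => γ.elInt_nonneg t
    rw [hx0] at m1
    rw [hx1] at m2
    nlinarith
  rcases le_total t₁ t₂ with h | h
  · have hsub : Icc t₁ t₂ ⊆ Ioo 0 1 := fun t ht => ⟨ht₁.1.trans_le ht.1, ht.2.trans_lt ht₂.2⟩
    obtain ⟨s₁, s₂, a1, a2, a3, a4, a5, a6⟩ := exists_consecutive_zeros
      (f := fun t => γ.dy t + a * γ.dx t) (g := fun t => a * γ.dx t - γ.dy t) h
      ((hcy.add (continuousOn_const.mul hcx)).mono hsub)
      (((continuousOn_const.mul hcx).sub hcy).mono hsub) h₁ h₂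
      (fun t ht => by have := mul_nonneg ha.le (hdx t (hsub ht)); linarith)
    exact key s₁ (hsub ⟨a1, a2.trans a3⟩) s₂ (hsub ⟨a1.trans a2, a3⟩) a2 a6 (-1) (by norm_num)
      (by linarith) (by linarith)
  · have hsub : Icc t₂ t₁ ⊆ Ioo 0 1 := fun t ht => ⟨ht₂.1.trans_le ht.1, ht.2.trans_lt ht₁.2⟩
    obtain ⟨s₁, s₂, a1, a2, a3, a4, a5, a6⟩ := exists_consecutive_zeros
      (g := fun t => γ.dy t + a * γ.dx t) (f := fun t => a * γ.dx t - γ.dy t) h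
      (((continuousOn_const.mul hcx).sub hcy).mono hsub)
      ((hcy.add (continuousOn_const.mul hcx)).mono hsub) h₂ h₁
      (fun t ht => by have := mul_nonneg ha.le (hdx t (hsub ht)); linarith)
    exact key s₁ (hsub ⟨a1, a2.trans a3⟩) s₂ (hsub ⟨a1.trans a2, a3⟩) a2
      (fun t ht => (a6 t ht).symm) 1 (by norm_num) (by linarith) (by linarith)

end Curve

/-- The quadratic form `q² + B² (1 - q)²`. -/
def hullR (B q : ℝ) : ℝ := q ^ 2 + B ^ 2 * (1 - q) ^ 2

/-- The primitive in `q` of `B (q² + B² (1 - q)²) ^ (-5/4)`. -/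
def hullF (B q : ℝ) : ℝ := ∫ m in (0:ℝ)..q, B * hullR B m ^ (-(5:ℝ)/4)

theorem continuous_hullR (B : ℝ) : Continuous (hullR B) := by unfold hullR; fun_prop

theorem hullR_pos {B : ℝ} (hB : 0 < B) (q : ℝ) : 0 < hullR B q := by
  rcases eq_or_ne q 0 with rfl | h
  · simp [hullR]; positivity
  · unfold hullR; positivity

theorem hasDerivAt_hullF {B : ℝ} (hB : 0 < B) (m : ℝ) :
    HasDerivAt (hullF B) (B * hullR B m ^ (-(5:ℝ)/4)) m := by
  have hc : Continuous fun m => B * hullR B m ^ (-(5:ℝ)/4) :=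
    continuous_const.mul ((continuous_hullR B).rpow_const fun m => Or.inl (hullR_pos hB m).ne')
  exact intervalIntegral.integral_hasDerivAt_right (hc.intervalIntegrable _ _)
    (hc.stronglyMeasurableAtFilter _ _) hc.continuousAt

/-- A convex function `X` with `X 0 = 0`, `X 1 = 1` and subgradient `Q`, such that the curve
`τ ↦ (X τ, B (τ - X τ))` lies above the obstacle `ψ` and has energy distribution `Φ ≤ E`. -/
structure HullData (ψ : ℝ → ℝ) (B E : ℝ) (X Q Φ : ℝ → ℝ) : Prop where
  support : ∀ τ σ, X τ + Q τ * (σ - τ) ≤ X σ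
  Q_mem : ∀ τ, Q τ ∈ Icc 0 B
  mono : Monotone Φ
  Φ_mem : ∀ τ, Φ τ ∈ Icc 0 E
  sq_le : ∀ τ σ, 0 < τ → τ ≤ σ → σ < 1 →
    (hullF B (Q σ) - hullF B (Q τ)) ^ 2 ≤ (σ - τ) * (Φ σ - Φ τ)
  X_zero : X 0 = 0
  X_one : X 1 = 1
  obst : ∀ x ∈ Icc (0:ℝ) 1, X (x + ψ x / B) ≤ x

/-- The biconjugate of a planar curve `(T, x)` over `[0, 1]`, with slopes in `[0, B]`, together with
contact points of its supporting lines. -/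
theorem exists_support_contact {T x : ℝ → ℝ} {B : ℝ} (hB : 0 ≤ B) (hT : ContinuousOn T (Icc 0 1))
    (hx : ContinuousOn x (Icc 0 1)) (hT01 : ∀ t ∈ Icc (0:ℝ) 1, T t ∈ Icc (0:ℝ) 1)
    (hT0 : T 0 = 0) (hT1 : T 1 = 1) (hx0 : x 0 = 0) (hx1 : x 1 = 1)
    (hxnn : ∀ t ∈ Icc (0:ℝ) 1, 0 ≤ x t)
    (hBmax : ∀ t ∈ Icc (0:ℝ) 1, B * T t - x t ≤ B - 1) :
    ∃ X Q : ℝ → ℝ, (∀ τ σ, X τ + Q τ * (σ - τ) ≤ X σ) ∧ (∀ τ, Q τ ∈ Icc 0 B) ∧ X 0 = 0 ∧ X 1 = 1 ∧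
      (∀ t ∈ Icc (0:ℝ) 1, X (T t) ≤ x t) ∧
      ∀ τ σ, 0 < τ → τ ≤ σ → σ < 1 → Q τ < Q σ → ∃ t ∈ Icc (0:ℝ) 1, ∃ t' ∈ Icc (0:ℝ) 1,
        τ ≤ T t ∧ T t ≤ T t' ∧ T t' ≤ σ ∧
        IsMaxOn (fun s => Q τ * T s - x s) (Icc 0 1) t ∧
        IsMaxOn (fun s => Q σ * T s - x s) (Icc 0 1) t' := by
  have hcont : ∀ S : ℝ, ContinuousOn (fun s => S * T s - x s) (Icc 0 1) := fun S =>
    (continuousOn_const.mul hT).sub hx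
  have hex : ∀ S : ℝ, ∃ t ∈ Icc (0:ℝ) 1, IsMaxOn (fun s => S * T s - x s) (Icc 0 1) t := fun S =>
    isCompact_Icc.exists_isMaxOn (nonempty_Icc.2 zero_le_one) (hcont S)
  choose m hm hmax using hex
  set H : ℝ → ℝ := fun S => S * T (m S) - x (m S) with hH
  have hHge : ∀ S, ∀ s ∈ Icc (0:ℝ) 1, S * T s - x s ≤ H S := fun S s hs => hmax S hs
  have hHd : ∀ S S', H S + (S' - S) * T (m S) ≤ H S' := by
    intro S S'
    have := hHge S' _ (hm S)
    simp only [hH] at this ⊢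
    linarith
  have hHlip : LipschitzWith 1 H := by
    refine LipschitzWith.of_dist_le_mul fun S S' => ?_
    have h1 := hHd S S'
    have h2 := hHd S' S
    have t1 := hT01 _ (hm S)
    have t2 := hT01 _ (hm S')
    rw [Real.dist_eq, Real.dist_eq, NNReal.coe_one, one_mul]
    rcases le_total S S' with h | h
    · rw [abs_of_nonpos (a := S - S') (by linarith)]
      refine abs_le.2 ⟨?_, ?_⟩ <;> nlinarith [t1.1, t1.2, t2.1, t2.2]
    · rw [abs_of_nonneg (a := S - S') (by linarith)]
      refine abs_le.2 ⟨?_, ?_⟩ <;> nlinarith [t1.1, t1.2, t2.1, t2.2]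
  have hexQ : ∀ τ : ℝ, ∃ S ∈ Icc 0 B, IsMaxOn (fun S => S * τ - H S) (Icc 0 B) S := fun τ =>
    isCompact_Icc.exists_isMaxOn (nonempty_Icc.2 hB)
      ((by fun_prop : Continuous fun S : ℝ => S * τ).sub hHlip.continuous).continuousOn
  choose Q hQ hQmax using hexQ
  have hQge : ∀ τ, ∀ S ∈ Icc 0 B, S * τ - H S ≤ Q τ * τ - H (Q τ) := fun τ S hS => hQmax τ hS
  have h0mem : (0:ℝ) ∈ Icc (0:ℝ) 1 := ⟨le_rfl, zero_le_one⟩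
  have h1mem : (1:ℝ) ∈ Icc (0:ℝ) 1 := ⟨zero_le_one, le_rfl⟩
  refine ⟨fun τ => Q τ * τ - H (Q τ), Q, ?_, hQ, ?_, ?_, ?_, ?_⟩
  · intro τ σ
    have := hQge σ _ (hQ τ)
    linarith
  · have h1 := hQge 0 0 ⟨le_rfl, hB⟩
    have h2 := hHge (Q 0) 0 h0mem
    have h3 : H 0 ≤ 0 := by
      have := hxnn _ (hm 0)
      simp only [hH]; linarith
    rw [hT0, hx0] at h2
    simp only at h1 h2 ⊢
    linarith
  · have h1 := hQge 1 B ⟨hB, le_rfl⟩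
    have h2 := hHge (Q 1) 1 h1mem
    have h3 : H B ≤ B - 1 := hBmax _ (hm B)
    rw [hT1, hx1] at h2
    simp only at h1 h2 ⊢
    linarith
  · intro t ht
    have := hHge (Q (T t)) t ht
    simp only
    linarith
  · intro τ σ hτ hτσ hσ hlt
    have e₁ : ∃ t ∈ Icc (0:ℝ) 1, τ ≤ T t ∧ H (Q τ) ≤ Q τ * T t - x t := by
      have hlb : ∀ S ∈ Icc 0 B, Q τ < S → τ ≤ T (m S) := by
        intro S hS hQS
        have h1 := hQge τ S hS
        have h2 := hHd S (Q τ)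
        by_contra hcon
        push Not at hcon
        nlinarith
      have hc : IsCompact {t ∈ Icc (0:ℝ) 1 | τ ≤ T t} :=
        isCompact_Icc.of_isClosed_subset
          (hT.preimage_isClosed_of_isClosed isClosed_Icc isClosed_Ici) inter_subset_left
      obtain ⟨t, ⟨ht, hτt⟩, htmax⟩ := hc.exists_isMaxOn ⟨1, h1mem, by rw [hT1]; linarith⟩
        ((hcont (Q τ)).mono inter_subset_left)
      refine ⟨t, ht, hτt, ?_⟩
      by_contra hcon
      push Not at hcon
      set δ := min (Q σ - Q τ) ((H (Q τ) - (Q τ * T t - x t)) / 2) with hδ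
      have hδ0 : 0 < δ := lt_min (by linarith) (by linarith)
      have hδ1 : δ ≤ Q σ - Q τ := min_le_left _ _
      have hδ2 : δ ≤ (H (Q τ) - (Q τ * T t - x t)) / 2 := min_le_right _ _
      have hS : Q τ + δ ∈ Icc 0 B := ⟨by linarith [(hQ τ).1], by linarith [(hQ σ).2]⟩
      have h1 := hlb _ hS (by linarith)
      have h2 : Q τ * T (m (Q τ + δ)) - x (m (Q τ + δ)) ≤ Q τ * T t - x t := htmax ⟨hm _, h1⟩
      have h3 := hQge τ _ hS
      have h4 := hT01 _ (hm (Q τ + δ))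
      have h5 : H (Q τ + δ) = (Q τ + δ) * T (m (Q τ + δ)) - x (m (Q τ + δ)) := rfl
      have h6 := hHd (Q τ) (Q τ + δ)
      have h7 := hT01 _ (hm (Q τ))
      nlinarith [h4.1, h4.2, h7.1, h7.2]
    have e₂ : ∃ t ∈ Icc (0:ℝ) 1, T t ≤ σ ∧ H (Q σ) ≤ Q σ * T t - x t := by
      have hlb : ∀ S ∈ Icc 0 B, S < Q σ → T (m S) ≤ σ := by
        intro S hS hQS
        have h1 := hQge σ S hS
        have h2 := hHd S (Q σ)
        by_contra hcon
        push Not at hcon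
        nlinarith
      have hc : IsCompact {t ∈ Icc (0:ℝ) 1 | T t ≤ σ} :=
        isCompact_Icc.of_isClosed_subset
          (hT.preimage_isClosed_of_isClosed isClosed_Icc isClosed_Iic) inter_subset_left
      obtain ⟨t, ⟨ht, hτt⟩, htmax⟩ := hc.exists_isMaxOn ⟨0, h0mem, by rw [hT0]; linarith⟩
        ((hcont (Q σ)).mono inter_subset_left)
      refine ⟨t, ht, hτt, ?_⟩
      by_contra hcon
      push Not at hcon
      set δ := min (Q σ - Q τ) ((H (Q σ) - (Q σ * T t - x t)) / 2) with hδ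
      have hδ0 : 0 < δ := lt_min (by linarith) (by linarith)
      have hδ1 : δ ≤ Q σ - Q τ := min_le_left _ _
      have hδ2 : δ ≤ (H (Q σ) - (Q σ * T t - x t)) / 2 := min_le_right _ _
      have hS : Q σ - δ ∈ Icc 0 B := ⟨by linarith [(hQ τ).1], by linarith [(hQ σ).2]⟩
      have h1 := hlb _ hS (by linarith)
      have h2 : Q σ * T (m (Q σ - δ)) - x (m (Q σ - δ)) ≤ Q σ * T t - x t := htmax ⟨hm _, h1⟩
      have h3 := hQge σ _ hS
      have h4 := hT01 _ (hm (Q σ - δ))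
      have h5 : H (Q σ - δ) = (Q σ - δ) * T (m (Q σ - δ)) - x (m (Q σ - δ)) := rfl
      nlinarith [h4.1, h4.2]
    obtain ⟨t, ht, hτt, htmax⟩ := e₁
    obtain ⟨t', ht', hσt', htmax'⟩ := e₂
    refine ⟨t, ht, t', ht', hτt, ?_, hσt', fun s hs => (hHge _ s hs).trans htmax,
      fun s hs => (hHge _ s hs).trans htmax'⟩
    have h1 := (hHge (Q τ) t' ht').trans htmax
    have h2 := (hHge (Q σ) t ht).trans htmax'
    by_contra hcon
    push Not at hcon
    nlinarith

theorem MemP.exists_hullData {ψ : ℝ → ℝ} {γ : Curve} (hγ : MemP ψ γ) {E a : ℝ} (hE0 : 0 ≤ E)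
    (ha : 0 < a) (hE : elE γ ≤ ENNReal.ofReal E)
    (hpos : ∀ t ∈ Ioo (0:ℝ) 1, 0 < γ.dy t + a * γ.dx t) :
    ∃ X Q Φ : ℝ → ℝ, HullData ψ (a + 1) E X Q Φ := by
  obtain ⟨⟨him, hdx, -⟩, hx0, hy0, hx1, hy1, hψ⟩ := hγ
  have hfin : elE γ < ⊤ := hE.trans_lt ENNReal.ofReal_lt_top
  set B := a + 1 with hB
  have hB0 : 0 < B := by positivity
  have h0mem : (0:ℝ) ∈ Icc (0:ℝ) 1 := ⟨le_rfl, zero_le_one⟩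
  have h1mem : (1:ℝ) ∈ Icc (0:ℝ) 1 := ⟨zero_le_one, le_rfl⟩
  set T : ℝ → ℝ := fun t => 1 * γ.x t + B⁻¹ * γ.y t with hT
  have hfpos : ∀ t ∈ Ioo (0:ℝ) 1, 0 < 1 * γ.dx t + B⁻¹ * γ.dy t := by
    intro t ht
    have h1 := hpos t ht
    have h2 := hdx t ht
    have : 1 * γ.dx t + B⁻¹ * γ.dy t = B⁻¹ * (γ.dx t + (γ.dy t + a * γ.dx t)) := by
      field_simp; rw [hB]; ring
    rw [this]; positivity
  have hTd : ∀ t ∈ Ioo (0:ℝ) 1, HasDerivAt T (1 * γ.dx t + B⁻¹ * γ.dy t) t := fun t ht =>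
    ((γ.hasDerivAt_x ht).const_mul 1).add ((γ.hasDerivAt_y ht).const_mul _)
  have hTc : ContinuousOn T (Icc 0 1) :=
    (continuousOn_const.mul γ.continuousOn_x).add (continuousOn_const.mul γ.continuousOn_y)
  have hTmono : StrictMonoOn T (Icc 0 1) := by
    refine strictMonoOn_of_deriv_pos (convex_Icc 0 1) hTc ?_
    rw [interior_Icc]
    exact fun t ht => (hTd t ht).deriv ▸ hfpos t ht
  have hT0 : T 0 = 0 := by simp [hT, hx0, hy0]
  have hT1 : T 1 = 1 := by simp [hT, hx1, hy1]
  have hT01 : ∀ t ∈ Icc (0:ℝ) 1, T t ∈ Icc (0:ℝ) 1 := fun t ht =>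
    ⟨hT0 ▸ hTmono.monotoneOn h0mem ht ht.1, hT1 ▸ hTmono.monotoneOn ht h1mem ht.2⟩
  have hxmono := Curve.monotoneOn_x hdx
  have hxnn : ∀ t ∈ Icc (0:ℝ) 1, 0 ≤ γ.x t := fun t ht => hx0 ▸ hxmono h0mem ht ht.1
  have hamono : MonotoneOn (fun t => a * γ.x t + γ.y t) (Icc 0 1) := by
    have hd : ∀ t ∈ Ioo (0:ℝ) 1,
        HasDerivAt (fun t => a * γ.x t + γ.y t) (a * γ.dx t + γ.dy t) t := fun t ht =>
      ((γ.hasDerivAt_x ht).const_mul a).add (γ.hasDerivAt_y ht)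
    refine monotoneOn_of_deriv_nonneg (convex_Icc 0 1)
      ((continuousOn_const.mul γ.continuousOn_x).add γ.continuousOn_y) ?_ ?_
    · rw [interior_Icc]
      exact fun t ht => (hd t ht).differentiableAt.differentiableWithinAt
    · rw [interior_Icc]
      intro t ht
      rw [(hd t ht).deriv]
      have := hpos t ht
      linarith
  obtain ⟨X, Q, hs, hQ, hX0, hX1, hXT, hcontact⟩ := exists_support_contact hB0.le hTc
    γ.continuousOn_x hT01 hT0 hT1 hx0 hx1 hxnn (fun t ht => by
      have := hamono ht h1mem ht.2
      simp only [hx1, hy1] at this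
      have e : B * T t - γ.x t = a * γ.x t + γ.y t := by
        simp only [hT]; field_simp; rw [hB]; ring
      rw [e, hB]; linarith)
  have hX : Monotone X := fun τ σ h => by
    have h1 := hs τ σ
    have h2 := mul_nonneg (hQ τ).1 (sub_nonneg.2 h)
    linarith
  have hei := γ.integrableOn_elInt hfin
  set A : ℝ → Set ℝ := fun s => Ioo 0 1 ∩ T ⁻¹' Iio s with hA
  have hAsub : ∀ s, A s ⊆ Ioo 0 1 := fun s => inter_subset_left
  have hAmeas : ∀ s, MeasurableSet (A s) := fun s =>
    ((hTc.mono Ioo_subset_Icc_self).isOpen_inter_preimage isOpen_Ioo isOpen_Iio).measurableSet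
  have hmonoA : Monotone fun s => ∫ t in A s, elInt γ t := fun s s' h =>
    setIntegral_mono_set (hei.mono_set (hAsub _)) (Eventually.of_forall γ.elInt_nonneg)
      (LE.le.eventuallyLE fun t ht => ⟨ht.1, lt_of_lt_of_le ht.2 h⟩)
  refine ⟨X, Q, fun s => ∫ t in A s, elInt γ t, hs, hQ, hmonoA, fun s =>
    ⟨setIntegral_nonneg (hAmeas s) fun t _ => γ.elInt_nonneg t,
      γ.setIntegral_elInt_le hE0 hE (hAsub s)⟩, ?_, hX0, hX1, ?_⟩
  · intro τ σ hτ hle hσ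
    have hΦ := sub_nonneg.2 (hmonoA hle)
    have hQle : Q τ ≤ Q σ := by
      rcases hle.eq_or_lt with rfl | h
      · exact le_rfl
      · have h1 := hs τ σ
        have h2 := hs σ τ
        nlinarith
    rcases hQle.eq_or_lt with h | h
    · rw [h, sub_self, sq, mul_zero]
      exact mul_nonneg (sub_nonneg.2 hle) hΦ
    obtain ⟨t, ht, t', ht', h1, h2, h3, hm, hm'⟩ := hcontact τ σ hτ hle hσ h
    have htt' : t ≤ t' := (hTmono.le_iff_le ht ht').1 h2
    have hIoo : ∀ t ∈ Icc (0:ℝ) 1, 0 < T t → T t < 1 → t ∈ Ioo (0:ℝ) 1 := by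
      intro t ht h h'
      refine ⟨lt_of_le_of_ne ht.1 ?_, lt_of_le_of_ne ht.2 ?_⟩
      · rintro rfl; rw [hT0] at h; exact lt_irrefl _ h
      · rintro rfl; rw [hT1] at h'; exact lt_irrefl _ h'
    have htI := hIoo t ht (by linarith) (by linarith)
    have htI' := hIoo t' ht' (by linarith) (by linarith)
    have hslope : ∀ q, ∀ t ∈ Ioo (0:ℝ) 1, IsMaxOn (fun s => q * T s - γ.x s) (Icc 0 1) t →
        (1 * γ.dx t + 0 * γ.dy t) / (1 * γ.dx t + B⁻¹ * γ.dy t) = q := by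
      intro q t ht hmax
      have := (hmax.isLocalMax (Icc_mem_nhds ht.1 ht.2)).hasDerivAt_eq_zero
        (((hTd t ht).const_mul q).sub (γ.hasDerivAt_x ht))
      rw [div_eq_iff (hfpos t ht).ne']
      linarith
    have hmain := γ.sq_sub_slope_le (p := 1) (q := B⁻¹) (r := 1) (s := 0) (k := B)
      (continuous_hullR B) (hullR_pos hB0)
      (fun u v h => by
        unfold hullR
        generalize hf : 1 * u + B⁻¹ * v = f at h ⊢
        have hv : v = B * (f - u) := by rw [← hf]; field_simp; ring
        rw [hv]
        have := h.ne'
        field_simp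
        ring)
      (by field_simp; norm_num) (hasDerivAt_hullF hB0) hfin htI htI' htt'
      (fun s hs => hfpos s ⟨htI.1.trans_le hs.1, hs.2.trans_lt htI'.2⟩)
    rw [hslope _ t htI hm, hslope _ t' htI' hm'] at hmain
    refine hmain.trans ?_
    have hdisj : Disjoint (A τ) (Ioo t t') := by
      rw [Set.disjoint_left]
      rintro s ⟨hs1, hs2⟩ hs3
      have := hTmono ht (Ioo_subset_Icc_self hs1) hs3.1
      simp only [mem_preimage, mem_Iio] at hs2
      linarith
    have hsub : Ioo t t' ⊆ Ioo 0 1 := fun s hs => ⟨htI.1.trans hs.1, hs.2.trans htI'.2⟩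
    have hle' : (∫ s in t..t', elInt γ s) ≤ (∫ s in A σ, elInt γ s) - ∫ s in A τ, elInt γ s := by
      rw [intervalIntegral.integral_of_le htt', integral_Ioc_eq_integral_Ioo, le_sub_iff_add_le',
        ← setIntegral_union hdisj measurableSet_Ioo (hei.mono_set (hAsub _)) (hei.mono_set hsub)]
      refine setIntegral_mono_set (hei.mono_set (hAsub _)) (Eventually.of_forall γ.elInt_nonneg)
        (LE.le.eventuallyLE (union_subset (fun s hs => ⟨hs.1, hs.2.trans_le hle⟩) ?_))
      intro s hs
      have := hTmono (Ioo_subset_Icc_self (hsub hs)) ht' hs.2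
      exact ⟨hsub hs, show T s < σ by linarith⟩
    refine mul_le_mul ?_ hle' (intervalIntegral.integral_nonneg htt' fun t _ => γ.elInt_nonneg t)
      (sub_nonneg.2 hle)
    have : T t' - T t ≤ σ - τ := by linarith
    exact this
  · intro x hx
    have hxr : Icc (γ.x 0) (γ.x 1) ⊆ γ.x '' Icc 0 1 :=
      intermediate_value_Icc zero_le_one γ.continuousOn_x
    rw [hx0, hx1] at hxr
    obtain ⟨t, ht, rfl⟩ := hxr hx
    refine (hX ?_).trans (hXT t ht)
    have h1 := hψ t ht
    simp only [hT]
    rw [one_mul, div_eq_inv_mul]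
    gcongr

theorem exists_tendsto_ultrafilter {ι : Type*} (U : Ultrafilter ι) {f : ι → ℝ} {a b : ℝ}
    (h : ∀ n, f n ∈ Icc a b) : ∃ l, Tendsto f U (𝓝 l) := by
  obtain ⟨l, -, hl⟩ := (isCompact_Icc (a := a) (b := b)).ultrafilter_le_nhds (U.map f) (by
    rw [Ultrafilter.coe_map]
    exact tendsto_principal.2 (Eventually.of_forall h))
  exact ⟨l, hl⟩

theorem HullData.of_approx {ψ : ℝ → ℝ} {B α : ℝ} (hB : 0 < B)
    (h : ∀ n : ℕ, ∃ X Q Φ, HullData ψ B (α + 1 / ((n:ℝ) + 1)) X Q Φ) :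
    ∃ X Q Φ, HullData ψ B α X Q Φ := by
  choose X Q Φ hd using h
  have hXb : ∀ τ, ∀ n, X n τ ∈ Icc (-(B * |τ|)) (B * |τ|) := by
    intro τ n
    have h1 := (hd n).support 0 τ
    have h2 := (hd n).support τ 0
    rw [(hd n).X_zero] at h1 h2
    have q1 := (hd n).Q_mem 0
    have q2 := (hd n).Q_mem τ
    have key : ∀ q ∈ Icc 0 B, |q * τ| ≤ B * |τ| := fun q hq => by
      rw [abs_mul, abs_of_nonneg hq.1]
      exact mul_le_mul_of_nonneg_right hq.2 (abs_nonneg _)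
    have k1 := abs_le.1 (key _ q1)
    have k2 := abs_le.1 (key _ q2)
    constructor <;> linarith [k1.1, k2.2]
  have hΦb : ∀ τ, ∀ n, Φ n τ ∈ Icc 0 (α + 1) := by
    intro τ n
    refine ⟨((hd n).Φ_mem τ).1, ((hd n).Φ_mem τ).2.trans ?_⟩
    have : 1 / ((n:ℝ) + 1) ≤ 1 := by
      rw [div_le_one (by positivity)]; linarith [n.cast_nonneg (α := ℝ)]
    linarith
  set U := hyperfilter ℕ with hU
  choose Y hY using fun τ => exists_tendsto_ultrafilter U (hXb τ)
  choose P hP using fun τ => exists_tendsto_ultrafilter U (fun n => (hd n).Q_mem τ)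
  choose Ψ hΨ using fun τ => exists_tendsto_ultrafilter U (hΦb τ)
  have hE : Tendsto (fun n : ℕ => α + 1 / ((n:ℝ) + 1)) U (𝓝 (α + 0)) :=
    (tendsto_one_div_add_atTop_nhds_zero_nat.const_add α).mono_left Nat.hyperfilter_le_atTop
  rw [add_zero] at hE
  have hF : Continuous (hullF B) :=
    continuous_iff_continuousAt.2 fun m => (hasDerivAt_hullF hB m).continuousAt
  have hFP : ∀ τ, Tendsto (fun n => hullF B (Q n τ)) U (𝓝 (hullF B (P τ))) := fun τ =>
    (hF.tendsto _).comp (hP τ)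
  refine ⟨Y, P, Ψ, ⟨fun τ σ => ?_, fun τ => ?_, fun τ σ h => ?_, fun τ => ?_, fun τ σ h1 h2 h3 => ?_,
    ?_, ?_, fun x hx => ?_⟩⟩
  · exact le_of_tendsto_of_tendsto' ((hY τ).add ((hP τ).mul_const _)) (hY σ)
      fun n => (hd n).support τ σ
  · exact isClosed_Icc.mem_of_tendsto (hP τ) (Eventually.of_forall fun n => (hd n).Q_mem τ)
  · exact le_of_tendsto_of_tendsto' (hΨ τ) (hΨ σ) fun n => (hd n).mono h
  · exact ⟨ge_of_tendsto' (hΨ τ) fun n => ((hd n).Φ_mem τ).1,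
      le_of_tendsto_of_tendsto' (hΨ τ) hE fun n => ((hd n).Φ_mem τ).2⟩
  · exact le_of_tendsto_of_tendsto' (((hFP σ).sub (hFP τ)).pow 2)
      (((hΨ σ).sub (hΨ τ)).const_mul _) fun n => (hd n).sq_le τ σ h1 h2 h3
  · exact tendsto_nhds_unique (hY 0) (by simp only [(hd _).X_zero]; exact tendsto_const_nhds)
  · exact tendsto_nhds_unique (hY 1) (by simp only [(hd _).X_one]; exact tendsto_const_nhds)
  · exact le_of_tendsto' (hY _) fun n => (hd n).obst x hx

/-- If `x` is an increasing parametrization of `(0, 1)` and the slope `P` of the curve `(x, y)` is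
decreasing and locally of class `W^{1,2}`, then the curve is the graph of a concave function of
class `W^{2,2}_loc(0,1)`. -/
theorem exists_graph_reparam {x y dx P : ℝ → ℝ} {β₁ β₂ : ℝ} (hβ : β₁ < β₂)
    (hxc : ContinuousOn x (Icc β₁ β₂)) (hx1 : x β₁ = 0) (hx2 : x β₂ = 1)
    (hx : ∀ t ∈ Ioo β₁ β₂, HasDerivAt x (dx t) t) (hdx : ∀ t ∈ Ioo β₁ β₂, 0 < dx t)
    (hdxc : ContinuousOn dx (Ioo β₁ β₂))
    (hy : ∀ t ∈ Ioo β₁ β₂, HasDerivAt y (P t * dx t) t) (hP : AntitoneOn P (Ioo β₁ β₂))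
    (hPloc : ∀ c d, β₁ < c → c ≤ d → d < β₂ → ∃ Ψ : ℝ → ℝ, MonotoneOn Ψ (Icc c d) ∧
      ∀ s ∈ Icc c d, ∀ t ∈ Icc c d, s ≤ t → (P t - P s) ^ 2 ≤ (t - s) * (Ψ t - Ψ s)) :
    ∃ u du ddu : ℝ → ℝ, W22locOn u du ddu 0 1 ∧
      (∀ t ∈ Ioo β₁ β₂, u (x t) = y t) ∧ (∀ t ∈ Ioo β₁ β₂, du (x t) = P t) ∧
      ConcaveOn ℝ (Ioo 0 1) u ∧ AntitoneOn du (Ioo 0 1) := by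
  have hmono : StrictMonoOn x (Icc β₁ β₂) := by
    refine strictMonoOn_of_deriv_pos (convex_Icc _ _) hxc ?_
    rw [interior_Icc]
    exact fun t ht => (hx t ht).deriv ▸ hdx t ht
  have hsurj : ∀ r ∈ Ioo (0:ℝ) 1, ∃ t ∈ Ioo β₁ β₂, x t = r := by
    have := intermediate_value_Ioo hβ.le hxc
    rw [hx1, hx2] at this
    exact this
  set w := Function.invFunOn x (Ioo β₁ β₂) with hw
  have hwmem : ∀ r ∈ Ioo (0:ℝ) 1, w r ∈ Ioo β₁ β₂ := fun r hr => Function.invFunOn_mem (hsurj r hr)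
  have hxw : ∀ r ∈ Ioo (0:ℝ) 1, x (w r) = r := fun r hr => Function.invFunOn_eq (hsurj r hr)
  have hxmem : ∀ t ∈ Ioo β₁ β₂, x t ∈ Ioo (0:ℝ) 1 := fun t ht =>
    ⟨hx1 ▸ hmono ⟨le_rfl, hβ.le⟩ (Ioo_subset_Icc_self ht) ht.1,
      hx2 ▸ hmono (Ioo_subset_Icc_self ht) ⟨hβ.le, le_rfl⟩ ht.2⟩
  have hwx : ∀ t ∈ Ioo β₁ β₂, w (x t) = t := fun t ht =>
    hmono.injOn (Ioo_subset_Icc_self (hwmem _ (hxmem t ht))) (Ioo_subset_Icc_self ht)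
      (hxw _ (hxmem t ht))
  have hwmono : StrictMonoOn w (Ioo 0 1) := fun r hr r' hr' h => by
    refine (hmono.lt_iff_lt (Ioo_subset_Icc_self (hwmem r hr))
      (Ioo_subset_Icc_self (hwmem r' hr'))).1 ?_
    rwa [hxw r hr, hxw r' hr']
  have hwimg : w '' Ioo 0 1 = Ioo β₁ β₂ := by
    refine Subset.antisymm (image_subset_iff.2 hwmem) fun t ht => ⟨x t, hxmem t ht, hwx t ht⟩
  have hwc : ∀ r ∈ Ioo (0:ℝ) 1, ContinuousAt w r := fun r hr =>
    continuousAt_of_monotoneOn_of_image_mem_nhds hwmono.monotoneOn (Ioo_mem_nhds hr.1 hr.2)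
      (hwimg ▸ Ioo_mem_nhds (hwmem r hr).1 (hwmem r hr).2)
  have hwd : ∀ r ∈ Ioo (0:ℝ) 1, HasDerivAt w (dx (w r))⁻¹ r := fun r hr =>
    HasDerivAt.of_local_left_inverse (hwc r hr) (hx _ (hwmem r hr)) (hdx _ (hwmem r hr)).ne' (by
      filter_upwards [Ioo_mem_nhds hr.1 hr.2] with s hs using hxw s hs)
  have hud : ∀ r ∈ Ioo (0:ℝ) 1, HasDerivAt (fun r => y (w r)) (P (w r)) r := fun r hr => by
    have := (hy _ (hwmem r hr)).comp r (hwd r hr)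
    rwa [mul_assoc, mul_inv_cancel₀ (hdx _ (hwmem r hr)).ne', mul_one] at this
  have hdu : AntitoneOn (fun r => P (w r)) (Ioo 0 1) := fun r hr r' hr' h =>
    hP (hwmem r hr) (hwmem r' hr') (hwmono.monotoneOn hr hr' h)
  have hIcc : ∀ {a b : ℝ}, 0 < a → b < 1 → Icc a b ⊆ Ioo 0 1 := fun ha hb t ht =>
    ⟨ha.trans_le ht.1, ht.2.trans_lt hb⟩
  have hduint : ∀ a b : ℝ, 0 < a → b < 1 → IntegrableOn (fun r => P (w r)) (Icc a b) :=
    fun a b ha hb => (hdu.mono (hIcc ha hb)).integrableOn_isCompact isCompact_Icc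
  have hloc : ∀ a b : ℝ, 0 < a → a ≤ b → b < 1 → ∃ Ψ : ℝ → ℝ, MonotoneOn Ψ (Icc a b) ∧
      ∀ s ∈ Icc a b, ∀ t ∈ Icc a b, s ≤ t →
        (P (w t) - P (w s)) ^ 2 ≤ (t - s) * (Ψ t - Ψ s) := by
    intro a b ha hab hb
    have haI := hIcc ha hb ⟨le_rfl, hab⟩
    have hbI := hIcc ha hb ⟨hab, le_rfl⟩
    have hca := hwmem a haI
    have hdb := hwmem b hbI
    have hle := hwmono.monotoneOn haI hbI hab
    obtain ⟨Ψ, hΨ, hest⟩ := hPloc _ _ hca.1 hle hdb.2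
    have hsub : Icc (w a) (w b) ⊆ Ioo β₁ β₂ := fun t ht =>
      ⟨hca.1.trans_le ht.1, ht.2.trans_lt hdb.2⟩
    obtain ⟨t0, ht0, hmin⟩ := isCompact_Icc.exists_isMinOn (nonempty_Icc.2 hle) (hdxc.mono hsub)
    set m := dx t0
    have hm : 0 < m := hdx t0 (hsub ht0)
    have hwm : ∀ r ∈ Icc a b, w r ∈ Icc (w a) (w b) := fun r hr =>
      ⟨hwmono.monotoneOn haI (hIcc ha hb hr) hr.1, hwmono.monotoneOn (hIcc ha hb hr) hbI hr.2⟩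
    refine ⟨fun r => m⁻¹ * Ψ (w r), fun r hr r' hr' h => mul_le_mul_of_nonneg_left
      (hΨ (hwm r hr) (hwm r' hr') (hwmono.monotoneOn (hIcc ha hb hr) (hIcc ha hb hr') h))
      (inv_nonneg.2 hm.le), fun s hs t ht hst => ?_⟩
    have hws := hwm s hs
    have hwt := hwm t ht
    have hwst := hwmono.monotoneOn (hIcc ha hb hs) (hIcc ha hb ht) hst
    have h1 := hest _ hws _ hwt hwst
    have h2 : m * (w t - w s) ≤ x (w t) - x (w s) := by
      refine (convex_Icc (w a) (w b)).mul_sub_le_image_sub_of_le_deriv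
        (fun r hr => (hx r (hsub hr)).continuousAt.continuousWithinAt) ?_ ?_ _ hws _ hwt hwst
      · rw [interior_Icc]
        exact fun r hr =>
          (hx r (hsub (Ioo_subset_Icc_self hr))).differentiableAt.differentiableWithinAt
      · rw [interior_Icc]
        intro r hr
        rw [(hx r (hsub (Ioo_subset_Icc_self hr))).deriv]
        exact hmin (Ioo_subset_Icc_self hr)
    rw [hxw _ (hIcc ha hb hs), hxw _ (hIcc ha hb ht)] at h2
    have h3 := sub_nonneg.2 (hΨ hws hwt hwst)
    refine h1.trans ?_
    have h4 : w t - w s ≤ m⁻¹ * (t - s) := by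
      rw [← div_eq_inv_mul, le_div_iff₀ hm]; linarith
    calc _ ≤ m⁻¹ * (t - s) * (Ψ (w t) - Ψ (w s)) := mul_le_mul_of_nonneg_right h4 h3
      _ = _ := by ring
  have hac : ∀ a b : ℝ, 0 < a → a ≤ b → b < 1 →
      AbsolutelyContinuousOnInterval (fun r => P (w r)) a b := by
    intro a b ha hab hb
    obtain ⟨Ψ, hΨ, hest⟩ := hloc a b ha hab hb
    exact absolutelyContinuousOnInterval_of_sq_le hab hΨ hest
  refine ⟨fun r => y (w r), fun r => P (w r), deriv fun r => P (w r),
    ⟨hduint, fun a b ha hb => ?_, fun a b ha hb => ?_, fun a ha t ht => ?_, fun a ha t ht => ?_⟩,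
    fun t ht => by simp only [hwx t ht], fun t ht => by simp only [hwx t ht], ?_, hdu⟩
  · rcases lt_or_ge b a with h | h
    · rw [Icc_eq_empty (not_le.2 h)]; exact integrableOn_empty
    · exact (intervalIntegrable_iff_integrableOn_Icc_of_le h).1
        (hac a b ha h hb).intervalIntegrable_deriv
  · rcases lt_or_ge b a with h | h
    · rw [Icc_eq_empty (not_le.2 h)]; exact integrableOn_empty
    obtain ⟨Ψ, hΨ, hest⟩ := hloc a b ha h hb
    have hi := (MonotoneOn.intervalIntegrable_deriv (f := Ψ) (a := a) (b := b)
      (by rwa [uIcc_of_le h]))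
    rw [intervalIntegrable_iff_integrableOn_Ioo_of_le h] at hi
    rw [integrableOn_Icc_iff_integrableOn_Ioo]
    refine hi.mono' ((measurable_deriv _).pow_const 2).aestronglyMeasurable ?_
    rw [ae_restrict_iff' measurableSet_Ioo]
    filter_upwards [ae_sq_deriv_le h hΨ hest] with r hr hrI
    rw [Real.norm_eq_abs, abs_of_nonneg (sq_nonneg _)]
    exact (hr hrI).2
  · have hsub : uIcc a t ⊆ Ioo 0 1 := (ordConnected_Ioo).uIcc_subset ha ht
    rw [intervalIntegral.integral_eq_sub_of_hasDerivAt (fun r hr => hud r (hsub hr))]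
    · ring
    · exact (hdu.mono hsub).intervalIntegrable
  · rcases le_total a t with h | h
    · rw [(hac a t ha.1 h ht.2).integral_deriv_eq_sub]; ring
    · rw [intervalIntegral.integral_symm, (hac t a ht.1 h ha.2).integral_deriv_eq_sub]; ring
  · refine AntitoneOn.concaveOn_of_deriv (convex_Ioo 0 1)
      (fun r hr => (hud r hr).continuousAt.continuousWithinAt) ?_ ?_
    · rw [interior_Ioo]
      exact fun r hr => (hud r hr).differentiableAt.differentiableWithinAt
    · rw [interior_Ioo]
      intro r hr r' hr' h
      rw [(hud r hr).deriv, (hud r' hr').deriv]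
      exact hdu hr hr' h

theorem W22locOn.mono {u du ddu : ℝ → ℝ} {c d c' d' : ℝ} (h : W22locOn u du ddu c d) (hc : c ≤ c')
    (hd : d' ≤ d) : W22locOn u du ddu c' d' where
  du_loc a b ha hb := h.du_loc a b (hc.trans_lt ha) (hb.trans_le hd)
  ddu_loc a b ha hb := h.ddu_loc a b (hc.trans_lt ha) (hb.trans_le hd)
  ddu_sq a b ha hb := h.ddu_sq a b (hc.trans_lt ha) (hb.trans_le hd)
  ftc_u a ha t ht := h.ftc_u a (Ioo_subset_Ioo hc hd ha) t (Ioo_subset_Ioo hc hd ht)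
  ftc_du a ha t ht := h.ftc_du a (Ioo_subset_Ioo hc hd ha) t (Ioo_subset_Ioo hc hd ht)

theorem CapShaped.pseudograph {γ : Curve} {β₁ β₂ : ℝ} {u du ddu : ℝ → ℝ}
    (h : CapShaped γ β₁ β₂ u du ddu) (him : γ.Immersed) (hdx : ∀ t ∈ Ioo (0:ℝ) 1, 0 ≤ γ.dx t) :
    Pseudograph γ := by
  refine ⟨him, hdx, fun a b ha hab hb hpos => ⟨u, du, ddu, ?_, ?_⟩⟩
  · obtain ⟨h1, h2, h3⟩ := h.hβ
    have hx0 := h.left 0 ⟨le_rfl, h1⟩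
    have hx1 := h.right 1 ⟨h3, le_rfl⟩
    have hmono := Curve.monotoneOn_x hdx
    exact h.reg.mono (hx0 ▸ hmono ⟨le_rfl, zero_le_one⟩ ⟨ha, hab.le.trans hb⟩ ha)
      (hx1 ▸ hmono ⟨ha.trans hab.le, hb⟩ ⟨zero_le_one, le_rfl⟩ hb)
  · have hl : ∀ t ∈ Ioo (0:ℝ) β₁, γ.dx t = 0 := fun t ht => by
      have h1 : t < 1 := ht.2.trans (h.hβ.2.1.trans_le h.hβ.2.2)
      refine (γ.hasDerivAt_x ⟨ht.1, h1⟩).unique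
        ((hasDerivAt_const t (0:ℝ)).congr_of_eventuallyEq ?_)
      filter_upwards [Icc_mem_nhds ht.1 ht.2] with s hs using h.left s hs
    have hr : ∀ t ∈ Ioo β₂ (1:ℝ), γ.dx t = 0 := fun t ht => by
      have h1 : 0 < t := (h.hβ.1.trans_lt h.hβ.2.1).trans ht.1
      refine (γ.hasDerivAt_x ⟨h1, ht.2⟩).unique
        ((hasDerivAt_const t (1:ℝ)).congr_of_eventuallyEq ?_)
      filter_upwards [Icc_mem_nhds ht.1 ht.2] with s hs using h.right s hs
    intro t ht
    refine h.graph t ⟨?_, ?_⟩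
    · by_contra hcon
      obtain ⟨s, hs1, hs2⟩ := exists_between ht.1
      have := hpos s ⟨hs1, hs2.trans ht.2⟩
      rw [hl s ⟨ha.trans_lt hs1, hs2.trans_le (not_lt.1 hcon)⟩] at this
      exact lt_irrefl _ this
    · by_contra hcon
      obtain ⟨s, hs1, hs2⟩ := exists_between ht.2
      have := hpos s ⟨ht.1.trans hs1, hs2⟩
      rw [hr s ⟨(not_lt.1 hcon).trans_lt hs1, hs2.trans_le hb⟩] at this
      exact lt_irrefl _ this

/-- For a direction `(u, v)` of slope at least `-a` with `u ≥ 0`, the Euclidean norm is dominated by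
a linear functional. -/
theorem sqrt_sq_add_sq_le {a u v : ℝ} (hu : 0 ≤ u) (hv : 0 ≤ a * u + v) :
    Real.sqrt (u ^ 2 + v ^ 2) ≤ (a + Real.sqrt (1 + a ^ 2)) * u + v := by
  set r := Real.sqrt (1 + a ^ 2) with hr
  have hr2 : r ^ 2 = 1 + a ^ 2 := Real.sq_sqrt (by positivity)
  have hr0 : 0 ≤ r := Real.sqrt_nonneg _
  have har : 0 ≤ a + r := by
    have : |a| ≤ r := Real.abs_le_sqrt (by linarith)
    linarith [neg_abs_le a]
  refine Real.sqrt_le_iff.2 ⟨by linarith [mul_nonneg hr0 hu], ?_⟩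
  have h2 := mul_nonneg (mul_nonneg har hu) hv
  have h3 : ((a + r) * u + v) ^ 2 =
      u ^ 2 + v ^ 2 + 2 * ((a + r) * u * (a * u + v)) + (r ^ 2 - (1 + a ^ 2)) * u ^ 2 := by ring
  rw [h3, hr2]
  linarith

namespace HullData

variable {ψ : ℝ → ℝ} {B E : ℝ} {X Q Φ : ℝ → ℝ}

theorem monotone_Q (h : HullData ψ B E X Q Φ) : Monotone Q := fun τ σ hle => by
  rcases hle.eq_or_lt with rfl | hlt
  · exact le_rfl
  · have h1 := h.support τ σ
    have h2 := h.support σ τ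
    nlinarith

theorem monotone_X (h : HullData ψ B E X Q Φ) : Monotone X := fun τ σ hle => by
  have h1 := h.support τ σ
  have h2 := mul_nonneg (h.Q_mem τ).1 (sub_nonneg.2 hle)
  linarith

theorem continuous_X (h : HullData ψ B E X Q Φ) : Continuous X := by
  have hB : 0 ≤ B := (h.Q_mem 0).1.trans (h.Q_mem 0).2
  refine (LipschitzWith.of_le_add_mul B.toNNReal fun τ σ => ?_).continuous
  have h1 := h.support τ σ
  have h2 := h.Q_mem τ
  rw [Real.dist_eq, Real.coe_toNNReal _ hB]
  rcases le_total σ τ with hle | hle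
  · rw [abs_of_nonneg (sub_nonneg.2 hle)]
    nlinarith [h2.2]
  · rw [abs_of_nonpos (sub_nonpos.2 hle)]
    nlinarith [h2.1]

/-- The subgradient itself satisfies the quadratic increment bound. -/
theorem exists_sq_sub_le (h : HullData ψ B E X Q Φ) (hB : 0 < B) :
    ∃ C : ℝ, 0 < C ∧ ∀ τ σ, 0 < τ → τ ≤ σ → σ < 1 →
      (Q σ - Q τ) ^ 2 ≤ (σ - τ) * (C * Φ σ - C * Φ τ) := by
  have hc : Continuous fun m => B * hullR B m ^ (-(5:ℝ)/4) :=
    continuous_const.mul ((continuous_hullR B).rpow_const fun m => Or.inl (hullR_pos hB m).ne')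
  obtain ⟨m₀, -, hmin⟩ := (isCompact_Icc (a := 0) (b := B)).exists_isMinOn
    (nonempty_Icc.2 hB.le) hc.continuousOn
  set κ := B * hullR B m₀ ^ (-(5:ℝ)/4)
  have hκ : 0 < κ := mul_pos hB (Real.rpow_pos_of_pos (hullR_pos hB _) _)
  refine ⟨(κ ^ 2)⁻¹, by positivity, fun τ σ h1 h2 h3 => ?_⟩
  have hF := h.sq_le τ σ h1 h2 h3
  have hQ := h.monotone_Q h2
  have hlow : κ * (Q σ - Q τ) ≤ hullF B (Q σ) - hullF B (Q τ) := by
    refine (convex_Icc 0 B).mul_sub_le_image_sub_of_le_deriv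
      (fun m _ => (hasDerivAt_hullF hB m).continuousAt.continuousWithinAt)
      (fun m _ => (hasDerivAt_hullF hB m).differentiableAt.differentiableWithinAt) ?_ _ (h.Q_mem τ)
      _ (h.Q_mem σ) hQ
    rw [interior_Icc]
    intro m hm
    rw [(hasDerivAt_hullF hB m).deriv]
    exact hmin (Ioo_subset_Icc_self hm)
  have h4 : (κ * (Q σ - Q τ)) ^ 2 ≤ (σ - τ) * (Φ σ - Φ τ) :=
    (pow_le_pow_left₀ (mul_nonneg hκ.le (sub_nonneg.2 hQ)) hlow 2).trans hF
  rw [← mul_sub, mul_left_comm, ← div_eq_inv_mul, le_div_iff₀ (by positivity)]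
  linarith

end HullData

namespace HullData

variable {ψ : ℝ → ℝ} {B E : ℝ} {X Q Φ : ℝ → ℝ}

theorem absolutelyContinuous_Q (h : HullData ψ B E X Q Φ) (hB : 0 < B) {a b : ℝ} (ha : 0 < a)
    (hab : a ≤ b) (hb : b < 1) : AbsolutelyContinuousOnInterval Q a b := by
  obtain ⟨C, hC, hest⟩ := h.exists_sq_sub_le hB
  exact absolutelyContinuousOnInterval_of_sq_le (Φ := fun τ => C * Φ τ) hab
    (fun s _ t _ hst => mul_le_mul_of_nonneg_left (h.mono hst) hC.le)
    fun s hs t ht hst => hest s t (ha.trans_le hs.1) hst (ht.2.trans_lt hb)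

theorem continuousOn_Q (h : HullData ψ B E X Q Φ) (hB : 0 < B) : ContinuousOn Q (Ioo 0 1) := by
  intro t ht
  obtain ⟨a, ha0, hat⟩ := exists_between ht.1
  obtain ⟨b, htb, hb1⟩ := exists_between ht.2
  have hc := (h.absolutelyContinuous_Q hB ha0 (hat.trans htb).le hb1).continuousOn
  rw [uIcc_of_le (hat.trans htb).le] at hc
  exact (hc.continuousAt (Icc_mem_nhds hat htb)).continuousWithinAt

theorem hasDerivAt_X (h : HullData ψ B E X Q Φ) (hB : 0 < B) {t : ℝ} (ht : t ∈ Ioo (0:ℝ) 1) :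
    HasDerivAt X (Q t) t := by
  rw [hasDerivAt_iff_isLittleO, Asymptotics.isLittleO_iff]
  intro c hc
  have hQ := (h.continuousOn_Q hB).continuousAt (Ioo_mem_nhds ht.1 ht.2)
  filter_upwards [Metric.continuousAt_iff'.1 hQ c hc] with s hs
  have h1 := h.support t s
  have h2 := h.support s t
  rw [Real.dist_eq] at hs
  have h3 : |(Q s - Q t) * (s - t)| ≤ c * |s - t| := by
    rw [abs_mul]; exact mul_le_mul_of_nonneg_right hs.le (abs_nonneg _)
  rw [Real.norm_eq_abs, Real.norm_eq_abs, smul_eq_mul]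
  refine (abs_le_abs_of_nonneg ?_ ?_).trans h3 <;> linarith

theorem intervalIntegrable_Q (h : HullData ψ B E X Q Φ) (a b : ℝ) :
    IntervalIntegrable Q volume a b :=
  h.monotone_Q.intervalIntegrable

theorem integral_Q (h : HullData ψ B E X Q Φ) (hB : 0 < B) {t : ℝ} (ht : t ∈ Icc (0:ℝ) 1) :
    ∫ s in (0:ℝ)..t, Q s = X t := by
  rw [intervalIntegral.integral_eq_sub_of_hasDerivAt_of_le ht.1 h.continuous_X.continuousOn
    (fun s hs => h.hasDerivAt_X hB ⟨hs.1, hs.2.trans_le ht.2⟩) (h.intervalIntegrable_Q _ _),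
    h.X_zero, sub_zero]

theorem exists_curve (h : HullData ψ B E X Q Φ) (hB : 0 < B) :
    ∃ γ : Curve, γ.x = X ∧ (γ.y = fun t => B * (t - X t)) ∧ γ.dx = Q ∧
      (γ.dy = fun t => B * (1 - Q t)) ∧ γ.ddx = deriv Q ∧ γ.ddy = fun t => -(B * deriv Q t) := by
  have hQint : IntegrableOn Q (Icc 0 1) :=
    (intervalIntegrable_iff_integrableOn_Icc_of_le zero_le_one).1 (h.intervalIntegrable_Q 0 1)
  have hdQ : ∀ a b : ℝ, 0 < a → b < 1 → IntegrableOn (deriv Q) (Icc a b) := fun a b ha hb => by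
    rcases lt_or_ge b a with hlt | hle
    · rw [Icc_eq_empty (not_le.2 hlt)]; exact integrableOn_empty
    · exact (intervalIntegrable_iff_integrableOn_Icc_of_le hle).1
        (h.absolutelyContinuous_Q hB ha hle hb).intervalIntegrable_deriv
  have hftc : ∀ a ∈ Ioo (0:ℝ) 1, ∀ t ∈ Ioo (0:ℝ) 1, ∫ s in a..t, deriv Q s = Q t - Q a := by
    intro a ha t ht
    rcases le_total a t with hle | hle
    · exact (h.absolutelyContinuous_Q hB ha.1 hle ht.2).integral_deriv_eq_sub
    · rw [intervalIntegral.integral_symm,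
        (h.absolutelyContinuous_Q hB ht.1 hle ha.2).integral_deriv_eq_sub]
      ring
  refine ⟨{ x := X, y := fun t => B * (t - X t), dx := Q, dy := fun t => B * (1 - Q t)
            ddx := deriv Q, ddy := fun t => -(B * deriv Q t)
            dx_int := hQint
            dy_int := ((integrableOn_const (by simp)).sub hQint).const_mul B
            ftc_x := fun t ht => by rw [h.integral_Q hB ht, h.X_zero, zero_add]
            ftc_y := fun t ht => ?_
            ddx_loc := hdQ
            ddy_loc := fun a b ha hb => ((hdQ a b ha hb).const_mul B).neg
            ftc_dx := fun a ha t ht => by rw [hftc a ha t ht]; ring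
            ftc_dy := fun a ha t ht => ?_ }, rfl, rfl, rfl, rfl, rfl, rfl⟩
  · rw [intervalIntegral.integral_const_mul, intervalIntegral.integral_sub (by simp)
      (h.intervalIntegrable_Q _ _), h.integral_Q hB ht, h.X_zero]
    simp
  · rw [intervalIntegral.integral_neg, intervalIntegral.integral_const_mul, hftc a ha t ht]
    ring

theorem elE_le (h : HullData ψ B E X Q Φ) (hB : 0 < B) {γ : Curve} (hdx : γ.dx = Q)
    (hdy : γ.dy = fun t => B * (1 - Q t)) (hddx : γ.ddx = deriv Q)
    (hddy : γ.ddy = fun t => -(B * deriv Q t)) : elE γ ≤ ENNReal.ofReal E := by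
  have hae : ∀ n : ℕ, ∀ᵐ t, t ∈ Ioo (1 / ((n:ℝ) + 2)) (1 - 1 / ((n:ℝ) + 2)) →
      elInt γ t ≤ deriv Φ t := by
    intro n
    set a := 1 / ((n:ℝ) + 2) with ha
    have ha0 : 0 < a := by positivity
    have hab : a ≤ 1 - a := by
      have : a ≤ 1 / 2 := by
        rw [ha]; gcongr; linarith [n.cast_nonneg (α := ℝ)]
      linarith
    obtain ⟨C, hC, hest⟩ := h.exists_sq_sub_le hB
    have hQd := ae_sq_deriv_le (f := Q) (Φ := fun τ => C * Φ τ) hab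
      (fun s _ t _ hst => mul_le_mul_of_nonneg_left (h.mono hst) hC.le)
      fun s hs t ht hst => hest s t (ha0.trans_le hs.1) hst (ht.2.trans_lt (by linarith))
    have hFd := ae_sq_deriv_le (f := fun τ => hullF B (Q τ)) (Φ := Φ) hab (h.mono.monotoneOn _)
      fun s hs t ht hst => h.sq_le s t (ha0.trans_le hs.1) hst (ht.2.trans_lt (by linarith))
    filter_upwards [hQd, hFd] with t h1 h2 ht
    have hd := (h1 ht).1.hasDerivAt
    have hcomp := ((hasDerivAt_hullF hB (Q t)).comp t hd).deriv
    have h3 := (h2 ht).2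
    simp only [Function.comp_def] at hcomp
    rw [hcomp] at h3
    refine le_trans (le_of_eq ?_) h3
    have h4 := sq_rpow_mul_div_eq (k := B) (δ := deriv Q t) (hullR_pos hB (Q t)) one_pos
    simp only [one_pow, div_one, one_mul] at h4
    rw [h4, elInt, hdx, hdy, hddx, hddy]
    simp only [hullR]
    congr 1
    · ring
    · congr 1; ring
  have hall : ∀ᵐ t, t ∈ Ioo (0:ℝ) 1 → elInt γ t ≤ deriv Φ t := by
    filter_upwards [ae_all_iff.2 hae] with t ht htI
    obtain ⟨n, hn⟩ := exists_nat_one_div_lt (lt_min htI.1 (by linarith [htI.2] : 0 < 1 - t))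
    refine ht n ?_
    have h1 : (1:ℝ) / ((n:ℝ) + 2) ≤ 1 / ((n:ℝ) + 1) := by gcongr; norm_num
    have h2 := min_le_left t (1 - t)
    have h3 := min_le_right t (1 - t)
    constructor <;> linarith
  calc elE γ ≤ ∫⁻ t in Ioo (0:ℝ) 1, ENNReal.ofReal (deriv Φ t) := by
        refine lintegral_mono_ae ((ae_restrict_iff' measurableSet_Ioo).2 ?_)
        filter_upwards [hall] with t ht htI using ENNReal.ofReal_le_ofReal (ht htI)
    _ ≤ ENNReal.ofReal (Φ 1 - Φ 0) := lintegral_deriv_le zero_le_one (h.mono.monotoneOn _)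
    _ ≤ ENNReal.ofReal E := ENNReal.ofReal_le_ofReal (by
        linarith [(h.Φ_mem 1).2, (h.Φ_mem 0).1])

theorem exists_cap (h : HullData ψ B E X Q Φ) (hB : 1 ≤ B) (hψ : ψ 0 < 0) :
    ∃ (γ : Curve) (β₁ β₂ : ℝ) (u du ddu : ℝ → ℝ),
      MemP ψ γ ∧ CapShaped γ β₁ β₂ u du ddu ∧ ConcaveOn ℝ (Ioo (0:ℝ) 1) u ∧
      elE γ ≤ ENNReal.ofReal E ∧
      lenE γ ≤ ENNReal.ofReal ((B - 1) + Real.sqrt (1 + (B - 1) ^ 2)) ∧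
      ∃ d : ℝ, Tendsto du (𝓝[<] (1:ℝ)) (𝓝 d) := by
  have hB0 : 0 < B := by linarith
  obtain ⟨γ, hx, hy, hdx, hdy, hddx, hddy⟩ := h.exists_curve hB0
  have hXm := h.monotone_X
  have hcl : IsCompact (Icc (0:ℝ) 1 ∩ X ⁻¹' {0}) :=
    isCompact_Icc.inter_right (isClosed_singleton.preimage h.continuous_X)
  obtain ⟨β, ⟨hβI, hβ0⟩, hβmax⟩ := hcl.exists_isGreatest ⟨0, ⟨le_rfl, zero_le_one⟩, h.X_zero⟩
  have hβ0 : X β = 0 := hβ0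
  have hβ1 : β < 1 := lt_of_le_of_ne hβI.2 fun he => by
    rw [he, h.X_one] at hβ0; exact one_ne_zero hβ0
  have hXpos : ∀ t ∈ Ioc β 1, 0 < X t := fun t ht => by
    refine lt_of_le_of_ne (hβ0 ▸ hXm ht.1.le) fun he => ?_
    exact ht.1.not_ge (hβmax ⟨⟨hβI.1.trans ht.1.le, ht.2⟩, he.symm⟩)
  have hQpos : ∀ t, 0 ≤ t → 0 < X t → 0 < Q t := fun t ht hXt => by
    have h1 := h.support t 0
    rw [h.X_zero] at h1
    by_contra hcon
    have : Q t = 0 := le_antisymm (not_lt.1 hcon) (h.Q_mem t).1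
    rw [this] at h1
    linarith
  have hsub : Ioo β 1 ⊆ Ioo (0:ℝ) 1 := Ioo_subset_Ioo_left hβI.1
  have hQ1 : ∀ t ∈ Ioo β 1, 0 < Q t := fun t ht =>
    hQpos t (hsub ht).1.le (hXpos t (Ioo_subset_Ioc_self ht))
  obtain ⟨C, hC, hest⟩ := h.exists_sq_sub_le hB0
  obtain ⟨u, du, ddu, hreg, hu, hdu, hconc, hanti⟩ := exists_graph_reparam (x := X)
    (y := fun t => B * (t - X t)) (dx := Q) (P := fun t => B * (1 - Q t) / Q t) hβ1
    h.continuous_X.continuousOn hβ0 h.X_one (fun t ht => h.hasDerivAt_X hB0 (hsub ht)) hQ1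
    ((h.continuousOn_Q hB0).mono hsub)
    (fun t ht => by
      rw [div_mul_cancel₀ _ (hQ1 t ht).ne']
      exact ((hasDerivAt_id t).sub (h.hasDerivAt_X hB0 (hsub ht))).const_mul B)
    (fun s hs t ht hst => by
      have h1 := hQ1 s hs
      have h2 := hQ1 t ht
      have h3 := h.monotone_Q hst
      simp only
      rw [div_le_div_iff₀ h2 h1]
      nlinarith)
    (fun c d hc hcd hd => by
      have hcI : c ∈ Ioo β 1 := ⟨hc, hcd.trans_lt hd⟩
      have hQc := hQ1 c hcI
      refine ⟨fun t => (B / Q c ^ 2) ^ 2 * (C * Φ t), fun s _ t _ hst => ?_,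
        fun s hs t ht hst => ?_⟩
      · have := h.mono hst
        simp only
        gcongr
      · have h1 := hest s t ((hβI.1.trans_lt hc).trans_le hs.1) hst (ht.2.trans_lt hd)
        have h2 := h.monotone_Q hs.1
        have h3 := h.monotone_Q ht.1
        have hQs : 0 < Q s := hQc.trans_le h2
        have hQt : 0 < Q t := hQc.trans_le h3
        have e : (B * (1 - Q t) / Q t - B * (1 - Q s) / Q s) ^ 2 =
            (B / (Q s * Q t)) ^ 2 * (Q t - Q s) ^ 2 := by
          field_simp; ring
        rw [e]
        calc _ ≤ (B / Q c ^ 2) ^ 2 * (Q t - Q s) ^ 2 := by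
              rw [sq (Q c)]; gcongr
          _ ≤ (B / Q c ^ 2) ^ 2 * ((t - s) * (C * Φ t - C * Φ s)) := by gcongr
          _ = _ := by ring)
  have hcap : CapShaped γ β 1 u du ddu :=
    { hβ := ⟨hβI.1, hβ1, le_rfl⟩
      left := fun t ht => by
        rw [hx]
        exact le_antisymm (hβ0 ▸ hXm ht.2) (h.X_zero ▸ hXm ht.1)
      right := fun t ht => by rw [hx, le_antisymm ht.2 ht.1, h.X_one]
      pos := fun t ht => by rw [hdx]; exact hQ1 t ht
      graph := fun t ht => by rw [hx, hy]; exact hu t ht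
      reg := hreg }
  have him : γ.Immersed := by
    refine ⟨1 / 2, by norm_num, fun t ht => ?_⟩
    rw [speed1, hdx, hdy]
    refine Real.lt_sqrt_of_sq_lt ?_
    have h1 : 1 ≤ B ^ 2 := by nlinarith
    have h2 := mul_le_mul_of_nonneg_right h1 (sq_nonneg (1 - Q t))
    nlinarith [sq_nonneg (2 * Q t - 1)]
  refine ⟨γ, β, 1, u, du, ddu, ⟨hcap.pseudograph him fun t _ => hdx ▸ (h.Q_mem t).1, ?_, ?_, ?_, ?_,
    ?_⟩, hcap, hconc, h.elE_le hB0 hdx hdy hddx hddy, ?_, ?_⟩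
  · rw [hx, h.X_zero]
  · rw [hy]; simp [h.X_zero]
  · rw [hx, h.X_one]
  · rw [hy]; simp [h.X_one]
  · intro t ht
    rw [hx, hy]
    simp only
    have hX0 : 0 ≤ X t := h.X_zero ▸ hXm ht.1
    rcases hX0.eq_or_lt with he | hlt
    · rw [← he, sub_zero]
      have := mul_nonneg hB0.le ht.1
      linarith
    · by_contra hcon
      push Not at hcon
      have hQt := hQpos t ht.1 hlt
      have h1 := h.obst (X t) ⟨hX0, h.X_one ▸ hXm ht.2⟩
      have h2 := h.support t (X t + ψ (X t) / B)
      have h3 : t - X t < ψ (X t) / B := by rw [lt_div_iff₀ hB0]; linarith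
      have h4 : 0 < Q t * (X t + ψ (X t) / B - t) := mul_pos hQt (by linarith)
      linarith
  · set a := B - 1 with ha
    have h_int : IntegrableOn (fun t => (a + Real.sqrt (1 + a ^ 2)) * γ.dx t + γ.dy t) (Ioo 0 1) :=
      ((γ.dx_int.mono_set Ioo_subset_Icc_self).const_mul _).add
        (γ.dy_int.mono_set Ioo_subset_Icc_self)
    have hle : ∀ t, speed1 γ.toCurve1 t ≤ (a + Real.sqrt (1 + a ^ 2)) * γ.dx t + γ.dy t := by
      intro t
      rw [speed1]
      refine sqrt_sq_add_sq_le (hdx ▸ (h.Q_mem t).1) ?_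
      rw [hdx, hdy, ha]
      have := (h.Q_mem t).2
      linarith
    calc lenE γ ≤ ∫⁻ t in Ioo (0:ℝ) 1,
          ENNReal.ofReal ((a + Real.sqrt (1 + a ^ 2)) * γ.dx t + γ.dy t) :=
          lintegral_mono fun t => ENNReal.ofReal_le_ofReal (hle t)
      _ = ENNReal.ofReal (∫ t in Ioo (0:ℝ) 1, ((a + Real.sqrt (1 + a ^ 2)) * γ.dx t + γ.dy t)) :=
          (ofReal_integral_eq_lintegral_ofReal h_int
            (Eventually.of_forall fun t => (Real.sqrt_nonneg _).trans (hle t))).symm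
      _ = ENNReal.ofReal (a + Real.sqrt (1 + a ^ 2)) := by
          congr 1
          have h0 : (0:ℝ) ∈ Icc (0:ℝ) 1 := ⟨le_rfl, zero_le_one⟩
          have h1 : (1:ℝ) ∈ Icc (0:ℝ) 1 := ⟨zero_le_one, le_rfl⟩
          rw [← integral_Ioc_eq_integral_Ioo, ← intervalIntegral.integral_of_le zero_le_one,
            intervalIntegral.integral_add ((γ.intervalIntegrable_dx h0 h1).const_mul _)
              (γ.intervalIntegrable_dy h0 h1), intervalIntegral.integral_const_mul,
            γ.integral_dx h0 h1, γ.integral_dy h0 h1, hx, hy]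
          simp [h.X_zero, h.X_one]
  · refine ⟨_, hanti.tendsto_nhdsWithin_Ioo_left ⟨1 / 2, by norm_num, by norm_num⟩
      ⟨-(B - 1), ?_⟩⟩
    rintro _ ⟨r, hr, rfl⟩
    have hsurj := intermediate_value_Ioo hβ1.le (h.continuous_X.continuousOn (s := Icc β 1))
    rw [hβ0, h.X_one] at hsurj
    obtain ⟨t, ht, rfl⟩ := hsurj hr
    rw [hdu t ht, le_div_iff₀ (hQ1 t ht)]
    have := (h.Q_mem t).2
    linarith

end HullData

theorem integrableOn_Icc_comp_sub_left {f : ℝ → ℝ} {a b : ℝ} (c : ℝ)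
    (h : IntegrableOn f (Icc (c - b) (c - a))) : IntegrableOn (fun t => f (c - t)) (Icc a b) := by
  have := ((Measure.measurePreserving_sub_left volume c).integrableOn_comp_preimage
    (Homeomorph.subLeft c).measurableEmbedding (f := f) (s := Icc (c - b) (c - a))).2 h
  rwa [Set.preimage_const_sub_Icc, sub_sub_cancel, sub_sub_cancel] at this

theorem W22locOn.reflect {u du ddu : ℝ → ℝ} {c d : ℝ} (h : W22locOn u du ddu c d) :
    W22locOn (fun x => u (1 - x)) (fun x => -du (1 - x)) (fun x => ddu (1 - x))
      (1 - d) (1 - c) where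
  du_loc a b ha hb :=
    (integrableOn_Icc_comp_sub_left 1 (h.du_loc _ _ (by linarith) (by linarith))).neg
  ddu_loc a b ha hb :=
    integrableOn_Icc_comp_sub_left 1 (h.ddu_loc _ _ (by linarith) (by linarith))
  ddu_sq a b ha hb := integrableOn_Icc_comp_sub_left (f := fun t => ddu t ^ 2) 1
    (h.ddu_sq _ _ (by linarith) (by linarith))
  ftc_u a ha t ht := by
    have h1 := h.ftc_u (1 - a) ⟨by linarith [ha.2], by linarith [ha.1]⟩ (1 - t)
      ⟨by linarith [ht.2], by linarith [ht.1]⟩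
    rw [intervalIntegral.integral_neg, intervalIntegral.integral_comp_sub_left (fun s => du s) 1,
      ← intervalIntegral.integral_symm]
    exact h1
  ftc_du a ha t ht := by
    have h1 := h.ftc_du (1 - a) ⟨by linarith [ha.2], by linarith [ha.1]⟩ (1 - t)
      ⟨by linarith [ht.2], by linarith [ht.1]⟩
    rw [intervalIntegral.integral_comp_sub_left (fun s => ddu s) 1,
      intervalIntegral.integral_symm, h1]
    ring

/-- The mirror image of a curve in the line `x = 1/2`, traversed backwards. -/
def Curve.reflect (γ : Curve) : Curve where
  x t := 1 - γ.x (1 - t)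
  y t := γ.y (1 - t)
  dx t := γ.dx (1 - t)
  dy t := -γ.dy (1 - t)
  ddx t := -γ.ddx (1 - t)
  ddy t := γ.ddy (1 - t)
  dx_int := integrableOn_Icc_comp_sub_left 1 (by simpa using γ.dx_int)
  dy_int := (integrableOn_Icc_comp_sub_left 1 (by simpa using γ.dy_int)).neg
  ftc_x t ht := by
    rw [intervalIntegral.integral_comp_sub_left (fun s => γ.dx s) 1,
      γ.integral_dx ⟨by linarith [ht.2], by linarith [ht.1]⟩ ⟨by norm_num, by norm_num⟩]
    ring
  ftc_y t ht := by
    rw [intervalIntegral.integral_neg, intervalIntegral.integral_comp_sub_left (fun s => γ.dy s) 1,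
      γ.integral_dy ⟨by linarith [ht.2], by linarith [ht.1]⟩ ⟨by norm_num, by norm_num⟩]
    ring
  ddx_loc a b ha hb :=
    (integrableOn_Icc_comp_sub_left 1 (γ.ddx_loc _ _ (by linarith) (by linarith))).neg
  ddy_loc a b ha hb :=
    integrableOn_Icc_comp_sub_left 1 (γ.ddy_loc _ _ (by linarith) (by linarith))
  ftc_dx a ha t ht := by
    have h1 := γ.ftc_dx (1 - a) ⟨by linarith [ha.2], by linarith [ha.1]⟩ (1 - t)
      ⟨by linarith [ht.2], by linarith [ht.1]⟩
    rw [intervalIntegral.integral_neg, intervalIntegral.integral_comp_sub_left (fun s => γ.ddx s) 1,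
      ← intervalIntegral.integral_symm]
    exact h1
  ftc_dy a ha t ht := by
    have h1 := γ.ftc_dy (1 - a) ⟨by linarith [ha.2], by linarith [ha.1]⟩ (1 - t)
      ⟨by linarith [ht.2], by linarith [ht.1]⟩
    rw [intervalIntegral.integral_comp_sub_left (fun s => γ.ddy s) 1,
      intervalIntegral.integral_symm, h1]
    ring

theorem lintegral_Ioo_comp_one_sub (f : ℝ → ENNReal) :
    ∫⁻ t in Ioo (0:ℝ) 1, f (1 - t) = ∫⁻ t in Ioo (0:ℝ) 1, f t := by
  have := (Measure.measurePreserving_sub_left volume (1:ℝ)).setLIntegral_comp_preimage_emb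
    (Homeomorph.subLeft (1:ℝ)).measurableEmbedding f (Ioo 0 1)
  rwa [Set.preimage_const_sub_Ioo, sub_zero, sub_self] at this

theorem one_sub_mem_Ioo {t : ℝ} (ht : t ∈ Ioo (0:ℝ) 1) : 1 - t ∈ Ioo (0:ℝ) 1 :=
  ⟨by linarith [ht.2], by linarith [ht.1]⟩

namespace Curve

theorem speed1_reflect (γ : Curve) (t : ℝ) :
    speed1 γ.reflect.toCurve1 t = speed1 γ.toCurve1 (1 - t) := by
  simp [speed1, reflect]

theorem lenE_reflect (γ : Curve) : lenE γ.reflect = lenE γ := by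
  unfold lenE len1E
  simp_rw [speed1_reflect]
  exact lintegral_Ioo_comp_one_sub fun t => ENNReal.ofReal (speed1 γ.toCurve1 t)

theorem elInt_reflect (γ : Curve) (t : ℝ) : elInt γ.reflect t = elInt γ (1 - t) := by
  simp only [elInt, reflect, neg_sq]
  congr 2
  ring

theorem elE_reflect (γ : Curve) : elE γ.reflect = elE γ := by
  unfold elE
  simp_rw [elInt_reflect]
  exact lintegral_Ioo_comp_one_sub fun t => ENNReal.ofReal (elInt γ t)

end Curve

theorem MemP.reflect {ψ : ℝ → ℝ} {γ : Curve} (h : MemP ψ γ) :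
    MemP (fun x => ψ (1 - x)) γ.reflect := by
  obtain ⟨⟨⟨ε, hε, him⟩, hdx, hg⟩, h1, h2, h3, h4, h5⟩ := h
  refine ⟨⟨⟨ε, hε, fun t ht => ?_⟩, fun t ht => hdx _ (one_sub_mem_Ioo ht), ?_⟩, ?_, ?_, ?_, ?_, ?_⟩
  · rw [Curve.speed1_reflect]
    exact him _ (one_sub_mem_Ioo ht)
  · intro a b ha hab hb hpos
    obtain ⟨u, du, ddu, hu, hg⟩ := hg (1 - b) (1 - a) (by linarith) (by linarith) (by linarith)
      fun t ht => by
        have := hpos (1 - t) ⟨by linarith [ht.2], by linarith [ht.1]⟩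
        simpa [Curve.reflect] using this
    refine ⟨_, _, _, hu.reflect, fun t ht => ?_⟩
    simp only [Curve.reflect, sub_sub_cancel]
    exact hg _ ⟨by linarith [ht.2], by linarith [ht.1]⟩
  · simp [Curve.reflect, h3]
  · simp [Curve.reflect, h4]
  · simp [Curve.reflect, h1]
  · simp [Curve.reflect, h2]
  · intro t ht
    simp only [Curve.reflect, sub_sub_cancel]
    exact h5 _ ⟨by linarith [ht.2], by linarith [ht.1]⟩

theorem CapShaped.reflect {γ : Curve} {β₁ β₂ : ℝ} {u du ddu : ℝ → ℝ}
    (h : CapShaped γ β₁ β₂ u du ddu) :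
    CapShaped γ.reflect (1 - β₂) (1 - β₁) (fun x => u (1 - x)) (fun x => -du (1 - x))
      (fun x => ddu (1 - x)) where
  hβ := ⟨by linarith [h.hβ.2.2], by linarith [h.hβ.2.1], by linarith [h.hβ.1]⟩
  left t ht := by
    simp [Curve.reflect, h.right (1 - t) ⟨by linarith [ht.2], by linarith [ht.1]⟩]
  right t ht := by
    simp [Curve.reflect, h.left (1 - t) ⟨by linarith [ht.2], by linarith [ht.1]⟩]
  pos t ht := h.pos _ ⟨by linarith [ht.2], by linarith [ht.1]⟩
  graph t ht := by
    simp only [Curve.reflect, sub_sub_cancel]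
    exact h.graph _ ⟨by linarith [ht.2], by linarith [ht.1]⟩
  reg := by simpa using h.reg.reflect

theorem ConcaveOn.comp_one_sub {u : ℝ → ℝ} (h : ConcaveOn ℝ (Ioo 0 1) u) :
    ConcaveOn ℝ (Ioo 0 1) fun x => u (1 - x) := by
  refine ⟨convex_Ioo 0 1, fun x hx y hy a b ha hb hab => ?_⟩
  have := h.2 (one_sub_mem_Ioo hx) (one_sub_mem_Ioo hy) ha hb hab
  simp only [smul_eq_mul] at this ⊢
  rwa [show a * (1 - x) + b * (1 - y) = 1 - (a * x + b * y) by linear_combination hab] at this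

theorem tendsto_one_sub_nhdsGT_zero :
    Tendsto (fun x : ℝ => 1 - x) (𝓝[>] 0) (𝓝[<] 1) := by
  refine tendsto_nhdsWithin_iff.2 ⟨?_, ?_⟩
  · exact tendsto_nhdsWithin_of_tendsto_nhds
      ((by fun_prop : Continuous fun x : ℝ => 1 - x).tendsto' _ _ (sub_zero 1))
  · filter_upwards [self_mem_nhdsWithin] with x hx
    simpa using hx

theorem integrable_one_add_sq_rpow : Integrable fun s : ℝ => ((1 + s ^ 2) ^ (-(5:ℝ)/4) : ℝ) := by
  have := integrable_rpow_neg_one_add_norm_sq (E := ℝ) (μ := volume) (r := 5 / 2) (by norm_num)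
  convert this using 3
  · simp
  · norm_num

theorem tendsto_Gfun_atTop : Tendsto Gfun atTop (𝓝 (c0 / 2)) := by
  have h := intervalIntegral_tendsto_integral_Ioi 0 integrable_one_add_sq_rpow.integrableOn
    (tendsto_id (α := ℝ))
  have h2 := integral_comp_abs (f := fun s : ℝ => ((1 + s ^ 2) ^ (-(5:ℝ)/4) : ℝ))
  simp only [sq_abs] at h2
  rw [c0, h2, mul_div_cancel_left₀ _ two_ne_zero]
  exact h

theorem strictMono_Gfun : StrictMono Gfun :=
  strictMono_of_hasDerivAt_pos hasDerivAt_Gfun fun _ => by positivity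

theorem Gfun_zero : Gfun 0 = 0 := by simp [Gfun]

theorem Gfun_lt (x : ℝ) : Gfun x < c0 / 2 :=
  (strictMono_Gfun (lt_add_one x)).trans_le
    (strictMono_Gfun.monotone.ge_of_tendsto tendsto_Gfun_atTop _)

theorem c0_pos : 0 < c0 := by linarith [Gfun_lt 0, Gfun_zero]

theorem Gfun_Ginv {y : ℝ} (h0 : 0 ≤ y) (h1 : y < c0 / 2) : Gfun (Ginv y) = y := by
  obtain ⟨b, hb⟩ := (tendsto_Gfun_atTop.eventually (lt_mem_nhds h1)).exists
  have hb0 : 0 ≤ b := by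
    rw [← strictMono_Gfun.le_iff_le, Gfun_zero]
    exact h0.trans hb.le
  obtain ⟨x, -, hx⟩ := intermediate_value_Icc hb0
    (fun x _ => (hasDerivAt_Gfun x).continuousAt.continuousWithinAt)
    (show y ∈ Icc (Gfun 0) (Gfun b) from ⟨by rwa [Gfun_zero], hb.le⟩)
  exact Function.invFun_eq ⟨x, hx⟩

/-- The slope threshold appearing in the length bound is positive and its image under `G`
exceeds half the square root of the energy. -/
theorem Ginv_threshold {α : ℝ} (h0 : 0 ≤ α) (h1 : α < c0 ^ 2) :
    0 < Ginv (Real.sqrt ((α + c0 ^ 2) / 2) - c0 / 2) ∧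
      α < 4 * Gfun (Ginv (Real.sqrt ((α + c0 ^ 2) / 2) - c0 / 2)) ^ 2 := by
  have hc := c0_pos
  have hs := Real.sqrt_nonneg α
  have hs2 := Real.sq_sqrt h0
  have hlt : Real.sqrt α < c0 := by rwa [Real.sqrt_lt h0 hc.le]
  have hlow : (Real.sqrt α + c0) / 2 < Real.sqrt ((α + c0 ^ 2) / 2) := by
    apply Real.lt_sqrt_of_sq_lt
    nlinarith [sq_pos_of_pos (sub_pos.2 hlt)]
  have hup : Real.sqrt ((α + c0 ^ 2) / 2) < c0 := by
    rw [Real.sqrt_lt (by positivity) hc.le]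
    linarith
  set y := Real.sqrt ((α + c0 ^ 2) / 2) - c0 / 2 with hy
  have hG : Gfun (Ginv y) = y := Gfun_Ginv (by linarith) (by linarith)
  refine ⟨?_, ?_⟩
  · rw [← strictMono_Gfun.lt_iff_lt, Gfun_zero, hG]
    linarith
  · rw [hG]
    nlinarith

theorem exists_cap_of_forall_slope {ψ : ℝ → ℝ} (hψ : ψ 0 < 0) {α a : ℝ} (hα : 0 ≤ α) (ha : 0 < a)
    (h : ∀ n : ℕ, ∃ γ, MemP ψ γ ∧ elE γ ≤ ENNReal.ofReal (α + 1 / ((n:ℝ) + 1)) ∧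
      ∀ t ∈ Ioo (0:ℝ) 1, 0 < γ.dy t + a * γ.dx t) :
    ∃ (γ : Curve) (β₁ β₂ : ℝ) (u du ddu : ℝ → ℝ),
      MemP ψ γ ∧ CapShaped γ β₁ β₂ u du ddu ∧ ConcaveOn ℝ (Ioo (0:ℝ) 1) u ∧
      elE γ ≤ ENNReal.ofReal α ∧ lenE γ ≤ ENNReal.ofReal (a + Real.sqrt (1 + a ^ 2)) ∧
      ∃ d : ℝ, Tendsto du (𝓝[<] (1:ℝ)) (𝓝 d) := by
  obtain ⟨X, Q, Φ, hX⟩ := HullData.of_approx (ψ := ψ) (α := α) (by linarith : 0 < a + 1) fun n => by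
    obtain ⟨γ, hγ, hE, hpos⟩ := h n
    exact hγ.exists_hullData (by positivity) ha hE hpos
  simpa using hX.exists_cap (by linarith) hψ

/-- Below the energy `4 G(a)²`, the infimum of the elastic energy is attained by a concave cap
with at most one vertical tangent. -/
theorem exists_cap_of_infP_lt {ψ : ℝ → ℝ} (hψ : Admissible ψ) {a : ℝ} (ha : 0 < a)
    (hfin : infP ψ ≠ ⊤) (hlt : (infP ψ).toReal < 4 * Gfun a ^ 2) :
    ∃ (γ : Curve) (β₁ β₂ : ℝ) (u du ddu : ℝ → ℝ),
      MemP ψ γ ∧ CapShaped γ β₁ β₂ u du ddu ∧ ConcaveOn ℝ (Ioo (0:ℝ) 1) u ∧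
      elE γ = infP ψ ∧ lenE γ ≤ ENNReal.ofReal (a + Real.sqrt (1 + a ^ 2)) ∧
      ((∃ d : ℝ, Tendsto du (𝓝[>] (0:ℝ)) (𝓝 d)) ∨ ∃ d : ℝ, Tendsto du (𝓝[<] (1:ℝ)) (𝓝 d)) := by
  set α := (infP ψ).toReal with hα
  have hα0 : 0 ≤ α := ENNReal.toReal_nonneg
  have hofα : ENNReal.ofReal α = infP ψ := ENNReal.ofReal_toReal hfin
  have hge : ∀ {γ}, MemP ψ γ → elE γ ≤ ENNReal.ofReal α → elE γ = infP ψ := fun {γ} hγ hE =>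
    le_antisymm (hE.trans_eq hofα) (sInf_le ⟨γ, hγ, rfl⟩)
  have happ : ∀ δ > 0, ∃ γ, MemP ψ γ ∧ elE γ ≤ ENNReal.ofReal (α + δ) := fun δ hδ => by
    have : infP ψ < ENNReal.ofReal (α + δ) := by
      rw [← hofα]
      exact (ENNReal.ofReal_lt_ofReal_iff (by positivity)).2 (by linarith)
    obtain ⟨e, ⟨γ, hγ, rfl⟩, he⟩ := sInf_lt_iff.1 this
    exact ⟨γ, hγ, he.le⟩
  have hdich : ∀ δ > 0, ∃ γ, MemP ψ γ ∧ elE γ ≤ ENNReal.ofReal (α + δ) ∧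
      ((∀ t ∈ Ioo (0:ℝ) 1, 0 < γ.dy t + a * γ.dx t) ∨
        ∀ t ∈ Ioo (0:ℝ) 1, 0 < a * γ.dx t - γ.dy t) := fun δ hδ => by
    obtain ⟨δ', h0, h1⟩ := exists_between (lt_min hδ (sub_pos.2 hlt))
    obtain ⟨γ, hγ, hE⟩ := happ δ' h0
    refine ⟨γ, hγ, hE.trans (ENNReal.ofReal_le_ofReal ?_), ?_⟩
    · linarith [h1.trans_le (min_le_left _ _)]
    · exact γ.slope_dichotomy hγ.1.1 hγ.1.2.1 hγ.2.1 hγ.2.2.2.1 (by positivity) ha hE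
        (by linarith [h1.trans_le (min_le_right _ _)])
  by_cases hR : ∀ n : ℕ, ∃ γ, MemP ψ γ ∧ elE γ ≤ ENNReal.ofReal (α + 1 / ((n:ℝ) + 1)) ∧
      ∀ t ∈ Ioo (0:ℝ) 1, 0 < γ.dy t + a * γ.dx t
  · obtain ⟨γ, β₁, β₂, u, du, ddu, h1, h2, h3, h4, h5, h6⟩ :=
      exists_cap_of_forall_slope hψ.neg0 hα0 ha hR
    exact ⟨γ, β₁, β₂, u, du, ddu, h1, h2, h3, hge h1 h4, h5, Or.inr h6⟩
  · push Not at hR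
    obtain ⟨N, hN⟩ := hR
    have hL : ∀ n : ℕ, ∃ γ, MemP (fun x => ψ (1 - x)) γ ∧
        elE γ ≤ ENNReal.ofReal (α + 1 / ((n:ℝ) + 1)) ∧
        ∀ t ∈ Ioo (0:ℝ) 1, 0 < γ.dy t + a * γ.dx t := fun n => by
      obtain ⟨γ, hγ, hE, hd⟩ := hdich (1 / ((max n N : ℕ) + 1)) Nat.one_div_pos_of_nat
      have hmono : ∀ k ≤ max n N, elE γ ≤ ENNReal.ofReal (α + 1 / ((k:ℝ) + 1)) := fun k hk =>
        hE.trans (ENNReal.ofReal_le_ofReal (add_le_add_right (Nat.one_div_le_one_div hk) _))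
      refine ⟨γ.reflect, hγ.reflect, ?_, fun t ht => ?_⟩
      · rw [Curve.elE_reflect]
        exact hmono n (le_max_left _ _)
      · rcases hd with hd | hd
        · obtain ⟨s, hs, hs'⟩ := hN γ hγ (hmono N (le_max_right _ _))
          exact absurd (hd s hs) hs'.not_gt
        · have := hd _ (one_sub_mem_Ioo ht)
          simp only [Curve.reflect]
          linarith
    obtain ⟨γ, β₁, β₂, u, du, ddu, h1, h2, h3, h4, h5, d, h6⟩ :=
      exists_cap_of_forall_slope (by simpa using hψ.neg1) hα0 ha hL
    have h1' : MemP ψ γ.reflect := by simpa using h1.reflect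
    refine ⟨γ.reflect, _, _, _, _, _, h1', h2.reflect, h3.comp_one_sub, hge h1' ?_, ?_,
      Or.inl ⟨-d, (h6.comp tendsto_one_sub_nhdsGT_zero).neg⟩⟩
    · rwa [Curve.elE_reflect]
    · rwa [Curve.lenE_reflect]

/-- The horizontal speed of the rectangular elastica with height `sin ω`. -/
def elasticaSpeed (ω : ℝ) : ℝ := Real.sin ω ^ 2 / Real.sqrt (1 + Real.sin ω ^ 2)

/-- The horizontal width of one arch of the rectangular elastica. -/
def elasticaWidth : ℝ := ∫ ω in (0:ℝ)..Real.pi, elasticaSpeed ω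

/-- The slope of the rectangular elastica. -/
def elasticaSlope (ω : ℝ) : ℝ := Real.cos ω * Real.sqrt (1 + Real.sin ω ^ 2) / Real.sin ω ^ 2

theorem one_add_sin_sq_pos (ω : ℝ) : 0 < 1 + Real.sin ω ^ 2 := by positivity

theorem continuous_elasticaSpeed : Continuous elasticaSpeed := by
  refine (by fun_prop : Continuous fun ω : ℝ => Real.sin ω ^ 2).div (by fun_prop) fun ω => ?_
  exact (Real.sqrt_pos.2 (one_add_sin_sq_pos ω)).ne'

theorem elasticaSpeed_nonneg (ω : ℝ) : 0 ≤ elasticaSpeed ω := by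
  unfold elasticaSpeed; positivity

theorem elasticaSpeed_pos {ω : ℝ} (h : 0 < Real.sin ω) : 0 < elasticaSpeed ω :=
  div_pos (by positivity) (Real.sqrt_pos.2 (one_add_sin_sq_pos ω))

theorem hasDerivAt_sqrt_one_add_sin_sq (ω : ℝ) :
    HasDerivAt (fun ω => Real.sqrt (1 + Real.sin ω ^ 2))
      (Real.sin ω * Real.cos ω / Real.sqrt (1 + Real.sin ω ^ 2)) ω := by
  have h := (((Real.hasDerivAt_sin ω).pow 2).const_add 1).sqrt (one_add_sin_sq_pos ω).ne'
  refine h.congr_deriv ?_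
  have := (Real.sqrt_pos.2 (one_add_sin_sq_pos ω)).ne'
  simp only [Pi.pow_apply]
  field_simp
  norm_num
  ring

theorem hasDerivAt_elasticaSpeed (ω : ℝ) :
    HasDerivAt elasticaSpeed (Real.sin ω * Real.cos ω * (2 + Real.sin ω ^ 2) /
      Real.sqrt (1 + Real.sin ω ^ 2) ^ 3) ω := by
  have hr := (Real.sqrt_pos.2 (one_add_sin_sq_pos ω)).ne'
  have h := ((Real.hasDerivAt_sin ω).pow 2).div (hasDerivAt_sqrt_one_add_sin_sq ω) hr
  refine h.congr_deriv ?_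
  have h2 := Real.sq_sqrt (one_add_sin_sq_pos ω).le
  simp only [Pi.pow_apply]
  set r := Real.sqrt (1 + Real.sin ω ^ 2)
  field_simp
  rw [h2]
  ring

theorem hasDerivAt_elasticaSlope {ω : ℝ} (hs : 0 < Real.sin ω) :
    HasDerivAt elasticaSlope
      (-(2 / (Real.sin ω ^ 3 * Real.sqrt (1 + Real.sin ω ^ 2)))) ω := by
  have hr := (Real.sqrt_pos.2 (one_add_sin_sq_pos ω)).ne'
  have h := ((Real.hasDerivAt_cos ω).mul (hasDerivAt_sqrt_one_add_sin_sq ω)).div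
    ((Real.hasDerivAt_sin ω).pow 2) (by simpa using hs.ne')
  refine h.congr_deriv ?_
  have h2 := Real.sq_sqrt (one_add_sin_sq_pos ω).le
  have hc := Real.cos_sq' ω
  simp only [Pi.pow_apply, Pi.mul_apply]
  set r := Real.sqrt (1 + Real.sin ω ^ 2)
  set s := Real.sin ω
  set c := Real.cos ω
  field_simp
  rw [h2, hc]
  ring

theorem one_add_elasticaSlope_sq {ω : ℝ} (hs : 0 < Real.sin ω) :
    1 + elasticaSlope ω ^ 2 = (Real.sin ω ^ 4)⁻¹ := by
  rw [elasticaSlope, div_pow, mul_pow, Real.sq_sqrt (one_add_sin_sq_pos ω).le, Real.cos_sq']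
  field_simp
  ring

theorem hasDerivAt_Gfun_elasticaSlope {ω : ℝ} (hs : 0 < Real.sin ω) :
    HasDerivAt (fun ω => Gfun (elasticaSlope ω)) (-(2 * elasticaSpeed ω)) ω := by
  refine ((hasDerivAt_Gfun _).comp ω (hasDerivAt_elasticaSlope hs)).congr_deriv ?_
  have hr := (Real.sqrt_pos.2 (one_add_sin_sq_pos ω)).ne'
  have : (1 + elasticaSlope ω ^ 2) ^ (-(5:ℝ)/4) = Real.sin ω ^ 5 := by
    rw [one_add_elasticaSlope_sq hs, Real.inv_rpow (by positivity), ← Real.rpow_neg (by positivity),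
      ← Real.rpow_natCast, ← Real.rpow_mul hs.le, ← Real.rpow_natCast]
    norm_num
  rw [this, elasticaSpeed]
  field_simp

theorem elasticaWidth_pos : 0 < elasticaWidth :=
  intervalIntegral.intervalIntegral_pos_of_pos_on
    (continuous_elasticaSpeed.intervalIntegrable _ _)
    (fun _ hω => elasticaSpeed_pos (Real.sin_pos_of_mem_Ioo hω)) Real.pi_pos

theorem two_mul_elasticaWidth_le : 2 * elasticaWidth ≤ c0 := by
  have hcont : Continuous fun b => ∫ ω in (0:ℝ)..b, elasticaSpeed ω :=
    intervalIntegral.continuous_primitive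
      (fun a b => continuous_elasticaSpeed.intervalIntegrable a b) 0
  have hlim : Tendsto (fun ε : ℝ => 2 * ((∫ ω in (0:ℝ)..(Real.pi - ε), elasticaSpeed ω) -
      ∫ ω in (0:ℝ)..ε, elasticaSpeed ω)) (𝓝[>] 0) (𝓝 (2 * elasticaWidth)) := by
    refine tendsto_nhdsWithin_of_tendsto_nhds (Continuous.tendsto' ?_ _ _ ?_)
    · exact continuous_const.mul ((hcont.comp (continuous_const.sub continuous_id)).sub hcont)
    · simp [elasticaWidth]
  refine le_of_tendsto hlim ?_
  filter_upwards [Ioo_mem_nhdsGT (half_pos Real.pi_pos)] with ε hε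
  have hle : ε ≤ Real.pi - ε := by linarith [hε.2]
  have h_int := fun a b => continuous_elasticaSpeed.intervalIntegrable (μ := volume) a b
  have hftc := intervalIntegral.integral_eq_sub_of_hasDerivAt (a := ε) (b := Real.pi - ε)
    (f := fun ω => Gfun (elasticaSlope ω)) (f' := fun ω => -(2 * elasticaSpeed ω))
    (fun ω hω => hasDerivAt_Gfun_elasticaSlope (Real.sin_pos_of_mem_Ioo (by
      rw [uIcc_of_le hle] at hω
      exact ⟨hε.1.trans_le hω.1, hω.2.trans_lt (by linarith [hε.1])⟩)))
    ((h_int _ _).const_mul 2).neg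
  rw [intervalIntegral.integral_neg, intervalIntegral.integral_const_mul] at hftc
  rw [intervalIntegral.integral_interval_sub_left (h_int _ _) (h_int _ _)]
  have h1 := Gfun_lt (elasticaSlope ε)
  have h2 := Gfun_lt (-elasticaSlope (Real.pi - ε))
  rw [Gfun_neg] at h2
  linarith

/-- The angle of the rectangular elastica, extended by vertical segments of relative length `m`. -/
def clampAngle (m t : ℝ) : ℝ := max 0 (min ((Real.pi + 2 * m) * t - m) Real.pi)

/-- The derivative of `clampAngle`. -/
def clampAngleDeriv (m t : ℝ) : ℝ :=
  (Ioo (m / (Real.pi + 2 * m)) ((Real.pi + m) / (Real.pi + 2 * m))).indicator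
    (fun _ => Real.pi + 2 * m) t

theorem continuous_clampAngle (m : ℝ) : Continuous (clampAngle m) := by
  unfold clampAngle; fun_prop

section clampAngle

variable {m t : ℝ}

theorem clampAngle_of_le (hm : 0 < m) (ht : t ≤ m / (Real.pi + 2 * m)) : clampAngle m t = 0 := by
  have hpi := Real.pi_pos
  rw [le_div_iff₀ (by positivity)] at ht
  exact max_eq_left ((min_le_left _ _).trans (by linarith))

theorem clampAngle_of_ge (hm : 0 < m) (ht : (Real.pi + m) / (Real.pi + 2 * m) ≤ t) :
    clampAngle m t = Real.pi := by
  have hpi := Real.pi_pos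
  rw [div_le_iff₀ (by positivity)] at ht
  rw [clampAngle, min_eq_right (by linarith), max_eq_right hpi.le]

theorem clampAngle_of_mem (hm : 0 < m)
    (ht : t ∈ Icc (m / (Real.pi + 2 * m)) ((Real.pi + m) / (Real.pi + 2 * m))) :
    clampAngle m t = (Real.pi + 2 * m) * t - m := by
  have hpi := Real.pi_pos
  have h1 := ht.1
  have h2 := ht.2
  rw [div_le_iff₀ (by positivity)] at h1
  rw [le_div_iff₀ (by positivity)] at h2
  rw [clampAngle, min_eq_left (by linarith), max_eq_right (by linarith)]

theorem clampAngle_mem (m t : ℝ) : clampAngle m t ∈ Icc 0 Real.pi :=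
  ⟨le_max_left _ _, max_le Real.pi_pos.le (min_le_right _ _)⟩

theorem clampAngle_mem_Ioo (hm : 0 < m)
    (ht : t ∈ Ioo (m / (Real.pi + 2 * m)) ((Real.pi + m) / (Real.pi + 2 * m))) :
    clampAngle m t ∈ Ioo 0 Real.pi := by
  have hpi := Real.pi_pos
  rw [clampAngle_of_mem hm (Ioo_subset_Icc_self ht)]
  have h1 := ht.1
  have h2 := ht.2
  rw [div_lt_iff₀ (by positivity)] at h1
  rw [lt_div_iff₀ (by positivity)] at h2
  constructor <;> linarith

theorem hasDerivAt_clampAngle (hm : 0 < m)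
    (ht : t ∉ ({m / (Real.pi + 2 * m), (Real.pi + m) / (Real.pi + 2 * m)} : Set ℝ)) :
    HasDerivAt (clampAngle m) (clampAngleDeriv m t) t := by
  simp only [mem_insert_iff, mem_singleton_iff, not_or] at ht
  rcases lt_or_gt_of_ne ht.1 with h1 | h1
  · rw [clampAngleDeriv, indicator_of_notMem fun h => h.1.not_gt h1]
    refine (hasDerivAt_const t (0:ℝ)).congr_of_eventuallyEq ?_
    filter_upwards [Iio_mem_nhds h1] with s hs
    exact clampAngle_of_le hm (le_of_lt hs)
  rcases lt_or_gt_of_ne ht.2 with h2 | h2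
  · rw [clampAngleDeriv, indicator_of_mem (show t ∈ Ioo _ _ from ⟨h1, h2⟩)]
    refine HasDerivAt.congr_of_eventuallyEq
      (((hasDerivAt_id t).const_mul (Real.pi + 2 * m)).sub_const m |>.congr_deriv (mul_one _)) ?_
    filter_upwards [Ioo_mem_nhds h1 h2] with s hs
    exact clampAngle_of_mem hm (Ioo_subset_Icc_self hs)
  · rw [clampAngleDeriv, indicator_of_notMem fun h => h.2.not_gt h2]
    refine (hasDerivAt_const t Real.pi).congr_of_eventuallyEq ?_
    filter_upwards [Ioi_mem_nhds h2] with s hs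
    exact clampAngle_of_ge hm (le_of_lt hs)

theorem hasDerivAt_abs_sub_clampAngle (hm : 0 < m)
    (ht : t ∉ ({m / (Real.pi + 2 * m), (Real.pi + m) / (Real.pi + 2 * m)} : Set ℝ)) :
    HasDerivAt (fun t => Real.sin (clampAngle m t) - |(Real.pi + 2 * m) * t - m - clampAngle m t|)
      ((Real.pi + 2 * m) * Real.cos (clampAngle m t)) t := by
  have hpi := Real.pi_pos
  have hl : HasDerivAt (fun s => (Real.pi + 2 * m) * s - m) (Real.pi + 2 * m) t :=
    ((hasDerivAt_id t).const_mul (Real.pi + 2 * m)).sub_const m |>.congr_deriv (mul_one _)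
  simp only [mem_insert_iff, mem_singleton_iff, not_or] at ht
  rcases lt_or_gt_of_ne ht.1 with h1 | h1
  · rw [clampAngle_of_le hm h1.le, Real.cos_zero, mul_one]
    refine hl.congr_of_eventuallyEq ?_
    filter_upwards [Iio_mem_nhds h1] with s hs
    rw [clampAngle_of_le hm (le_of_lt hs)]
    rw [mem_Iio, lt_div_iff₀ (by positivity)] at hs
    rw [Real.sin_zero, sub_zero, abs_of_neg (by linarith)]
    ring
  rcases lt_or_gt_of_ne ht.2 with h2 | h2
  · rw [clampAngle_of_mem hm ⟨h1.le, h2.le⟩]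
    refine (hl.sin.congr_deriv (mul_comm _ _)).congr_of_eventuallyEq ?_
    filter_upwards [Ioo_mem_nhds h1 h2] with s hs
    rw [clampAngle_of_mem hm (Ioo_subset_Icc_self hs), sub_self, abs_zero, sub_zero]
  · rw [clampAngle_of_ge hm h2.le, Real.cos_pi]
    refine ((hl.const_sub Real.pi).congr_deriv (by ring)).congr_of_eventuallyEq ?_
    filter_upwards [Ioi_mem_nhds h2] with s hs
    rw [clampAngle_of_ge hm (le_of_lt hs)]
    rw [mem_Ioi, div_lt_iff₀ (by positivity)] at hs
    rw [Real.sin_pi, abs_of_pos (by linarith)]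
    ring

theorem integrableOn_mul_clampAngleDeriv {f : ℝ → ℝ} (hf : Continuous f) (a b : ℝ) :
    IntegrableOn (fun t => f t * clampAngleDeriv m t) (Icc a b) := by
  have h : IntegrableOn (fun t => f t * (Real.pi + 2 * m)) (Icc a b) :=
    (hf.mul continuous_const).continuousOn.integrableOn_Icc
  refine (h.indicator (measurableSet_Ioo (a := m / (Real.pi + 2 * m))
    (b := (Real.pi + m) / (Real.pi + 2 * m)))).congr_fun (fun t _ => ?_) measurableSet_Icc
  simp only [clampAngleDeriv, indicator]
  split_ifs <;> simp

end clampAngle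

/-- One arch of the rectangular elastica, rescaled to unit width and put on top of two vertical
segments. -/
theorem exists_elastica_curve {m : ℝ} (hm : 0 < m) : ∃ γ : Curve,
    (γ.x = fun t => elasticaWidth⁻¹ * ∫ ω in (0:ℝ)..clampAngle m t, elasticaSpeed ω) ∧
    (γ.y = fun t => elasticaWidth⁻¹ * (m + (Real.sin (clampAngle m t) -
      |(Real.pi + 2 * m) * t - m - clampAngle m t|))) ∧
    (γ.dx = fun t => elasticaWidth⁻¹ * (Real.pi + 2 * m) * elasticaSpeed (clampAngle m t)) ∧
    (γ.dy = fun t => elasticaWidth⁻¹ * (Real.pi + 2 * m) * Real.cos (clampAngle m t)) ∧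
    (γ.ddx = fun t => elasticaWidth⁻¹ * (Real.pi + 2 * m) * (Real.sin (clampAngle m t) *
      Real.cos (clampAngle m t) * (2 + Real.sin (clampAngle m t) ^ 2) /
      Real.sqrt (1 + Real.sin (clampAngle m t) ^ 2) ^ 3) * clampAngleDeriv m t) ∧
    (γ.ddy = fun t => elasticaWidth⁻¹ * (Real.pi + 2 * m) * (-Real.sin (clampAngle m t)) *
      clampAngleDeriv m t) := by
  set S : Set ℝ := {m / (Real.pi + 2 * m), (Real.pi + m) / (Real.pi + 2 * m)} with hS
  have hSc : S.Countable := (Set.toFinite S).countable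
  have hθ := continuous_clampAngle m
  have hprim : ∀ b, HasDerivAt (fun b => ∫ ω in (0:ℝ)..b, elasticaSpeed ω) (elasticaSpeed b) b :=
    fun b => continuous_elasticaSpeed.integral_hasStrictDerivAt 0 b |>.hasDerivAt
  have hprimc : Continuous fun b => ∫ ω in (0:ℝ)..b, elasticaSpeed ω :=
    continuous_iff_continuousAt.2 fun b => (hprim b).continuousAt
  have hftc : ∀ {f f' : ℝ → ℝ}, Continuous f → (∀ t ∉ S, HasDerivAt f (f' t) t) →
      (∀ a b, IntegrableOn f' (Icc a b)) → ∀ a t, f t = f a + ∫ s in a..t, f' s := by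
    intro f f' hf hd hi a t
    rw [integral_eq_of_hasDerivAt_off_countable f f' hSc hf.continuousOn (fun s hs => hd s hs.2)
      (intervalIntegrable_iff.2 ((hi _ _).mono_set uIoc_subset_uIcc))]
    ring
  have hspeed : ∀ t ∉ S, (Real.pi + 2 * m) * elasticaSpeed (clampAngle m t) =
      elasticaSpeed (clampAngle m t) * clampAngleDeriv m t := fun t ht => by
    simp only [hS, mem_insert_iff, mem_singleton_iff, not_or] at ht
    by_cases hmem : t ∈ Ioo (m / (Real.pi + 2 * m)) ((Real.pi + m) / (Real.pi + 2 * m))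
    · rw [clampAngleDeriv, indicator_of_mem hmem, mul_comm]
    · have : clampAngle m t = 0 ∨ clampAngle m t = Real.pi := by
        rcases le_or_gt t (m / (Real.pi + 2 * m)) with h | h
        · exact Or.inl (clampAngle_of_le hm h)
        · exact Or.inr (clampAngle_of_ge hm (not_lt.1 fun h' => hmem ⟨h, h'⟩))
      rcases this with h | h <;> simp [h, elasticaSpeed]
  have hxc : Continuous fun t => elasticaWidth⁻¹ * (Real.pi + 2 * m) *
      elasticaSpeed (clampAngle m t) :=
    continuous_const.mul (continuous_elasticaSpeed.comp hθ)
  have hyc : Continuous fun t => elasticaWidth⁻¹ * (Real.pi + 2 * m) *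
      Real.cos (clampAngle m t) := by fun_prop
  have hddx : ∀ a b, IntegrableOn (fun t => elasticaWidth⁻¹ * (Real.pi + 2 * m) *
      (Real.sin (clampAngle m t) * Real.cos (clampAngle m t) *
      (2 + Real.sin (clampAngle m t) ^ 2) / Real.sqrt (1 + Real.sin (clampAngle m t) ^ 2) ^ 3) *
      clampAngleDeriv m t) (Icc a b) :=
    integrableOn_mul_clampAngleDeriv (continuous_const.mul ((by fun_prop : Continuous fun t =>
      Real.sin (clampAngle m t) * Real.cos (clampAngle m t) *
      (2 + Real.sin (clampAngle m t) ^ 2)).div (by fun_prop) fun t =>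
        pow_ne_zero 3 (Real.sqrt_pos.2 (one_add_sin_sq_pos _)).ne'))
  have hddy : ∀ a b, IntegrableOn (fun t => elasticaWidth⁻¹ * (Real.pi + 2 * m) *
      (-Real.sin (clampAngle m t)) * clampAngleDeriv m t) (Icc a b) :=
    integrableOn_mul_clampAngleDeriv (by fun_prop)
  have hx : ∀ a t, elasticaWidth⁻¹ * (∫ ω in (0:ℝ)..clampAngle m t, elasticaSpeed ω) =
      elasticaWidth⁻¹ * (∫ ω in (0:ℝ)..clampAngle m a, elasticaSpeed ω) + ∫ s in a..t,
        elasticaWidth⁻¹ * (Real.pi + 2 * m) * elasticaSpeed (clampAngle m s) := by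
    refine hftc (f := fun t => elasticaWidth⁻¹ * (∫ ω in (0:ℝ)..clampAngle m t, elasticaSpeed ω))
      (continuous_const.mul (hprimc.comp hθ)) (fun t ht => ?_)
      fun a b => hxc.continuousOn.integrableOn_Icc
    refine (((hprim _).comp t (hasDerivAt_clampAngle hm ht)).const_mul elasticaWidth⁻¹).congr_deriv
      ?_
    rw [mul_assoc, hspeed t ht]
  have hy := hftc (f := fun t => elasticaWidth⁻¹ * (m + (Real.sin (clampAngle m t) -
      |(Real.pi + 2 * m) * t - m - clampAngle m t|)))
      (f' := fun t => elasticaWidth⁻¹ * (Real.pi + 2 * m) * Real.cos (clampAngle m t))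
      (by fun_prop) (fun t ht => by
        rw [mul_assoc]
        exact ((hasDerivAt_abs_sub_clampAngle hm ht).const_add m).const_mul _)
      fun a b => hyc.continuousOn.integrableOn_Icc
  have hdx := hftc hxc (fun t ht =>
    (((hasDerivAt_elasticaSpeed _).comp t (hasDerivAt_clampAngle hm ht)).const_mul
      (elasticaWidth⁻¹ * (Real.pi + 2 * m))).congr_deriv (mul_assoc _ _ _).symm) hddx
  have hdy := hftc hyc (fun t ht =>
    (((Real.hasDerivAt_cos _).comp t (hasDerivAt_clampAngle hm ht)).const_mul
      (elasticaWidth⁻¹ * (Real.pi + 2 * m))).congr_deriv (mul_assoc _ _ _).symm) hddy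
  exact ⟨
    { x := _, y := _, dx := _, dy := _, ddx := _, ddy := _
      dx_int := hxc.continuousOn.integrableOn_Icc
      dy_int := hyc.continuousOn.integrableOn_Icc
      ftc_x := fun t _ => hx 0 t
      ftc_y := fun t _ => hy 0 t
      ddx_loc := fun a b _ _ => hddx a b
      ddy_loc := fun a b _ _ => hddy a b
      ftc_dx := fun a _ t _ => hdx a t
      ftc_dy := fun a _ t _ => hdy a t }, rfl, rfl, rfl, rfl, rfl, rfl⟩

theorem elastica_speed_sq (ω : ℝ) :
    elasticaSpeed ω ^ 2 + Real.cos ω ^ 2 = (1 + Real.sin ω ^ 2)⁻¹ := by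
  rw [elasticaSpeed, div_pow, Real.sq_sqrt (one_add_sin_sq_pos ω).le, Real.cos_sq']
  have := (one_add_sin_sq_pos ω).ne'
  field_simp
  ring

theorem elastica_integrand_eq {c d : ℝ} (hc : 0 < c) (ω : ℝ) :
    (c * elasticaSpeed ω * (c * (-Real.sin ω) * d) - c * Real.cos ω *
      (c * (Real.sin ω * Real.cos ω * (2 + Real.sin ω ^ 2) / Real.sqrt (1 + Real.sin ω ^ 2) ^ 3)
        * d)) ^ 2 / ((c * elasticaSpeed ω) ^ 2 + (c * Real.cos ω) ^ 2) ^ ((5:ℝ)/2) =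
      4 * d ^ 2 / c * elasticaSpeed ω := by
  have hq := one_add_sin_sq_pos ω
  have hr := Real.sqrt_pos.2 hq
  have h2 := Real.sq_sqrt hq.le
  have hcos := Real.cos_sq' ω
  have hden : ((c * elasticaSpeed ω) ^ 2 + (c * Real.cos ω) ^ 2) ^ ((5:ℝ)/2) =
      (c / Real.sqrt (1 + Real.sin ω ^ 2)) ^ 5 := by
    rw [mul_pow, mul_pow, ← mul_add, elastica_speed_sq, ← h2, ← inv_pow, ← mul_pow,
      ← Real.rpow_natCast, ← Real.rpow_mul (by positivity), ← Real.rpow_natCast, ← div_eq_mul_inv,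
      Real.sqrt_sq (Real.sqrt_nonneg _)]
    norm_num
  have hnum : c * elasticaSpeed ω * (c * (-Real.sin ω) * d) - c * Real.cos ω *
      (c * (Real.sin ω * Real.cos ω * (2 + Real.sin ω ^ 2) / Real.sqrt (1 + Real.sin ω ^ 2) ^ 3)
        * d) = -(2 * c ^ 2 * d * Real.sin ω / Real.sqrt (1 + Real.sin ω ^ 2) ^ 3) := by
    rw [elasticaSpeed]
    set r := Real.sqrt (1 + Real.sin ω ^ 2)
    field_simp
    rw [h2, hcos]
    ring
  rw [hden, hnum, elasticaSpeed]
  set r := Real.sqrt (1 + Real.sin ω ^ 2)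
  field_simp
  ring

/-- Every admissible obstacle admits a concave cap of energy at most `c₀²`. -/
theorem exists_cap_elE_le {ψ : ℝ → ℝ} (hψ : Admissible ψ) :
    ∃ (γ : Curve) (β₁ β₂ : ℝ) (u du ddu : ℝ → ℝ),
      MemP ψ γ ∧ CapShaped γ β₁ β₂ u du ddu ∧ ConcaveOn ℝ (Ioo (0:ℝ) 1) u ∧
      elE γ ≤ ENNReal.ofReal (c0 ^ 2) := by
  have hpi := Real.pi_pos
  have hW := elasticaWidth_pos
  obtain ⟨M, hM⟩ := isCompact_Icc.exists_bound_of_continuousOn hψ.cont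
  have hM0 : 0 ≤ M := (norm_nonneg _).trans (hM 0 ⟨le_rfl, zero_le_one⟩)
  obtain ⟨m, hm, hmM⟩ : ∃ m, 0 < m ∧ M ≤ elasticaWidth⁻¹ * m :=
    ⟨elasticaWidth * (M + 1), by positivity, by rw [inv_mul_cancel_left₀ hW.ne']; linarith⟩
  obtain ⟨γ, hx, hy, hdx, hdy, hddx, hddy⟩ := exists_elastica_curve hm
  set β₁ := m / (Real.pi + 2 * m) with hβ₁
  set β₂ := (Real.pi + m) / (Real.pi + 2 * m) with hβ₂
  have hlam : 0 < Real.pi + 2 * m := by positivity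
  set c := elasticaWidth⁻¹ * (Real.pi + 2 * m) with hc
  have hc0 : 0 < c := by positivity
  have hβ1 : 0 ≤ β₁ := by positivity
  have hβ12 : β₁ < β₂ := div_lt_div_of_pos_right (by linarith) hlam
  have hβ2 : β₂ ≤ 1 := (div_le_one hlam).2 (by linarith)
  have hsub : Ioo β₁ β₂ ⊆ Ioo 0 1 := Ioo_subset_Ioo hβ1 hβ2
  have hleft : ∀ t ≤ β₁, γ.x t = 0 := fun t ht => by
    rw [hx]; simp [clampAngle_of_le hm ht]
  have hright : ∀ t, β₂ ≤ t → γ.x t = 1 := fun t ht => by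
    simp only [hx, clampAngle_of_ge hm ht]
    exact inv_mul_cancel₀ hW.ne'
  have hdx0 : ∀ t, 0 ≤ γ.dx t := fun t => by
    rw [hdx]; exact mul_nonneg hc0.le (elasticaSpeed_nonneg _)
  have hsin : ∀ t ∈ Ioo β₁ β₂, 0 < Real.sin (clampAngle m t) := fun t ht =>
    Real.sin_pos_of_mem_Ioo (clampAngle_mem_Ioo hm ht)
  have hdxpos : ∀ t ∈ Ioo β₁ β₂, 0 < γ.dx t := fun t ht => by
    rw [hdx]; exact mul_pos hc0 (elasticaSpeed_pos (hsin t ht))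
  have him : γ.Immersed := by
    refine ⟨c / 2, by positivity, fun t _ => Real.lt_sqrt_of_sq_lt ?_⟩
    simp only [hdx, hdy]
    rw [mul_pow c, mul_pow c, ← mul_add, elastica_speed_sq, div_pow, div_eq_mul_inv]
    refine mul_lt_mul_of_pos_left ?_ (by positivity)
    have := Real.sin_sq_le_one (clampAngle m t)
    gcongr
    linarith
  have hP' : ∀ t ∈ Ioo β₁ β₂, HasDerivAt (fun t => elasticaSlope (clampAngle m t))
      (-(2 / (Real.sin (clampAngle m t) ^ 3 * Real.sqrt (1 + Real.sin (clampAngle m t) ^ 2))) *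
        (Real.pi + 2 * m)) t := fun t ht => by
    have := hasDerivAt_clampAngle (t := t) hm (by
      simp only [mem_insert_iff, mem_singleton_iff, not_or]
      exact ⟨ht.1.ne', ht.2.ne⟩)
    rw [clampAngleDeriv, indicator_of_mem (show t ∈ Ioo _ _ from ht)] at this
    exact (hasDerivAt_elasticaSlope (hsin t ht)).comp t this
  have hPanti : AntitoneOn (fun t => elasticaSlope (clampAngle m t)) (Ioo β₁ β₂) := by
    refine antitoneOn_of_deriv_nonpos (convex_Ioo _ _)
      (fun t ht => (hP' t ht).continuousAt.continuousWithinAt) ?_ ?_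
    · rw [interior_Ioo]
      exact fun t ht => (hP' t ht).differentiableAt.differentiableWithinAt
    · rw [interior_Ioo]
      intro t ht
      rw [(hP' t ht).deriv]
      have := hsin t ht
      exact mul_nonpos_of_nonpos_of_nonneg (neg_nonpos.2 (by positivity)) hlam.le
  have hPloc : ∀ a b, β₁ < a → a ≤ b → b < β₂ → ∃ Ψ : ℝ → ℝ, MonotoneOn Ψ (Icc a b) ∧
      ∀ s ∈ Icc a b, ∀ t ∈ Icc a b, s ≤ t →
        (elasticaSlope (clampAngle m t) - elasticaSlope (clampAngle m s)) ^ 2 ≤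
          (t - s) * (Ψ t - Ψ s) := by
    intro a b ha hab hb
    have hss : Icc a b ⊆ Ioo β₁ β₂ := fun t ht => ⟨ha.trans_le ht.1, ht.2.trans_lt hb⟩
    have hθ := continuous_clampAngle m
    have hcont : ContinuousOn (fun t => -(2 / (Real.sin (clampAngle m t) ^ 3 *
        Real.sqrt (1 + Real.sin (clampAngle m t) ^ 2))) * (Real.pi + 2 * m)) (Icc a b) := by
      refine ((continuousOn_const.div (by fun_prop) fun t ht => ?_).neg).mul continuousOn_const
      have := hsin t (hss ht)
      positivity
    obtain ⟨C, hC⟩ := isCompact_Icc.exists_bound_of_continuousOn hcont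
    refine ⟨fun t => C ^ 2 * t, fun s _ t _ hst => by dsimp only; gcongr, fun s hs t ht hst => ?_⟩
    have hlip := (convex_Icc a b).norm_image_sub_le_of_norm_hasDerivWithin_le
      (fun t ht => (hP' t (hss ht)).hasDerivWithinAt) hC hs ht
    rw [Real.norm_eq_abs, Real.norm_eq_abs] at hlip
    have := pow_le_pow_left₀ (abs_nonneg _) hlip 2
    rw [sq_abs, mul_pow, sq_abs] at this
    linarith
  obtain ⟨u, du, ddu, hreg, hgraph, -, hconc, -⟩ := exists_graph_reparam
    (P := fun t => elasticaSlope (clampAngle m t)) hβ12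
    (γ.continuousOn_x.mono (Icc_subset_Icc hβ1 hβ2)) (hleft _ le_rfl) (hright _ le_rfl)
    (fun t ht => γ.hasDerivAt_x (hsub ht)) hdxpos (γ.continuousOn_dx.mono hsub)
    (y := γ.y) (fun t ht => by
      refine (γ.hasDerivAt_y (hsub ht)).congr_deriv ?_
      have h1 := hsin t ht
      have h2 := Real.sqrt_pos.2 (one_add_sin_sq_pos (clampAngle m t))
      rw [hdx, hdy]
      simp only [elasticaSlope, elasticaSpeed]
      field_simp) hPanti hPloc
  have hcap : CapShaped γ β₁ β₂ u du ddu :=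
    ⟨⟨hβ1, hβ12, hβ2⟩, fun t ht => hleft t ht.2, fun t ht => hright t ht.1, hdxpos, hgraph, hreg⟩
  have hx0 := hleft 0 hβ1
  have hx1 := hright 1 hβ2
  have hmono := γ.monotoneOn_x fun t _ => hdx0 t
  have hy0 : ∀ t ∈ Icc (0:ℝ) 1, |(Real.pi + 2 * m) * t - m - clampAngle m t| ≤ m ∧
      (t ∈ Icc β₁ β₂ → |(Real.pi + 2 * m) * t - m - clampAngle m t| = 0) := by
    intro t ht
    have hin : t ∈ Icc β₁ β₂ → |(Real.pi + 2 * m) * t - m - clampAngle m t| = 0 := fun h => by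
      rw [clampAngle_of_mem hm h]; simp
    refine ⟨?_, hin⟩
    rcases le_or_gt t β₁ with h1 | h1
    · have h1' := (le_div_iff₀ hlam).1 h1
      rw [clampAngle_of_le hm h1, abs_le]
      constructor <;> nlinarith [ht.1]
    rcases le_or_gt β₂ t with h2 | h2
    · have h2' := (div_le_iff₀ hlam).1 h2
      rw [clampAngle_of_ge hm h2, abs_le]
      constructor <;> nlinarith [ht.2]
    · rw [hin ⟨h1.le, h2.le⟩]
      exact hm.le
  have hsin0 : ∀ t, 0 ≤ Real.sin (clampAngle m t) := fun t =>
    Real.sin_nonneg_of_mem_Icc (clampAngle_mem m t)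
  have hynn : ∀ t ∈ Icc (0:ℝ) 1, 0 ≤ γ.y t := fun t ht => by
    rw [hy]
    exact mul_nonneg (by positivity) (by linarith [hsin0 t, (hy0 t ht).1])
  refine ⟨γ, β₁, β₂, u, du, ddu, ⟨hcap.pseudograph him fun t _ => hdx0 t, hx0, ?_, hx1, ?_,
    fun t ht => ?_⟩, hcap, hconc, ?_⟩
  · simp only [hy, clampAngle_of_le hm hβ1]
    simp [abs_of_pos hm]
  · simp only [hy, clampAngle_of_ge hm hβ2]
    rw [show (Real.pi + 2 * m) * 1 - m - Real.pi = m by ring, abs_of_pos hm]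
    simp
  · rcases le_or_gt t β₁ with h1 | h1
    · rw [hleft t h1]
      exact hψ.neg0.le.trans (hynn t ht)
    rcases le_or_gt β₂ t with h2 | h2
    · rw [hright t h2]
      exact hψ.neg1.le.trans (hynn t ht)
    · have hxt : γ.x t ∈ Icc (0:ℝ) 1 :=
        ⟨hx0 ▸ hmono ⟨le_rfl, zero_le_one⟩ ht ht.1, hx1 ▸ hmono ht ⟨zero_le_one, le_rfl⟩ ht.2⟩
      refine (le_abs_self _).trans ((hM _ hxt).trans (hmM.trans ?_))
      rw [hy]
      refine mul_le_mul_of_nonneg_left ?_ (by positivity)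
      linarith [hsin0 t, (hy0 t ht).2 ⟨h1.le, h2.le⟩]
  · have hle : ∀ t, elInt γ t ≤ 4 * elasticaWidth ^ 2 * γ.dx t := fun t => by
      simp only [elInt, hdx, hdy, hddx, hddy]
      rw [elastica_integrand_eq hc0, ← mul_assoc]
      refine mul_le_mul_of_nonneg_right ?_ (elasticaSpeed_nonneg _)
      have hd : clampAngleDeriv m t ^ 2 ≤ (Real.pi + 2 * m) ^ 2 := by
        rw [clampAngleDeriv, indicator]
        split_ifs
        · exact le_rfl
        · rw [zero_pow two_ne_zero]; positivity
      rw [div_le_iff₀ hc0, hc]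
      have : 4 * elasticaWidth ^ 2 * (elasticaWidth⁻¹ * (Real.pi + 2 * m)) *
          (elasticaWidth⁻¹ * (Real.pi + 2 * m)) = 4 * (Real.pi + 2 * m) ^ 2 := by
        field_simp
      linarith
    have h_int : IntegrableOn (fun t => 4 * elasticaWidth ^ 2 * γ.dx t) (Ioo 0 1) :=
      (γ.dx_int.mono_set Ioo_subset_Icc_self).const_mul _
    calc elE γ ≤ ∫⁻ t in Ioo (0:ℝ) 1, ENNReal.ofReal (4 * elasticaWidth ^ 2 * γ.dx t) :=
          lintegral_mono fun t => ENNReal.ofReal_le_ofReal (hle t)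
      _ = ENNReal.ofReal (∫ t in Ioo (0:ℝ) 1, 4 * elasticaWidth ^ 2 * γ.dx t) :=
          (ofReal_integral_eq_lintegral_ofReal h_int
            (Eventually.of_forall fun t => mul_nonneg (by positivity) (hdx0 t))).symm
      _ = ENNReal.ofReal (4 * elasticaWidth ^ 2) := by
          rw [integral_const_mul, ← integral_Ioc_eq_integral_Ioo,
            ← intervalIntegral.integral_of_le zero_le_one,
            γ.integral_dx ⟨le_rfl, zero_le_one⟩ ⟨zero_le_one, le_rfl⟩, hx0, hx1]
          norm_num
      _ ≤ ENNReal.ofReal (c0 ^ 2) := ENNReal.ofReal_le_ofReal (by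
          nlinarith [two_mul_elasticaWidth_le])

/-- Main existence theorem. -/
theorem stmt2 (ψ : ℝ → ℝ) (hψ : Admissible ψ) :
    -- (i) existence of a ∩-shaped minimizer, concave on the top
    (∃ (γ : Curve) (β₁ β₂ : ℝ) (u du ddu : ℝ → ℝ),
      MemP ψ γ ∧ CapShaped γ β₁ β₂ u du ddu ∧ ConcaveOn ℝ (Ioo (0:ℝ) 1) u ∧
      elE γ = infP ψ) ∧
    -- (ii) α ≤ c₀²
    infP ψ ≤ ENNReal.ofReal (c0^2) ∧
    -- (iii) length bound and at most one vertical tangent if α < c₀²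
    (infP ψ < ENNReal.ofReal (c0^2) →
      ∃ (γ : Curve) (β₁ β₂ : ℝ) (u du ddu : ℝ → ℝ),
        MemP ψ γ ∧ CapShaped γ β₁ β₂ u du ddu ∧ ConcaveOn ℝ (Ioo (0:ℝ) 1) u ∧
        elE γ = infP ψ ∧
        lenE γ ≤ ENNReal.ofReal (max
          (2 * (sSup (ψ '' Ioo 0 1) + obstNorm ψ) + 1)
          (Ginv (Real.sqrt (((infP ψ).toReal + c0^2) / 2) - c0 / 2) +
            Real.sqrt (1 + (Ginv (Real.sqrt (((infP ψ).toReal + c0^2) / 2) - c0 / 2))^2))) ∧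
        ((∃ d : ℝ, Tendsto du (𝓝[>] (0:ℝ)) (𝓝 d)) ∨
          (∃ d : ℝ, Tendsto du (𝓝[<] (1:ℝ)) (𝓝 d)))) := by
  obtain ⟨γ, β₁, β₂, u, du, ddu, h1, h2, h3, h4⟩ := exists_cap_elE_le hψ
  have hinf : infP ψ ≤ elE γ := sInf_le ⟨γ, h1, rfl⟩
  have hiii : infP ψ < ENNReal.ofReal (c0 ^ 2) → _ := fun hlt =>
    have hfin := hlt.ne_top
    have hthr := Ginv_threshold ENNReal.toReal_nonneg ((ENNReal.lt_ofReal_iff_toReal_lt hfin).1 hlt)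
    exists_cap_of_infP_lt hψ hthr.1 hfin hthr.2
  refine ⟨?_, hinf.trans h4, fun hlt => ?_⟩
  · rcases (hinf.trans h4).lt_or_eq with hlt | heq
    · obtain ⟨γ, β₁, β₂, u, du, ddu, k1, k2, k3, k4, -⟩ := hiii hlt
      exact ⟨γ, β₁, β₂, u, du, ddu, k1, k2, k3, k4⟩
    · exact ⟨γ, β₁, β₂, u, du, ddu, h1, h2, h3, (h4.trans_eq heq.symm).antisymm hinf⟩
  · obtain ⟨γ, β₁, β₂, u, du, ddu, k1, k2, k3, k4, k5, k6⟩ := hiii hlt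
    exact ⟨γ, β₁, β₂, u, du, ddu, k1, k2, k3, k4,
      k5.trans (ENNReal.ofReal_le_ofReal (le_max_right _ _)), k6⟩
end
end

section
/- Let ψ be an admissible obstacle. Then inf_{u ∈ G_ψ} E(u) ≤ c₀², where c₀ = ∫_{-∞}^{∞} (1+s²)^{-5/4} ds. -/
open MeasureTheory Set Topology Filter

noncomputable section

/-- For `0 < B`, the function `G` agrees on `[-B, B]` with an increasing `C¹` bijection of `ℝ`;
this is the inverse of the latter. -/
theorem exists_odd_monotone_inverse_Gfun {B : ℝ} (hB : 0 < B) :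
    ∃ H : ℝ → ℝ, (∀ y, H (-y) = -H y) ∧ Monotone H ∧ H 0 = 0 ∧ H (Gfun B) = B ∧
      ∀ y, HasDerivAt H ((1 + min (H y ^ 2) (B ^ 2)) ^ ((5:ℝ)/4)) y := by
  set w : ℝ → ℝ := fun s => (1 + min (s ^ 2) (B ^ 2)) ^ (-(5:ℝ)/4) with hw
  have hbase : ∀ s : ℝ, 0 < 1 + min (s ^ 2) (B ^ 2) := fun s => by positivity
  have hwc : Continuous w := by
    refine Continuous.rpow_const (by fun_prop) fun s => Or.inl (hbase s).ne'
  have hwpos : ∀ s, 0 < w s := fun s => Real.rpow_pos_of_pos (hbase s) _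
  set F : ℝ → ℝ := fun x => ∫ s in (0:ℝ)..x, w s with hF
  have hFd : ∀ x, HasDerivAt F (w x) x := fun x => (hwc.integral_hasStrictDerivAt 0 x).hasDerivAt
  have hFm : StrictMono F := strictMono_of_hasDerivAt_pos hFd hwpos
  have hFc : Continuous F := continuous_iff_continuousAt.2 fun x => (hFd x).continuousAt
  have hF0 : F 0 = 0 := by simp [hF]
  have hodd : ∀ x, F (-x) = -F x := by
    intro x
    have h := intervalIntegral.integral_comp_neg (a := (0:ℝ)) (b := x) w
    have hwe : ∀ s, w (-s) = w s := fun s => by simp [hw]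
    simp only [hwe, neg_zero] at h
    rw [hF]
    simp only
    rw [h, intervalIntegral.integral_symm]
  set m : ℝ := (1 + B ^ 2) ^ (-(5:ℝ)/4) with hm
  have hmpos : 0 < m := by positivity
  have hmw : ∀ s, m ≤ w s := fun s =>
    Real.rpow_le_rpow_of_nonpos (hbase s) (by gcongr; exact min_le_right _ _) (by norm_num)
  have hge : ∀ x, 0 ≤ x → m * x ≤ F x := by
    intro x hx
    have h := intervalIntegral.integral_mono_on (a := 0) (b := x) hx
      (intervalIntegrable_const (μ := volume) (c := m)) (hwc.intervalIntegrable 0 x) fun s _ => hmw s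
    simpa [mul_comm] using h
  have htop : Tendsto F atTop atTop :=
    tendsto_atTop_mono' atTop ((eventually_ge_atTop 0).mono hge)
      (tendsto_id.const_mul_atTop hmpos)
  have hbot : Tendsto F atBot atBot := by
    have h := tendsto_neg_atTop_atBot.comp (htop.comp tendsto_neg_atBot_atTop)
    refine h.congr fun x => ?_
    simp [hodd]
  have hsurj : Function.Surjective F := hFc.surjective htop hbot
  set e := hFm.orderIsoOfSurjective F hsurj
  have hFe : ∀ y, F (e.symm y) = y := fun y => e.apply_symm_apply y
  have heq : ∀ x, e.symm (F x) = x := fun x => e.symm_apply_apply x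
  have hGF : Gfun B = F B := by
    refine intervalIntegral.integral_congr fun s hs => ?_
    rw [uIcc_of_le hB.le] at hs
    have : s ^ 2 ≤ B ^ 2 := by gcongr <;> simp_all
    simp [hw, min_eq_left this]
  refine ⟨e.symm, fun y => ?_, e.symm.monotone, ?_, ?_, fun y => ?_⟩
  · conv_lhs => rw [← hFe y, ← hodd, heq]
  · conv_lhs => rw [← hF0, heq]
  · rw [hGF, heq]
  · have h := HasDerivAt.of_local_left_inverse (e.symm.continuous.continuousAt (x := y))
      (hFd (e.symm y)) (hwpos _).ne' (Eventually.of_forall hFe)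
    simp only [hw] at h
    rwa [neg_div, Real.rpow_neg (hbase _).le, inv_inv] at h

theorem two_mul_Gfun_le_c0 {B : ℝ} (hB : 0 ≤ B) : 2 * Gfun B ≤ c0 := by
  have hint : Integrable (fun s : ℝ => ((1 + s^2) ^ (-(5:ℝ)/4) : ℝ)) := by
    have h := integrable_rpow_neg_one_add_norm_sq (E := ℝ) (μ := volume) (r := 5/2)
      (by norm_num)
    refine h.congr (Eventually.of_forall fun s => ?_)
    simp only [Real.norm_eq_abs, sq_abs]
    norm_num
  have hneg : Gfun B = ∫ s in (-B)..0, ((1 + s^2) ^ (-(5:ℝ)/4) : ℝ) := by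
    have h := intervalIntegral.integral_comp_neg (a := (0:ℝ)) (b := B)
      (fun s : ℝ => ((1 + s^2) ^ (-(5:ℝ)/4) : ℝ))
    simpa [Gfun] using h
  have hsum : 2 * Gfun B = ∫ s in (-B)..B, ((1 + s^2) ^ (-(5:ℝ)/4) : ℝ) := by
    rw [← intervalIntegral.integral_add_adjacent_intervals (b := 0)
      hint.intervalIntegrable hint.intervalIntegrable, ← hneg, two_mul, Gfun]
  rw [hsum, intervalIntegral.integral_of_le (by linarith), c0]
  exact setIntegral_le_integral hint (Eventually.of_forall fun s => by positivity)

theorem Gfun_pos {B : ℝ} (hB : 0 < B) : 0 < Gfun B := by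
  refine intervalIntegral.intervalIntegral_pos_of_pos (Continuous.intervalIntegrable ?_ _ _)
    (fun s => by positivity) hB
  exact Continuous.rpow_const (by fun_prop) fun s => Or.inl (by positivity)

theorem graphE_nonneg (f : W22) : 0 ≤ graphE f :=
  integral_nonneg fun x => by positivity

/-- A symmetric cap: slope `B` on `[0, δ]`, slope `-B` on `[1 - δ, 1]`, and `G ∘ u'` affine in
between. -/
theorem exists_cap {δ B : ℝ} (hδ : 0 < δ) (hδ' : δ < 1/2) (hB : 0 < B) :
    ∃ f : W22, f.u 0 = 0 ∧ f.u 1 = 0 ∧ (∀ x ∈ Icc (0:ℝ) 1, 0 ≤ f.u x) ∧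
      (∀ x ∈ Icc δ (1 - δ), B * δ ≤ f.u x) ∧
      graphE f = (2 * Gfun B) ^ 2 / (1 - 2 * δ) := by
  obtain ⟨H, Hodd, Hmono, H0, HG, Hd⟩ := exists_odd_monotone_inverse_Gfun hB
  have hg := Gfun_pos hB
  set g := Gfun B
  set k : ℝ := g / (1/2 - δ) with hk
  have hden : 0 < 1/2 - δ := by linarith
  have hkpos : 0 < k := by positivity
  have hkd : k * (1/2 - δ) = g := div_mul_cancel₀ _ hden.ne'
  set c : ℝ → ℝ := fun x => max (-g) (min g (k * (1/2 - x))) with hc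
  set c' : ℝ → ℝ := (Ioo δ (1 - δ)).indicator fun _ => -k with hc'
  have hcc : Continuous c := by fun_prop
  have hc_left : ∀ x, x ≤ δ → c x = g := by
    intro x hx
    have : g ≤ k * (1/2 - x) := by rw [← hkd]; gcongr
    rw [hc]; simp only
    rw [min_eq_left this, max_eq_right (by linarith)]
  have hc_right : ∀ x, 1 - δ ≤ x → c x = -g := by
    intro x hx
    have : k * (1/2 - x) ≤ -g := by rw [← hkd]; nlinarith
    rw [hc]; simp only
    rw [min_eq_right (by linarith), max_eq_left this]
  have hc_mid : ∀ x ∈ Ioo δ (1 - δ), c x = k * (1/2 - x) := by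
    intro x hx
    have h1 : k * (1/2 - x) ≤ g := by rw [← hkd]; gcongr; exact hx.1.le
    have h2 : -g ≤ k * (1/2 - x) := by rw [← hkd]; nlinarith [hx.2]
    rw [hc]; simp only
    rw [min_eq_right h1, max_eq_right h2]
  have hcd : ∀ x, x ≠ δ → x ≠ 1 - δ → HasDerivAt c (c' x) x := by
    intro x h1 h2
    rcases lt_or_gt_of_ne h1 with h | h
    · have hx : x ∉ Ioo δ (1 - δ) := fun hx => by linarith [hx.1]
      rw [hc', indicator_of_notMem hx]
      refine (hasDerivAt_const x g).congr_of_eventuallyEq ?_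
      filter_upwards [Iio_mem_nhds h] with y hy using hc_left y (le_of_lt hy)
    rcases lt_or_gt_of_ne h2 with h' | h'
    · rw [hc', indicator_of_mem (show x ∈ Ioo δ (1 - δ) from ⟨h, h'⟩)]
      have hlin : HasDerivAt (fun y : ℝ => k * (1/2 - y)) (-k) x := by
        simpa only [mul_neg_one, id] using ((hasDerivAt_id x).const_sub (1/2)).const_mul k
      refine hlin.congr_of_eventuallyEq ?_
      filter_upwards [Ioo_mem_nhds h h'] with y hy using hc_mid y hy
    · have hx : x ∉ Ioo δ (1 - δ) := fun hx => by linarith [hx.2]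
      rw [hc', indicator_of_notMem hx]
      refine (hasDerivAt_const x (-g)).congr_of_eventuallyEq ?_
      filter_upwards [Ioi_mem_nhds h'] with y hy using hc_right y (le_of_lt hy)
  have hc_symm : ∀ x, c (1 - x) = -c x := by
    intro x
    have hx : k * (1/2 - (1 - x)) = -(k * (1/2 - x)) := by ring
    rw [hc]; simp only
    rw [hx]
    generalize k * (1/2 - x) = t
    rcases le_total g t with h | h
    · rw [min_eq_left h, min_eq_right (by linarith), max_eq_left (by linarith),
        max_eq_right (by linarith)]
    · rw [min_eq_right h]
      rcases le_total (-g) t with h' | h'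
      · rw [min_eq_right (by linarith), max_eq_right (by linarith), max_eq_right h']
      · rw [min_eq_left (by linarith), max_eq_right (by linarith), max_eq_left h', neg_neg]
  have hc_nonneg : ∀ x, x ≤ 1/2 → 0 ≤ c x := fun x hx =>
    le_max_of_le_right (le_min hg.le (mul_nonneg hkpos.le (by linarith)))
  have hc_le : ∀ x, c x ≤ g := fun x => max_le (by linarith) (min_le_left _ _)
  have hc_ge : ∀ x, -g ≤ c x := fun x => le_max_left _ _
  have hHc : Continuous H := continuous_iff_continuousAt.2 fun y => (Hd y).continuousAt
  set du : ℝ → ℝ := fun x => H (c x) with hdu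
  set p : ℝ → ℝ := fun x => (1 + du x ^ 2) ^ ((5:ℝ)/4) with hp
  set ddu : ℝ → ℝ := fun x => p x * c' x with hddu
  have hduc : Continuous du := hHc.comp hcc
  have hpc : Continuous p :=
    Continuous.rpow_const (by fun_prop) fun s => Or.inl (by positivity)
  have hdu_sq : ∀ x, du x ^ 2 ≤ B ^ 2 := by
    intro x
    have h1 : du x ≤ B := HG ▸ Hmono (hc_le x)
    have h2 : -B ≤ du x := by
      have := Hmono (hc_ge x)
      rwa [Hodd, HG] at this
    exact sq_le_sq' h2 h1
  have hdud : ∀ x, x ≠ δ → x ≠ 1 - δ → HasDerivAt du (ddu x) x := by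
    intro x h1 h2
    have h := (Hd (c x)).comp x (hcd x h1 h2)
    rwa [min_eq_left (hdu_sq x)] at h
  have hc'_int : IntegrableOn c' (Icc (0:ℝ) 1) :=
    (integrableOn_const (by simp)).indicator measurableSet_Ioo
  have hddu_int : IntegrableOn ddu (Icc (0:ℝ) 1) :=
    hc'_int.continuousOn_mul hpc.continuousOn isCompact_Icc
  have hc'sq : (fun x => c' x ^ 2) = (Ioo δ (1 - δ)).indicator fun _ => k ^ 2 := by
    ext x
    by_cases hx : x ∈ Ioo δ (1 - δ)
    · simp only [hc', indicator_of_mem hx, neg_sq]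
    · simp [hc', indicator_of_notMem hx]
  have hddu_sq : IntegrableOn (fun x => ddu x ^ 2) (Icc (0:ℝ) 1) := by
    have h1 : IntegrableOn (fun x => c' x ^ 2) (Icc (0:ℝ) 1) := by
      rw [hc'sq]
      exact (integrableOn_const (by simp)).indicator measurableSet_Ioo
    have h2 := h1.continuousOn_mul (hpc.pow 2).continuousOn isCompact_Icc
    refine h2.congr_fun (fun x _ => ?_) measurableSet_Icc
    simp [hddu, mul_pow]
  have hftc : ∀ x ∈ Icc (0:ℝ) 1, du x = du 0 + ∫ s in (0:ℝ)..x, ddu s := by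
    intro x hx
    have hi : IntervalIntegrable ddu volume 0 x := by
      rw [intervalIntegrable_iff_integrableOn_Icc_of_le hx.1]
      exact hddu_int.mono_set (Icc_subset_Icc_right hx.2)
    have h := integral_eq_of_hasDerivAt_off_countable_of_le du ddu hx.1
      (s := {δ, 1 - δ}) (by simp) hduc.continuousOn
      (fun y hy => hdud y (fun h => hy.2 (by simp [h])) (fun h => hy.2 (by simp [h]))) hi
    linarith
  set u : ℝ → ℝ := fun x => ∫ s in (0:ℝ)..x, du s with hu
  have hii : ∀ a b, IntervalIntegrable du volume a b := fun a b => hduc.intervalIntegrable a b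
  have hu0 : u 0 = 0 := by simp [hu]
  have hdu_symm : ∀ x, du (1 - x) = -du x := fun x => by simp only [hdu, hc_symm, Hodd]
  have hu1 : u 1 = 0 := by
    have h1 := intervalIntegral.integral_comp_sub_left (a := (0:ℝ)) (b := 1) du 1
    simp only [hdu_symm, intervalIntegral.integral_neg, sub_zero, sub_self] at h1
    simp only [hu]
    linarith
  have hu_symm : ∀ x, u (1 - x) = u x := by
    intro x
    have h := intervalIntegral.integral_comp_sub_left (a := (0:ℝ)) (b := x) du 1
    simp only [hdu_symm, intervalIntegral.integral_neg, sub_zero] at h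
    have h' := intervalIntegral.integral_add_adjacent_intervals (hii 0 (1 - x)) (hii (1 - x) 1)
    simp only [hu] at hu1 ⊢
    linarith
  have hdu_nonneg : ∀ x, x ≤ 1/2 → 0 ≤ du x := fun x hx => H0 ▸ Hmono (hc_nonneg x hx)
  have hu_nonneg : ∀ x, 0 ≤ x → x ≤ 1/2 → 0 ≤ u x := fun x h0 h1 =>
    intervalIntegral.integral_nonneg h0 fun s hs => hdu_nonneg s (hs.2.trans h1)
  have huδ : u δ = B * δ := by
    have : u δ = ∫ _ in (0:ℝ)..δ, B := by
      refine intervalIntegral.integral_congr fun s hs => ?_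
      rw [uIcc_of_le hδ.le] at hs
      simp only [hdu, hc_left s hs.2, HG]
    rw [this]; simp [mul_comm]
  have hu_ge : ∀ x, δ ≤ x → x ≤ 1/2 → B * δ ≤ u x := by
    intro x h0 h1
    have h := intervalIntegral.integral_add_adjacent_intervals (hii 0 δ) (hii δ x)
    have h' : 0 ≤ ∫ s in δ..x, du s :=
      intervalIntegral.integral_nonneg h0 fun s hs => hdu_nonneg s (hs.2.trans h1)
    rw [← huδ]
    simp only [hu]
    linarith
  refine ⟨⟨u, du, ddu, hduc.continuousOn.integrableOn_Icc, hddu_int, hddu_sq,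
    fun x _ => by simp [hu], hftc⟩, hu0, hu1, fun x hx => ?_, fun x hx => ?_, ?_⟩
  · rcases le_total x (1/2) with h | h
    · exact hu_nonneg x hx.1 h
    · have := hu_nonneg (1 - x) (by linarith [hx.2]) (by linarith)
      rwa [hu_symm] at this
  · rcases le_total x (1/2) with h | h
    · exact hu_ge x hx.1 h
    · have := hu_ge (1 - x) (by linarith [hx.2]) (by linarith)
      rwa [hu_symm] at this
  · have hE : ∀ x, ddu x ^ 2 / (1 + du x ^ 2) ^ ((5:ℝ)/2) = c' x ^ 2 := by
      intro x
      have hpos : 0 < 1 + du x ^ 2 := by positivity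
      have hp2 : p x ^ 2 = (1 + du x ^ 2) ^ ((5:ℝ)/2) := by
        rw [hp]; simp only
        rw [← Real.rpow_natCast, ← Real.rpow_mul hpos.le]
        norm_num
      rw [hddu]; simp only
      rw [mul_pow, hp2, mul_div_cancel_left₀ _ (by positivity)]
    simp only [graphE, hE]
    rw [hc'sq, setIntegral_indicator measurableSet_Ioo,
      inter_eq_right.2 (Ioo_subset_Ioo hδ.le (by linarith)), setIntegral_const]
    rw [Measure.real, Real.volume_Ioo, ENNReal.toReal_ofReal (by linarith), smul_eq_mul, hk]
    rw [show 1 - δ - δ = 2 * (1/2 - δ) by ring, show 1 - 2 * δ = 2 * (1/2 - δ) by ring]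
    generalize 1/2 - δ = d at hden
    field_simp

/-- An obstacle that is continuous on `[0, 1]` and negative at the end points lies below graphs
of energy at most `c₀² / (1 - 2 δ)` for all small `δ`. -/
theorem exists_pos_forall_memG_graphE_le {ψ : ℝ → ℝ} (hψ : ContinuousOn ψ (Icc 0 1))
    (h0 : ψ 0 < 0) (h1 : ψ 1 < 0) :
    ∃ r > 0, ∀ δ ∈ Ioo 0 r, δ < 1/2 ∧ ∃ f : W22, MemG ψ f ∧ graphE f ≤ c0 ^ 2 / (1 - 2 * δ) := by
  obtain ⟨M, hM⟩ := isCompact_Icc.bddAbove_image hψ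
  obtain ⟨r₀, hr₀, hψ₀⟩ := Metric.mem_nhdsWithin_iff.1
    ((hψ 0 (by simp)).eventually (gt_mem_nhds h0))
  obtain ⟨r₁, hr₁, hψ₁⟩ := Metric.mem_nhdsWithin_iff.1
    ((hψ 1 (by simp)).eventually (gt_mem_nhds h1))
  refine ⟨min (1/2) (min r₀ r₁), by positivity, fun δ hδ => ?_⟩
  obtain ⟨hδ0, hδr⟩ := hδ
  obtain ⟨hδ2, hδr0, hδr1⟩ : δ < 1/2 ∧ δ < r₀ ∧ δ < r₁ := by simpa [lt_min_iff] using hδr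
  refine ⟨hδ2, ?_⟩
  have hB : 0 < (|M| + 1) / δ := by positivity
  obtain ⟨f, hf0, hf1, hfnn, hfge, hfE⟩ := exists_cap hδ0 hδ2 hB
  refine ⟨f, ⟨hf0, hf1, fun x hx => ?_⟩, ?_⟩
  · by_cases hxl : x < δ
    · have : ψ x < 0 := hψ₀ ⟨by
        rw [Metric.mem_ball, Real.dist_eq, abs_lt]; constructor <;> linarith [hx.1], hx⟩
      exact this.le.trans (hfnn x hx)
    by_cases hxr : 1 - δ < x
    · have : ψ x < 0 := hψ₁ ⟨by
        rw [Metric.mem_ball, Real.dist_eq, abs_lt]; constructor <;> linarith [hx.2], hx⟩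
      exact this.le.trans (hfnn x hx)
    have h := hfge x ⟨not_lt.1 hxl, not_lt.1 hxr⟩
    rw [div_mul_cancel₀ _ hδ0.ne'] at h
    have hMx : ψ x ≤ M := hM (mem_image_of_mem ψ hx)
    linarith [le_abs_self M]
  · rw [hfE]
    have : 0 < 1 - 2 * δ := by linarith
    have hg := Gfun_pos hB
    have := two_mul_Gfun_le_c0 hB.le
    gcongr

/-- An upper bound for the least possible energy: `inf_{G_ψ} E ≤ c₀²`. -/
theorem stmt4 (ψ : ℝ → ℝ) (hψ : Admissible ψ) :
    (∃ u : W22, MemG ψ u) ∧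
    sInf {e : ℝ | ∃ u : W22, MemG ψ u ∧ e = graphE u} ≤ c0^2 := by
  obtain ⟨r, hr, h⟩ := exists_pos_forall_memG_graphE_le hψ.cont hψ.neg0 hψ.neg1
  refine ⟨?_, ?_⟩
  · obtain ⟨-, f, hf, -⟩ := h (r / 2) ⟨by positivity, by linarith⟩
    exact ⟨f, hf⟩
  · have hlim : Tendsto (fun δ : ℝ => c0 ^ 2 / (1 - 2 * δ)) (𝓝[>] 0) (𝓝 (c0 ^ 2)) := by
      have : ContinuousAt (fun δ : ℝ => c0 ^ 2 / (1 - 2 * δ)) 0 := by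
        refine ContinuousAt.div (by fun_prop) (by fun_prop) (by norm_num)
      have h' := this.tendsto
      simp only [mul_zero, sub_zero, div_one] at h'
      exact h'.mono_left nhdsWithin_le_nhds
    refine ge_of_tendsto hlim ?_
    filter_upwards [Ioo_mem_nhdsGT hr] with δ hδ
    obtain ⟨-, f, hf, hfE⟩ := h δ hδ
    refine le_trans (csInf_le ⟨0, ?_⟩ ⟨f, hf, rfl⟩) hfE
    rintro e ⟨v, -, rfl⟩
    exact graphE_nonneg v
end
end
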